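/- For every Schwartz K'-invariant function G on ℝ³×ℝ there exists g̃ ∈ 𝒮(ℝ⁴) such that g̃(λ(2l+1)+r², λ², λr, r²) = ∫_{ℝ³×ℝ} G(x,t)·φ'_{λ,l,r}(x,t) dx dt for all λ>0, l∈ℕ, r∈ℝ, and g̃(ζ²+r², 0, 0, r²) = ∫_{ℝ³×ℝ} G(x,t)·φ'_{ζ,r}(x,t) dx dt for all ζ,r∈ℝ. Moreover, for every a∈ℕ there exist C>0 and a'∈ℕ (independent of G) such that g̃ can be chosen with ‖g̃‖_a ≤ C‖G‖_{a'}. -/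

import Mathlib

open MeasureTheory Complex Matrix

noncomputable section

/-- The orthogonal group `O(2)` as a set of 2×2 matrices. -/
def O2 : Set (Matrix (Fin 2) (Fin 2) ℝ) := {A | A * A.transpose = 1}

/-- The action of `A ∈ O(2)` on `ℝ³ × ℝ`:
`A·(x₁,x₂,x₃,t) = (A(x₁,x₂), (det A)x₃, (det A)t)`. -/
def KAct (A : Matrix (Fin 2) (Fin 2) ℝ) (p : (Fin 3 → ℝ) × ℝ) : (Fin 3 → ℝ) × ℝ :=
  (![A.mulVec ![p.1 0, p.1 1] 0, A.mulVec ![p.1 0, p.1 1] 1, A.det * p.1 2], A.det * p.2)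

/-- `K'`-invariance of a function on `ℝ³ × ℝ`. -/
def InvK' (G : (Fin 3 → ℝ) × ℝ → ℂ) : Prop := ∀ A ∈ O2, ∀ p, G (KAct A p) = G p

/-- The Laguerre function of order 0: `𝓛_l(u) = (1/l!) e^{u/2} (d/du)^l (u^l e^{-u})`. -/
def lag (l : ℕ) (u : ℝ) : ℝ :=
  (l.factorial : ℝ)⁻¹ * Real.exp (u / 2) * deriv^[l] (fun v : ℝ => v ^ l * Real.exp (-v)) u

/-- The regular bounded spherical functions of `(K' ⋉ N', K')`:
`φ'_{λ,l,r}(x,t) = cos(λt + r x₃) · 𝓛_l((λ/2)(x₁² + x₂²))`. -/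
def sph' (lam : ℝ) (l : ℕ) (r : ℝ) (p : (Fin 3 → ℝ) × ℝ) : ℝ :=
  Real.cos (lam * p.2 + r * p.1 2) * lag l (lam / 2 * ((p.1 0) ^ 2 + (p.1 1) ^ 2))

/-- The Bessel function of order 0: `J₀(z) = (1/π) ∫₀^π cos(z sin θ) dθ`. -/
def J0 (z : ℝ) : ℝ := (1 / Real.pi) * ∫ θ in (0:ℝ)..Real.pi, Real.cos (z * Real.sin θ)

/-- The singular bounded spherical functions of `(K' ⋉ N', K')`:
`φ'_{ζ,r}(x,t) = J₀(ζ √(x₁² + x₂²)) · cos(r x₃)`. -/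
def sphSing' (zeta r : ℝ) (p : (Fin 3 → ℝ) × ℝ) : ℝ :=
  J0 (zeta * Real.sqrt ((p.1 0) ^ 2 + (p.1 1) ^ 2)) * Real.cos (r * p.1 2)

/-- The Schwartz seminorm `‖f‖_a`, controlling `(1+|x|)^k |∂^n f(x)|` for all `k, n ≤ a`. -/
def SN {E : Type*} [NormedAddCommGroup E] [NormedSpace ℝ E] (a : ℕ)
    (f : SchwartzMap E ℂ) : ℝ :=
  ((Finset.Iic (a, a)).sup (schwartzSeminormFamily ℝ E ℂ)) f


/-- The spherical transform relations for the pair `(K' ⋉ N', K')`. -/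
def GT4Eq (G : SchwartzMap ((Fin 3 → ℝ) × ℝ) ℂ) (g : SchwartzMap (ℝ × ℝ × ℝ × ℝ) ℂ) : Prop :=
  (∀ lam > (0:ℝ), ∀ l : ℕ, ∀ r : ℝ,
    g (lam * (2 * l + 1) + r ^ 2, lam ^ 2, lam * r, r ^ 2)
      = ∫ p : (Fin 3 → ℝ) × ℝ, G p * (sph' lam l r p : ℂ)) ∧
  (∀ zeta r : ℝ,
    g (zeta ^ 2 + r ^ 2, 0, 0, r ^ 2)
      = ∫ p : (Fin 3 → ℝ) × ℝ, G p * (sphSing' zeta r p : ℂ))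

set_option linter.unusedSectionVars false
set_option linter.unusedSimpArgs false
set_option linter.unusedVariables false

section TGsec
variable {P Q E E2 : Type} [TopologicalSpace P] [TopologicalSpace Q]
  [NormedAddCommGroup E] [NormedSpace ℝ E] [NormedAddCommGroup E2] [NormedSpace ℝ E2]

def PB {F : Type} [NormedAddCommGroup F] (W : P → E → ℝ) (f : P → E → F) : Prop :=
  Continuous (fun q : P × E => f q.1 q.2) ∧ ∃ (C : ℝ) (k : ℕ), ∀ p x, ‖f p x‖ ≤ C * W p x ^ k

def TG (W : P → E → ℝ) : ℕ → ∀ {F : Type} [NormedAddCommGroup F] [NormedSpace ℝ F],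
    (P → E → F) → Prop
  | 0, _, _, _, f => PB W f
  | n+1, F, _, _, f => PB W f ∧ ∃ f' : P → E → (E →L[ℝ] F),
      (∀ p x, HasFDerivAt (f p) (f' p x) x) ∧ TG W n f'

variable {W : P → E → ℝ} {W2 : Q → E2 → ℝ}
variable {F G H : Type} [NormedAddCommGroup F] [NormedSpace ℝ F]
  [NormedAddCommGroup G] [NormedSpace ℝ G] [NormedAddCommGroup H] [NormedSpace ℝ H]

theorem TG.pb {n : ℕ} {f : P → E → F} (h : TG W n f) : PB W f := by
  cases n with
  | zero => exact h
  | succ n => exact h.1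

theorem TG.pred {n : ℕ} : ∀ {F : Type} [NormedAddCommGroup F] [NormedSpace ℝ F] {f : P → E → F},
    TG W (n+1) f → TG W n f := by
  induction n with
  | zero => intro F _ _ f h; exact h.1
  | succ n ih =>
    intro F _ _ f h
    obtain ⟨h1, f', h2, h3⟩ := h
    exact ⟨h1, f', h2, ih h3⟩

theorem PB.posC (hW : ∀ p x, 1 ≤ W p x) {f : P → E → F} (h : PB W f) :
    ∃ (C : ℝ) (k : ℕ), 0 ≤ C ∧ ∀ p x, ‖f p x‖ ≤ C * W p x ^ k := by
  obtain ⟨_, C, k, h⟩ := h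
  refine ⟨|C|, k, abs_nonneg _, fun p x => (h p x).trans ?_⟩
  have := hW p x
  gcongr
  exact le_abs_self C

theorem PB.add (hW : ∀ p x, 1 ≤ W p x) {f g : P → E → F} (hf : PB W f) (hg : PB W g) :
    PB W (fun p x => f p x + g p x) := by
  refine ⟨hf.1.add hg.1, ?_⟩
  obtain ⟨C, k, hC, h1⟩ := hf.posC hW
  obtain ⟨D, m, hD, h2⟩ := hg.posC hW
  refine ⟨C + D, k + m, fun p x => (norm_add_le _ _).trans ?_⟩
  have hw := hW p x
  calc _ ≤ C * W p x ^ k + D * W p x ^ m := add_le_add (h1 p x) (h2 p x)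
    _ ≤ C * W p x ^ (k+m) + D * W p x ^ (k+m) := by
      gcongr <;> first | exact hw | omega
    _ = _ := by ring

theorem PB.bilin (hW : ∀ p x, 1 ≤ W p x) (B : F →L[ℝ] G →L[ℝ] H) {f : P → E → F} {g : P → E → G}
    (hf : PB W f) (hg : PB W g) :
    PB W (fun p x => B (f p x) (g p x)) := by
  refine ⟨(B.continuous.comp hf.1).clm_apply hg.1, ?_⟩
  obtain ⟨C, k, hC, h1⟩ := hf.posC hW
  obtain ⟨D, m, hD, h2⟩ := hg.posC hW
  refine ⟨‖B‖ * C * D, k + m, fun p x => (B.le_opNorm₂ _ _).trans ?_⟩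
  have hw := hW p x
  calc _ ≤ ‖B‖ * (C * W p x ^ k) * (D * W p x ^ m) := by
        gcongr
        · exact h1 p x
        · exact h2 p x
    _ = _ := by ring

theorem PB.clm (hW : ∀ p x, 1 ≤ W p x) (L : F →L[ℝ] G) {f : P → E → F}
    (hf : PB W f) : PB W (fun p x => L (f p x)) := by
  refine ⟨L.continuous.comp hf.1, ?_⟩
  obtain ⟨C, k, hC, h1⟩ := hf.posC hW
  refine ⟨‖L‖ * C, k, fun p x => (L.le_opNorm _).trans ?_⟩
  have hw := hW p x
  calc _ ≤ ‖L‖ * (C * W p x ^ k) := by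
        gcongr
        · exact h1 p x
    _ = _ := by ring

theorem TG.add (hW : ∀ p x, 1 ≤ W p x) {n : ℕ} :
    ∀ {F : Type} [NormedAddCommGroup F] [NormedSpace ℝ F] {f g : P → E → F},
    TG W n f → TG W n g → TG W n (fun p x => f p x + g p x) := by
  induction n with
  | zero => intro F _ _ f g h1 h2; exact PB.add hW h1 h2
  | succ n ih =>
    intro F _ _ f g ⟨h1, f', h2, h3⟩ ⟨g1, g', g2, g3⟩
    exact ⟨h1.add hW g1, fun p x => f' p x + g' p x, fun p x => (h2 p x).add (g2 p x), ih h3 g3⟩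

theorem TG.clm (hW : ∀ p x, 1 ≤ W p x) {n : ℕ} :
    ∀ {F G : Type} [NormedAddCommGroup F] [NormedSpace ℝ F] [NormedAddCommGroup G] [NormedSpace ℝ G]
    (L : F →L[ℝ] G) {f : P → E → F}, TG W n f → TG W n (fun p x => L (f p x)) := by
  induction n with
  | zero => intro F G _ _ _ _ L f h1; exact PB.clm hW L h1
  | succ n ih =>
    intro F G _ _ _ _ L f ⟨h1, f', h2, h3⟩
    refine ⟨h1.clm hW L, fun p x => L.comp (f' p x), fun p x => L.hasFDerivAt.comp x (h2 p x), ?_⟩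
    exact ih (ContinuousLinearMap.compL ℝ E F G L) h3

theorem TG.bilin (hW : ∀ p x, 1 ≤ W p x) {n : ℕ} :
    ∀ {F G H : Type} [NormedAddCommGroup F] [NormedSpace ℝ F] [NormedAddCommGroup G] [NormedSpace ℝ G]
     [NormedAddCommGroup H] [NormedSpace ℝ H]
    (B : F →L[ℝ] G →L[ℝ] H) {f : P → E → F} {g : P → E → G}, TG W n f → TG W n g →
      TG W n (fun p x => B (f p x) (g p x)) := by
  induction n with
  | zero => intro F G H _ _ _ _ _ _ B f g h1 h2; exact PB.bilin hW B h1 h2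
  | succ n ih =>
    intro F G H _ _ _ _ _ _ B f g hf hg
    have hf0 := hf.pred
    have hg0 := hg.pred
    obtain ⟨h1, f', h2, h3⟩ := hf
    obtain ⟨g1, g', g2, g3⟩ := hg
    refine ⟨h1.bilin hW B g1, fun p x => B.precompR E (f p x) (g' p x) + B.precompL E (f' p x) (g p x),
      fun p x => B.hasFDerivAt_of_bilinear (h2 p x) (g2 p x), ?_⟩
    exact (ih (B.precompR E) hf0 g3).add hW (ih (B.precompL E) h3 hg0)

theorem PB.const_x {φ : P → F} (hφ : Continuous φ) (hb : ∃ (C : ℝ) (k : ℕ), ∀ p x, ‖φ p‖ ≤ C * W p x ^ k) :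
    PB W (fun p _ => φ p) := ⟨hφ.comp continuous_fst, hb⟩

theorem TG.const_zero {n : ℕ} :
    ∀ {F : Type} [NormedAddCommGroup F] [NormedSpace ℝ F], TG W n (fun _ _ => (0:F)) := by
  induction n with
  | zero => intro F _ _; exact ⟨continuous_const, 0, 0, by simp⟩
  | succ n ih =>
    intro F _ _
    exact ⟨⟨continuous_const, 0, 0, by simp⟩, fun _ _ => 0, fun p x => hasFDerivAt_const _ _, ih⟩

theorem TG.const_x {n : ℕ} {φ : P → F} (hφ : Continuous φ)
    (hb : ∃ (C : ℝ) (k : ℕ), ∀ p x, ‖φ p‖ ≤ C * W p x ^ k) :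
    TG W n (fun p _ => φ p) := by
  cases n with
  | zero => exact PB.const_x hφ hb
  | succ n => exact ⟨PB.const_x hφ hb, fun _ _ => 0, fun p x => hasFDerivAt_const _ _, TG.const_zero⟩

theorem TG.const {n : ℕ} (c : F) : TG W n (fun _ _ => c) :=
  TG.const_x continuous_const ⟨‖c‖, 0, by simp⟩

theorem TG.lin {n : ℕ} (L : E →L[ℝ] F) (hx : ∃ (C : ℝ) (k : ℕ), 0 ≤ C ∧ ∀ p x, ‖x‖ ≤ C * W p x ^ k) :
    TG W n (fun _ x => L x) := by
  have : PB W (fun (_:P) x => L x) := by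
    refine ⟨L.continuous.comp continuous_snd, ?_⟩
    obtain ⟨C, k, hC, h⟩ := hx
    refine ⟨‖L‖ * C, k, fun p x => (L.le_opNorm _).trans ?_⟩
    rw [mul_assoc]
    gcongr
    exact h p x
  cases n with
  | zero => exact this
  | succ n => exact ⟨this, fun _ _ => L, fun p x => L.hasFDerivAt, TG.const L⟩

theorem TG.mul (hW : ∀ p x, 1 ≤ W p x) {A : Type} [NormedRing A] [NormedAlgebra ℝ A] {n : ℕ}
    {f g : P → E → A} (hf : TG W n f) (hg : TG W n g) : TG W n (fun p x => f p x * g p x) :=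
  TG.bilin hW (ContinuousLinearMap.mul ℝ A) hf hg

theorem TG.smul (hW : ∀ p x, 1 ≤ W p x) {n : ℕ}
    {f : P → E → ℝ} {g : P → E → F} (hf : TG W n f) (hg : TG W n g) : TG W n (fun p x => f p x • g p x) :=
  TG.bilin hW (ContinuousLinearMap.lsmul ℝ ℝ) hf hg

theorem TG.neg (hW : ∀ p x, 1 ≤ W p x) {n : ℕ}
    {f : P → E → F} (hf : TG W n f) : TG W n (fun p x => - f p x) :=
  TG.clm hW (-ContinuousLinearMap.id ℝ F) hf

theorem TG.sub (hW : ∀ p x, 1 ≤ W p x) {n : ℕ}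
    {f g : P → E → F} (hf : TG W n f) (hg : TG W n g) : TG W n (fun p x => f p x - g p x) := by
  simpa [sub_eq_add_neg] using hf.add hW (hg.neg hW)

theorem TG.pow (hW : ∀ p x, 1 ≤ W p x) {A : Type} [NormedRing A] [NormedAlgebra ℝ A] {n : ℕ}
    {f : P → E → A} (hf : TG W n f) (k : ℕ) : TG W n (fun p x => f p x ^ k) := by
  induction k with
  | zero => simpa using TG.const (1:A)
  | succ k ih => simpa [pow_succ] using ih.mul hW hf

theorem TG.congr {n : ℕ} {f g : P → E → F} (hf : TG W n f) (h : ∀ p x, f p x = g p x) : TG W n g := by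
  have : f = g := by ext p x; exact h p x
  exact this ▸ hf

theorem TG.comp1 (hW : ∀ p x, 1 ≤ W p x) {𝕜 : Type} [NontriviallyNormedField 𝕜] [NormedAlgebra ℝ 𝕜]
    {f : P → E → 𝕜} (Φ : ℕ → P → 𝕜 → 𝕜)
    (h1 : ∀ j p x, HasDerivAt (Φ j p) (Φ (j+1) p (f p x)) (f p x))
    (h2 : ∀ j, PB W (fun p x => Φ j p (f p x))) {n : ℕ} : ∀ j, TG W n f →
    TG W n (fun p x => Φ j p (f p x)) := by
  induction n with
  | zero => intro j _; exact h2 j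
  | succ n ih =>
    intro j hf
    have hf0 := hf.pred
    obtain ⟨g1, f', g2, g3⟩ := hf
    refine ⟨h2 j, fun p x => (ContinuousLinearMap.compL ℝ E 𝕜 𝕜).flip (f' p x) (ContinuousLinearMap.mul ℝ 𝕜 (Φ (j+1) p (f p x))), ?_, ?_⟩
    · intro p x
      have := ((h1 j p x).hasFDerivAt.restrictScalars ℝ).comp x (g2 p x)
      refine HasFDerivAt.congr_fderiv this ?_
      ext v
      simp [mul_comm]
    · exact TG.bilin hW _ g3 (TG.clm hW _ (ih (j+1) hf0))

theorem TG.comp (hW : ∀ p x, 1 ≤ W p x) {φ : P → Q} {m : P → E → E2}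
    (hφ : Continuous φ)  (hb : ∃ (C : ℝ) (k : ℕ), ∀ p x, W2 (φ p) (m p x) ≤ C * W p x ^ k)
    (hW2 : ∀ p x, 1 ≤ W2 p x) {n : ℕ} :
    ∀ {F : Type} [NormedAddCommGroup F] [NormedSpace ℝ F] {f : Q → E2 → F},
    TG W n m → TG W2 n f → TG W n (fun p x => f (φ p) (m p x)) := by
  have key : ∀ {F : Type} [NormedAddCommGroup F] [NormedSpace ℝ F] {f : Q → E2 → F}, PB W m → PB W2 f →
      PB W (fun p x => f (φ p) (m p x)) := by
    intro F _ _ f hm hf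
    refine ⟨hf.1.comp ((hφ.comp continuous_fst).prodMk hm.1), ?_⟩
    obtain ⟨C, k, hb⟩ := hb
    obtain ⟨D, l, hD, hf⟩ := hf.posC hW2
    refine ⟨D * C ^ l, k * l, fun p x => (hf _ _).trans ?_⟩
    have := hW2 (φ p) (m p x)
    calc _ ≤ D * (C * W p x ^ k) ^ l := by gcongr; exact hb p x
      _ = _ := by rw [mul_pow, pow_mul]; ring
  induction n with
  | zero => intro F _ _ f hm hf; exact key hm hf
  | succ n ih =>
    intro F _ _ f hm hf
    have hm0 := hm.pred
    obtain ⟨m1, m', m2, m3⟩ := hm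
    obtain ⟨f1, f', f2, f3⟩ := hf
    refine ⟨key m1 f1, fun p x => ContinuousLinearMap.compL ℝ E E2 F (f' (φ p) (m p x)) (m' p x),
      fun p x => (f2 _ _).comp x (m2 p x), ?_⟩
    exact TG.bilin hW _ (ih hm0 f3) m3

theorem TG.contDiff {n : ℕ} : ∀ {F : Type} [NormedAddCommGroup F] [NormedSpace ℝ F] {f : P → E → F},
    TG W n f → ∀ p, ContDiff ℝ n (f p) := by
  induction n with
  | zero =>
    intro F _ _ f hf p
    exact contDiff_zero.2 (hf.1.comp (Continuous.prodMk_right p))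
  | succ n ih =>
    intro F _ _ f hf p
    obtain ⟨f1, f', f2, f3⟩ := hf
    have : fderiv ℝ (f p) = f' p := by ext1 x; exact (f2 p x).fderiv
    rw [Nat.cast_add, Nat.cast_one, contDiff_succ_iff_fderiv]
    refine ⟨fun x => (f2 p x).differentiableAt, by simp, ?_⟩
    rw [this]; exact ih f3 p

theorem TG.bound {n : ℕ} (hW : ∀ p x, 1 ≤ W p x) : ∀ {F : Type} [NormedAddCommGroup F] [NormedSpace ℝ F] {f : P → E → F},
    TG W n f → ∃ (C : ℝ) (k : ℕ), 0 ≤ C ∧ ∀ i ≤ n, ∀ p x, ‖iteratedFDeriv ℝ i (f p) x‖ ≤ C * W p x ^ k := by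
  induction n with
  | zero =>
    intro F _ _ f hf
    obtain ⟨C, k, hC, h⟩ := PB.posC hW hf
    refine ⟨C, k, hC, fun i hi p x => ?_⟩
    obtain rfl : i = 0 := by omega
    simpa using h p x
  | succ n ih =>
    intro F _ _ f hf
    obtain ⟨f1, f', f2, f3⟩ := hf
    obtain ⟨C, k, hC, h⟩ := PB.posC hW f1
    obtain ⟨D, l, hD, h'⟩ := ih f3
    refine ⟨C + D, k + l, by positivity, fun i hi p x => ?_⟩
    have hw := hW p x
    have : fderiv ℝ (f p) = f' p := by ext1 x; exact (f2 p x).fderiv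
    cases i with
    | zero =>
      simp only [norm_iteratedFDeriv_zero]
      calc _ ≤ C * W p x ^ k := h p x
        _ ≤ _ := by
          gcongr
          · linarith
          · omega
    | succ i =>
      rw [← norm_iteratedFDeriv_fderiv, this]
      calc _ ≤ D * W p x ^ l := h' i (by omega) p x
        _ ≤ _ := by
          gcongr
          · linarith
          · omega

end TGsec

set_option linter.unusedSectionVars false
set_option linter.unusedSimpArgs false
set_option linter.unusedVariables false
section TGsec2
open Topology
variable {P E : Type} [TopologicalSpace P]
  [NormedAddCommGroup E] [NormedSpace ℝ E] {W : P → E → ℝ}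

theorem TG.integral (hW : ∀ p x, 1 ≤ W p x) (hWc : ∀ p, Continuous (W p)) [FirstCountableTopology P]
   (a b : ℝ) {n : ℕ} :
    ∀ {F : Type} [NormedAddCommGroup F] [NormedSpace ℝ F] [CompleteSpace F] {f : P × ℝ → E → F},
    TG (fun q x => W q.1 x) n f → TG W n (fun p x => ∫ s in a..b, f (p, s) x) := by
  have key : ∀ {F : Type} [NormedAddCommGroup F] [NormedSpace ℝ F] [CompleteSpace F] {f : P × ℝ → E → F},
    PB (fun q x => W q.1 x) f → PB W (fun p x => ∫ s in a..b, f (p, s) x) := by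
    intro F _ _ _ f hf
    constructor
    · have h1 : Continuous (Function.uncurry fun (q : P × E) (s : ℝ) => f (q.1, s) q.2) := by
        have := hf.1
        exact this.comp (f := fun z : (P × E) × ℝ => (((z.1.1, z.2), z.1.2) : (P × ℝ) × E)) (by fun_prop)
      exact intervalIntegral.continuous_parametric_intervalIntegral_of_continuous' h1 a b
    · obtain ⟨C, k, hC, h⟩ := hf.posC (fun (q : P × ℝ) x => hW q.1 x)
      refine ⟨C * |b - a|, k, fun p x => ?_⟩
      have := intervalIntegral.norm_integral_le_of_norm_le_const (a := a) (b := b) (f := fun s => f (p, s) x)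
        (C := C * W p x ^ k) (fun s _ => h (p, s) x)
      calc _ ≤ _ := this
        _ = _ := by ring
  induction n with
  | zero => intro F _ _ _ f hf; exact key hf
  | succ n ih =>
    intro F _ _ _ f hf
    obtain ⟨f1, f', f2, f3⟩ := hf
    refine ⟨key f1, fun p x => ∫ s in a..b, f' (p, s) x, ?_, ih f3⟩
    intro p x₀
    obtain ⟨C, k, hC, h⟩ := f3.pb.posC (fun (q : P × ℝ) x => hW q.1 x)
    have hs : {x | W p x < W p x₀ + 1} ∈ 𝓝 x₀ :=
      (isOpen_lt (hWc p) continuous_const).mem_nhds (by simp)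
    have hc : ∀ x, Continuous fun s : ℝ => f (p, s) x := fun x =>
      f1.1.comp (f := fun s : ℝ => (((p, s), x) : (P × ℝ) × E)) (by fun_prop)
    have hc' : ∀ x, Continuous fun s : ℝ => f' (p, s) x := fun x =>
      f3.pb.1.comp (f := fun s : ℝ => (((p, s), x) : (P × ℝ) × E)) (by fun_prop)
    refine intervalIntegral.hasFDerivAt_integral_of_dominated_of_fderiv_le (F := fun x s => f (p, s) x)
      (F' := fun x s => f' (p, s) x) (bound := fun _ => C * (W p x₀ + 1) ^ k)
      hs ?_ ?_ ?_ ?_ ?_ ?_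
    · exact Filter.Eventually.of_forall fun x => (hc x).aestronglyMeasurable
    · exact (hc x₀).intervalIntegrable _ _
    · exact (hc' x₀).aestronglyMeasurable
    · refine Filter.Eventually.of_forall fun t _ x hx => (h (p, t) x).trans ?_
      have h1 := hW p x
      simp only [Set.mem_setOf_eq] at hx
      gcongr
    · simp
    · exact Filter.Eventually.of_forall fun t _ x hx => f2 (p, t) x

theorem TG.glue (C : ℝ) (m : ℕ) {n : ℕ} :
    ∀ {F : Type} [NormedAddCommGroup F] [NormedSpace ℝ F] {f : E → F} {g : ℕ → E → F},
    (∀ x, ∃ l : ℕ, f =ᶠ[𝓝 x] g l ∧ (l + 1 : ℝ) ≤ C * (1 + ‖x‖) ^ m) →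
    TG (fun (l : ℕ) x => (l + 1) * (1 + ‖x‖)) n g → TG (fun (_ : Unit) x => 1 + ‖x‖) n (fun _ => f) := by
  have hW : ∀ (l : ℕ) (x : E), (1:ℝ) ≤ (l + 1) * (1 + ‖x‖) := fun l x => by
    nlinarith [norm_nonneg x, (Nat.cast_nonneg l : (0:ℝ) ≤ l), mul_nonneg (Nat.cast_nonneg l : (0:ℝ) ≤ l) (norm_nonneg x)]
  have key : ∀ {F : Type} [NormedAddCommGroup F] [NormedSpace ℝ F] {f : E → F} {g : ℕ → E → F},
    (∀ x, ∃ l : ℕ, f =ᶠ[𝓝 x] g l ∧ (l + 1 : ℝ) ≤ C * (1 + ‖x‖) ^ m) →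
    PB (fun (l : ℕ) x => (l + 1) * (1 + ‖x‖)) g → PB (fun (_ : Unit) x => 1 + ‖x‖) (fun _ => f) := by
    intro F _ _ f g hx hg
    constructor
    · have : Continuous f := by
        rw [continuous_iff_continuousAt]
        intro x
        obtain ⟨l, h1, h2⟩ := hx x
        refine ContinuousAt.congr ?_ h1.symm
        exact (hg.1.comp (Continuous.prodMk_right l)).continuousAt
      exact this.comp continuous_snd
    · obtain ⟨D, k, hD, h⟩ := hg.posC hW
      refine ⟨D * C ^ k, (m + 1) * k, fun _ x => ?_⟩
      obtain ⟨l, h1, h2⟩ := hx x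
      beta_reduce
      rw [h1.eq_of_nhds]
      refine (h l x).trans ?_
      calc D * ((l + 1) * (1 + ‖x‖)) ^ k ≤ D * ((C * (1 + ‖x‖) ^ m) * (1 + ‖x‖)) ^ k := by gcongr
        _ = _ := by rw [mul_assoc, ← pow_succ, mul_pow, pow_mul]; ring
  induction n with
  | zero => intro F _ _ f g hx hg; exact key hx hg
  | succ n ih =>
    intro F _ _ f g hx hg
    obtain ⟨g1, g', g2, g3⟩ := hg
    refine ⟨key hx g1, fun _ x => fderiv ℝ f x, ?_, ih (f := fderiv ℝ f) (g := g') ?_ g3⟩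
    · intro _ x
      obtain ⟨l, h1, h2⟩ := hx x
      exact (((g2 l x).differentiableAt).congr_of_eventuallyEq h1).hasFDerivAt
    · intro x
      obtain ⟨l, h1, h2⟩ := hx x
      refine ⟨l, ?_, h2⟩
      filter_upwards [Filter.EventuallyEq.fderiv (𝕜 := ℝ) h1] with y hy
      rw [hy]; exact (g2 l y).fderiv

theorem TG.comp_iter (hW : ∀ p x, 1 ≤ W p x) {𝕜 : Type} [NontriviallyNormedField 𝕜] [NormedAlgebra ℝ 𝕜]
    {f : P → E → 𝕜} {g : 𝕜 → 𝕜} {n : ℕ} (hf : TG W n f)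
    (hd : ∀ j p x, DifferentiableAt 𝕜 (deriv^[j] g) (f p x))
    (hb : ∀ j, ∃ (C : ℝ) (k : ℕ), ∀ p x, ‖deriv^[j] g (f p x)‖ ≤ C * W p x ^ k) :
    TG W n (fun p x => g (f p x)) := by
  refine TG.comp1 hW (fun j _ y => deriv^[j] g y) ?_ ?_ 0 hf
  · intro j p x
    rw [Function.iterate_succ_apply']
    exact (hd j p x).hasDerivAt
  · intro j
    refine ⟨?_, hb j⟩
    rw [continuous_iff_continuousAt]
    intro q
    exact (hd j q.1 q.2).continuousAt.comp (f := fun q : P × E => f q.1 q.2) hf.pb.1.continuousAt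

theorem diffOn_iter {g : ℂ → ℂ} {U : Set ℂ} (hU : IsOpen U) (hg : DifferentiableOn ℂ g U) (j : ℕ) :
    DifferentiableOn ℂ (deriv^[j] g) U := by
  induction j with
  | zero => exact hg
  | succ j ih => rw [Function.iterate_succ']; exact ih.deriv hU

theorem TG.comp_holo (hW : ∀ p x, 1 ≤ W p x) {f : P → E → ℂ} {g : ℂ → ℂ} {U K : Set ℂ} (hU : IsOpen U)
    (hK : IsCompact K) (hKU : K ⊆ U) (hg : DifferentiableOn ℂ g U) {n : ℕ} (hf : TG W n f)
    (hfK : ∀ p x, f p x ∈ K) : TG W n (fun p x => g (f p x)) := by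
  refine TG.comp_iter hW hf (fun j p x => (diffOn_iter hU hg j).differentiableAt (hU.mem_nhds (hKU (hfK p x)))) ?_
  intro j
  obtain ⟨C, hC⟩ := hK.exists_bound_of_continuousOn ((diffOn_iter hU hg j).continuousOn.mono hKU)
  exact ⟨C, 0, fun p x => by simpa using hC _ (hfK p x)⟩

theorem TG.cexp (hW : ∀ p x, 1 ≤ W p x) {f : P → E → ℂ} {n : ℕ} (hf : TG W n f) (M : ℝ)
    (hM : ∀ p x, (f p x).re ≤ M) : TG W n (fun p x => Complex.exp (f p x)) := by
  refine TG.comp_iter hW hf (fun j p x => by rw [Complex.iter_deriv_exp]; exact Complex.differentiableAt_exp) ?_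
  intro j
  refine ⟨Real.exp M, 0, fun p x => ?_⟩
  rw [Complex.iter_deriv_exp, Complex.norm_exp]
  simpa using hM p x

theorem TG.inv (hW : ∀ p x, 1 ≤ W p x) {𝕜 : Type} [NontriviallyNormedField 𝕜] [NormedAlgebra ℝ 𝕜]
    {f : P → E → 𝕜} {n : ℕ} (hf : TG W n f) (c : ℝ) (hc : 0 < c)
    (hM : ∀ p x, c ≤ ‖f p x‖) : TG W n (fun p x => (f p x)⁻¹) := by
  have h0 : ∀ p x, f p x ≠ 0 := fun p x h => by have := hM p x; rw [h] at this; simp at this; linarith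
  have e : ∀ j, deriv^[j] (Inv.inv : 𝕜 → 𝕜) = fun y => (-1) ^ j * (j.factorial : 𝕜) * y ^ (-1 - j : ℤ) := fun j => by
    ext y; rw [iter_deriv_inv]
  refine TG.comp_iter hW (g := Inv.inv) hf (fun j p x => ?_) ?_
  · rw [e]
    exact (differentiableAt_zpow.2 (Or.inl (h0 p x))).const_mul _
  · intro j
    refine ⟨‖((-1) ^ j * (j.factorial : 𝕜) : 𝕜)‖ * (c ^ (j+1))⁻¹, 0, fun p x => ?_⟩
    rw [e]
    simp only [norm_mul, pow_zero, mul_one]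
    gcongr
    rw [show (-1 - j : ℤ) = -((j+1 : ℕ) : ℤ) by push_cast; ring, _root_.zpow_neg, zpow_natCast, norm_inv, norm_pow]
    gcongr
    exact hM p x

theorem TG.rpow (hW : ∀ p x, 1 ≤ W p x) {f : P → E → ℝ} {n : ℕ} (hf : TG W n f) (s c : ℝ) (hc : 0 < c)
    (hs : s ≤ 1) (hM : ∀ p x, c ≤ f p x) : TG W n (fun p x => (f p x) ^ s) := by
  have h0 : ∀ p x, f p x ≠ 0 := fun p x h => by have := hM p x; rw [h] at this; linarith
  have key := TG.comp1 hW (f := f) (n := n) (fun j _ y => (∏ i ∈ Finset.range j, (s - i)) * y ^ (s - j)) ?_ ?_ 0 hf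
  · simpa using key
  · intro j p x
    have := (Real.hasDerivAt_rpow_const (p := s - j) (Or.inl (h0 p x))).const_mul (∏ i ∈ Finset.range j, (s - (i:ℝ)))
    refine this.congr_deriv ?_
    rw [Finset.prod_range_succ]
    push_cast
    rw [show s - (j + 1 : ℝ) = s - j - 1 by ring]
    ring
  · intro j
    constructor
    · refine continuous_const.mul ?_
      exact Continuous.rpow_const hf.pb.1 fun q => Or.inl (h0 _ _)
    · obtain ⟨C, k, hC, h⟩ := hf.pb.posC hW
      refine ⟨|∏ i ∈ Finset.range j, (s - (i:ℝ))| * (C * c ^ (s - j - 1)), k, fun p x => ?_⟩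
      rw [Real.norm_eq_abs, abs_mul, mul_assoc]
      gcongr
      have hp : 0 < f p x := hc.trans_le (hM p x)
      rw [abs_of_nonneg (by positivity)]
      have : f p x ^ (s - (j:ℝ)) = f p x * f p x ^ (s - j - 1) := by
        rw [Real.rpow_sub_one hp.ne']; field_simp
      rw [this]
      have h2 : f p x ^ (s - (j:ℝ) - 1) ≤ c ^ (s - (j:ℝ) - 1) := by
        apply Real.rpow_le_rpow_of_nonpos hc (hM p x)
        have : (0:ℝ) ≤ j := Nat.cast_nonneg j
        linarith
      have h3 := h p x
      rw [Real.norm_eq_abs, abs_of_pos hp] at h3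
      have := hW p x
      calc _ ≤ (C * W p x ^ k) * c ^ (s - (j:ℝ) - 1) := by gcongr
        _ = _ := by ring

theorem deriv_iter_zero_of_open {g : ℝ → ℝ} {U : Set ℝ} (hU : IsOpen U) (h : ∀ x ∈ U, g x = 0) (j : ℕ) :
    ∀ x ∈ U, deriv^[j] g x = 0 := by
  induction j with
  | zero => exact h
  | succ j ih =>
    intro x hx
    rw [Function.iterate_succ_apply']
    have : deriv^[j] g =ᶠ[𝓝 x] fun _ => 0 := by
      filter_upwards [hU.mem_nhds hx] with y hy using ih y hy
    rw [this.deriv_eq]; simp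

theorem sT_iter_contDiff (j : ℕ) : ContDiff ℝ (⊤ : ℕ∞) (deriv^[j] Real.smoothTransition) := by
  have : ContDiff ℝ (⊤ : ℕ∞) Real.smoothTransition := Real.smoothTransition.contDiff
  have := ContDiff.iterate_deriv j (𝕜 := ℝ) (f := Real.smoothTransition) (by exact_mod_cast this)
  exact this

theorem sT_iter_bound (j : ℕ) : ∃ C, ∀ y, ‖deriv^[j] Real.smoothTransition y‖ ≤ C := by
  obtain ⟨C, hC⟩ := (isCompact_Icc (a := (0:ℝ)) (b := 1)).exists_bound_of_continuousOn
    (sT_iter_contDiff j).continuous.continuousOn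
  cases j with
  | zero =>
    refine ⟨1, fun y => ?_⟩
    simp only [Function.iterate_zero, id]
    rw [Real.norm_eq_abs, abs_of_nonneg (Real.smoothTransition.nonneg y)]
    exact Real.smoothTransition.le_one y
  | succ j =>
    refine ⟨max C 0, fun y => ?_⟩
    by_cases hy : y ∈ Set.Icc (0:ℝ) 1
    · exact (hC y hy).trans (le_max_left _ _)
    · have : deriv^[j+1] Real.smoothTransition y = 0 := by
        rw [Function.iterate_succ_apply]
        refine deriv_iter_zero_of_open (U := (Set.Icc (0:ℝ) 1)ᶜ) isClosed_Icc.isOpen_compl ?_ j y hy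
        intro x hx
        rw [Set.mem_compl_iff, Set.mem_Icc, not_and_or, not_le, not_le] at hx
        rcases hx with hx | hx
        · have : Real.smoothTransition =ᶠ[𝓝 x] fun _ => 0 := by
            filter_upwards [isOpen_Iio.mem_nhds hx] with z hz
            exact Real.smoothTransition.zero_of_nonpos (le_of_lt hz)
          rw [this.deriv_eq]; simp
        · have : Real.smoothTransition =ᶠ[𝓝 x] fun _ => 1 := by
            filter_upwards [isOpen_Ioi.mem_nhds hx] with z hz
            exact Real.smoothTransition.one_of_one_le (le_of_lt hz)
          rw [this.deriv_eq]; simp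
      rw [this]; simp

theorem TG.sT (hW : ∀ p x, 1 ≤ W p x) {f : P → E → ℝ} {n : ℕ} (hf : TG W n f) :
    TG W n (fun p x => Real.smoothTransition (f p x)) := by
  refine TG.comp_iter hW hf (fun j p x => ((sT_iter_contDiff j).differentiable (by simp)).differentiableAt) ?_
  intro j
  obtain ⟨C, hC⟩ := sT_iter_bound j
  exact ⟨C, 0, fun p x => by simpa using hC _⟩

end TGsec2

set_option linter.unusedSectionVars false
set_option linter.unusedSimpArgs false
set_option linter.unusedVariables false
section CTsec
open Topology
variable {P E : Type} [TopologicalSpace P]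
  [NormedAddCommGroup E] [NormedSpace ℝ E] {W : P → E → ℝ}

def tau2 (y : ℝ) : ℝ := y * Real.smoothTransition (y + 1)

theorem tau2_of_nonneg {y : ℝ} (hy : 0 ≤ y) : tau2 y = y := by
  rw [tau2, Real.smoothTransition.one_of_one_le (by linarith), mul_one]

theorem tau2_ge (y : ℝ) : -1 ≤ tau2 y := by
  have h1 := Real.smoothTransition.nonneg (y+1)
  have h2 := Real.smoothTransition.le_one (y+1)
  rw [tau2]
  by_cases hy : y ≤ -1
  · rw [Real.smoothTransition.zero_of_nonpos (by linarith)]; simp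
  · nlinarith

theorem TG.tau2 (hW : ∀ p x, 1 ≤ W p x) {f : P → E → ℝ} {n : ℕ} (hf : TG W n f) :
    TG W n (fun p x => tau2 (f p x)) :=
  hf.mul hW ((hf.add hW (TG.const 1)).sT hW)

def cosS (w : ℂ) : ℂ := ∑' k : ℕ, (-1) ^ k * w ^ k / ((2 * k).factorial : ℂ)

theorem cosS_sq (z : ℂ) : cosS (z ^ 2) = Complex.cos z := by
  rw [cosS]
  have := (Complex.hasSum_cos z).tsum_eq
  rw [← this]
  congr 1; ext k; rw [← pow_mul]

theorem cosS_diff : Differentiable ℂ cosS := by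
  intro w
  have h : DifferentiableOn ℂ cosS (Metric.ball 0 (‖w‖ + 1)) := by
    refine differentiableOn_tsum_of_summable_norm (u := fun k : ℕ => (‖w‖ + 1) ^ k / (k.factorial : ℝ))
      (Real.summable_pow_div_factorial _) ?_ Metric.isOpen_ball ?_
    · intro k
      fun_prop
    · intro k z hz
      rw [norm_div, norm_mul, norm_pow, norm_pow, norm_neg, norm_one, one_pow, one_mul, Complex.norm_natCast]
      have h1 : ‖z‖ ≤ ‖w‖ + 1 := by simpa using (Metric.mem_ball.1 hz).le
      have h2 : k.factorial ≤ (2*k).factorial := Nat.factorial_le (by omega)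
      gcongr
  exact h.differentiableAt (Metric.isOpen_ball.mem_nhds (by simp))

theorem cosS_bound (w : ℂ) (h1 : -2 ≤ w.re) (h2 : |w.im| ≤ 1) : ‖cosS w‖ ≤ Real.exp 2 := by
  obtain ⟨z, rfl⟩ : ∃ z : ℂ, z ^ 2 = w := IsAlgClosed.exists_pow_nat_eq w (by norm_num)
  rw [cosS_sq]
  have e1 : (z^2).re = z.re ^ 2 - z.im ^ 2 := by simp [sq]
  have e2 : (z^2).im = 2 * z.re * z.im := by simp [sq]; ring
  rw [e1] at h1
  rw [e2] at h2
  have h3 : (2 * z.re * z.im)^2 ≤ 1 := by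
    rw [← sq_abs]; nlinarith [abs_nonneg (2 * z.re * z.im)]
  have hb : z.im ^ 2 ≤ 4 := by
    by_contra hh
    push Not at hh
    nlinarith
  have hb' : |z.im| ≤ 2 := by
    apply abs_le_of_sq_le_sq _ (by norm_num); linarith
  rw [Complex.cos]
  have b := abs_le.1 hb'
  have n1 : ‖Complex.exp (z * I)‖ ≤ Real.exp 2 := by
    rw [Complex.norm_exp]; apply Real.exp_le_exp.2; simp; linarith
  have n2 : ‖Complex.exp (-z * I)‖ ≤ Real.exp 2 := by
    rw [Complex.norm_exp]; apply Real.exp_le_exp.2; simp; linarith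
  rw [norm_div]
  have := norm_add_le (Complex.exp (z * I)) (Complex.exp (-z * I))
  simp only [Complex.norm_ofNat]
  linarith

theorem cosS_iter_bound (j : ℕ) (y : ℝ) (hy : -1 ≤ y) : ‖deriv^[j] cosS (y:ℂ)‖ ≤ j.factorial * Real.exp 2 := by
  rw [← iteratedDeriv_eq_iterate]
  have := Complex.norm_iteratedDeriv_le_of_forall_mem_sphere_norm_le (n := j) (c := (y:ℂ)) (R := 1)
    (C := Real.exp 2) (f := cosS) one_pos cosS_diff.diffContOnCl ?_
  · simpa using this
  · intro z hz
    have h1 : ‖z - y‖ = 1 := by simpa [dist_eq_norm] using hz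
    have h2 := Complex.abs_re_le_norm (z - y)
    have h3 := Complex.abs_im_le_norm (z - y)
    simp only [h1, sub_re, ofReal_re, sub_im, ofReal_im, sub_zero] at h2 h3
    exact cosS_bound z (by have := abs_le.1 h2; linarith) h3

def CT (y : ℝ) : ℂ := cosS (tau2 y : ℝ)

theorem CT_sq (z : ℝ) : CT (z ^ 2) = Real.cos z := by
  rw [CT, tau2_of_nonneg (sq_nonneg z)]
  push_cast
  rw [cosS_sq]

theorem TG.ofReal (hW : ∀ p x, 1 ≤ W p x) {f : P → E → ℝ} {n : ℕ} (hf : TG W n f) :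
    TG W n (fun p x => ((f p x : ℝ) : ℂ)) := TG.clm hW Complex.ofRealCLM hf

theorem TG.CT (hW : ∀ p x, 1 ≤ W p x) {f : P → E → ℝ} {n : ℕ} (hf : TG W n f) :
    TG W n (fun p x => CT (f p x)) := by
  refine TG.comp_iter hW (g := cosS) ((hf.tau2 hW).ofReal hW) (fun j p x =>
    (differentiableOn_univ.1 (diffOn_iter isOpen_univ cosS_diff.differentiableOn j)).differentiableAt) ?_
  intro j
  exact ⟨_, 0, fun p x => by simpa using cosS_iter_bound j _ (tau2_ge _)⟩

def aSer (y : ℂ) : ℂ := ∑' k : ℕ, y ^ k / (2 * k + 1 : ℂ)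

theorem norm_2k1 (k : ℕ) : ‖(2 * k + 1 : ℂ)‖ = 2 * k + 1 := by
  have : (2 * k + 1 : ℂ) = ((2 * k + 1 : ℕ) : ℂ) := by push_cast; rfl
  rw [this, Complex.norm_natCast]; push_cast; rfl

theorem aSer_diff : DifferentiableOn ℂ aSer (Metric.ball 0 (1/2)) := by
  refine differentiableOn_tsum_of_summable_norm (u := fun k : ℕ => (1/2:ℝ) ^ k)
      (summable_geometric_of_lt_one (by norm_num) (by norm_num)) ?_ Metric.isOpen_ball ?_
  · intro k
    fun_prop
  · intro k z hz
    have h1 : ‖z‖ ≤ 1/2 := by simpa using (Metric.mem_ball.1 hz).le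
    rw [norm_div, norm_pow, norm_2k1]
    refine (div_le_self (by positivity) ?_).trans (by gcongr)
    linarith [(Nat.cast_nonneg k : (0:ℝ) ≤ k)]

theorem aSer_summable {y : ℂ} (hy : ‖y‖ < 1) : Summable (fun k : ℕ => y ^ k / (2 * k + 1 : ℂ)) := by
  refine Summable.of_norm_bounded (summable_geometric_of_lt_one (norm_nonneg y) hy) ?_
  intro k
  rw [norm_div, norm_pow, norm_2k1]
  refine (div_le_self (by positivity) ?_)
  linarith [(Nat.cast_nonneg k : (0:ℝ) ≤ k)]

theorem aSer_zero : aSer 0 = 1 := by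
  rw [aSer, tsum_eq_single 0]
  · simp
  · intro b hb; simp [hb]

theorem aSer_sub_one {y : ℂ} (hy : ‖y‖ ≤ 1/4) : ‖aSer y - 1‖ ≤ ‖y‖ / 2 := by
  have hy1 : ‖y‖ < 1 := by linarith
  have hs := aSer_summable hy1
  rw [aSer, hs.tsum_eq_zero_add]
  simp only [pow_zero, Nat.cast_zero, mul_zero, zero_add, div_one, add_sub_cancel_left]
  have hg := (hasSum_geometric_of_lt_one (norm_nonneg y) hy1).mul_left (‖y‖ / 3)
  have := tsum_of_norm_bounded (f := fun b : ℕ => y ^ (b + 1) / (2 * ((b + 1 : ℕ):ℂ) + 1)) hg ?_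
  · refine this.trans ?_
    have : (1 - ‖y‖)⁻¹ ≤ 3/2 := by
      rw [inv_le_comm₀ (by linarith) (by norm_num)]; linarith
    nlinarith [norm_nonneg y]
  · intro k
    rw [norm_div, norm_pow, norm_2k1, pow_succ, div_mul_eq_mul_div, mul_comm]
    gcongr
    push_cast
    linarith [(Nat.cast_nonneg k : (0:ℝ) ≤ k)]

theorem aSer_sq {w : ℂ} (hw : ‖w‖ < 1) :
    2 * w * aSer (w ^ 2) = Complex.log (1 + w) - Complex.log (1 - w) := by
  have h1 := Complex.hasSum_taylorSeries_log hw
  have h2 := Complex.hasSum_taylorSeries_neg_log hw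
  have h3 := h1.add h2
  have h4 : HasSum (fun k : ℕ => 2 * w * ((w^2) ^ k / (2 * k + 1 : ℂ))) (2 * w * aSer (w^2)) := by
    refine HasSum.mul_left _ (aSer_summable ?_).hasSum
    rw [norm_pow]; nlinarith [norm_nonneg w]
  rw [sub_eq_add_neg]
  refine HasSum.unique h4 ?_
  have hinj : Function.Injective (fun k : ℕ => 2 * k + 1) := fun a b h => by simpa using h
  have h5 := (hinj.hasSum_iff (f := fun n : ℕ => (-1) ^ (n + 1) * w ^ n / n + w ^ n / n) (a := log (1 + w) + -log (1 - w)) ?_).2 h3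
  · convert h5 using 1
    ext k
    simp only [Function.comp]
    have : (2 * (k:ℂ) + 1) ≠ 0 := by
      have := norm_2k1 k
      intro h; rw [h] at this; simp at this
      linarith [(Nat.cast_nonneg k : (0:ℝ) ≤ k)]
    rw [show (-1:ℂ) ^ (2 * k + 1 + 1) = 1 by rw [show 2*k+1+1 = 2*(k+1) by ring, pow_mul]; simp]
    push_cast
    field_simp
    rw [← pow_mul]
    ring
  · intro n hn
    have : Even n := by
      by_contra h
      rw [Nat.not_even_iff_odd] at h
      obtain ⟨m, rfl⟩ := h
      exact hn ⟨m, rfl⟩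
    rw [this.add_one.neg_one_pow]
    ring

end CTsec

set_option linter.unusedSectionVars false
set_option linter.unusedSimpArgs false
set_option linter.unusedVariables false
section Lagsec
open Topology

def lagP (l : ℕ) (x : ℝ) : ℝ := ∑ k ∈ Finset.range (l + 1), (l.choose k : ℝ) * (-x) ^ k / (k.factorial : ℝ)

theorem prod_desc (l i : ℕ) (hi : i ≤ l) :
    (∏ j ∈ Finset.range i, ((l : ℝ) - j)) = (l.factorial : ℝ) / ((l - i).factorial : ℝ) := by
  have h1 : (∏ j ∈ Finset.range i, ((l : ℝ) - j)) = (l.descFactorial i : ℝ) := by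
    rw [Nat.descFactorial_eq_prod_range]
    push_cast
    refine Finset.prod_congr rfl fun j hj => ?_
    rw [Nat.cast_sub (by have := Finset.mem_range.1 hj; omega)]
  rw [h1, eq_div_iff (by positivity), mul_comm]
  exact_mod_cast Nat.factorial_mul_descFactorial hi

theorem lag_eq (l : ℕ) (x : ℝ) : lag l x = Real.exp (-x / 2) * lagP l x := by
  have h := iteratedDeriv_mul (n := l) (𝕜 := ℝ) (x := x) (f := fun v : ℝ => v ^ l) (g := fun v : ℝ => Real.exp (-1 * v))
    (by fun_prop) (by fun_prop)
  have e : (fun v : ℝ => v ^ l) * (fun v : ℝ => Real.exp (-1 * v)) = fun v : ℝ => v ^ l * Real.exp (-v) := by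
    ext v; simp
  rw [e] at h
  rw [lag, ← iteratedDeriv_eq_iterate, h, lagP, ← Finset.sum_flip, Finset.mul_sum, Finset.mul_sum]
  refine Finset.sum_congr rfl fun i hi => ?_
  have hi' : i ≤ l := by have := Finset.mem_range.1 hi; omega
  rw [iteratedDeriv_exp_const_mul, iteratedDeriv_eq_iterate, iter_deriv_pow, prod_desc l (l-i) (Nat.sub_le _ _),
    Nat.choose_symm hi', neg_pow x, Nat.sub_sub_self hi']
  have : Real.exp (x / 2) * Real.exp (-1 * x) = Real.exp (-x/2) := by rw [← Real.exp_add]; congr 1; ring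
  rw [← this]
  field_simp

theorem lagP_hasDeriv_aux (l : ℕ) (x : ℝ) :
    lagP (l+1) x = lagP l x + ∑ k ∈ Finset.range (l + 1), (l.choose k : ℝ) * (-x) ^ (k+1) / ((k+1).factorial : ℝ) := by
  rw [lagP, lagP, Finset.sum_range_succ' (n := l+1), Finset.sum_range_succ' (n := l) (f := fun k => (l.choose k : ℝ) * (-x) ^ k / (k.factorial : ℝ))]
  have h0 : ∑ k ∈ Finset.range (l + 1), ((l + 1).choose (k+1) : ℝ) * (-x) ^ (k+1) / ((k+1).factorial : ℝ)
    = ∑ k ∈ Finset.range (l + 1), (l.choose k : ℝ) * (-x) ^ (k+1) / ((k+1).factorial : ℝ) +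
      ∑ k ∈ Finset.range (l + 1), (l.choose (k+1) : ℝ) * (-x) ^ (k+1) / ((k+1).factorial : ℝ) := by
    rw [← Finset.sum_add_distrib]
    refine Finset.sum_congr rfl fun k _ => ?_
    rw [Nat.choose_succ_succ]; push_cast; ring
  rw [h0, Finset.sum_range_succ (n := l) (f := fun k => (l.choose (k+1) : ℝ) * (-x) ^ (k+1) / ((k+1).factorial : ℝ))]
  simp only [Nat.choose_succ_self, Nat.choose_zero_right]
  simp
  ring

theorem aux_hasDeriv (l : ℕ) (x : ℝ) :
    HasDerivAt (fun x : ℝ => ∑ k ∈ Finset.range (l + 1), (l.choose k : ℝ) * (-x) ^ (k+1) / ((k+1).factorial : ℝ))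
      (-lagP l x) x := by
  rw [lagP, ← Finset.sum_neg_distrib]
  refine HasDerivAt.fun_sum fun k _ => ?_
  have h1 := ((((hasDerivAt_id x).neg).pow (k+1)).const_mul (l.choose k : ℝ)).div_const ((k+1).factorial : ℝ)
  refine h1.congr_deriv ?_
  rw [Nat.factorial_succ]
  push_cast
  simp
  field_simp

theorem lagP_hasDeriv (l : ℕ) (x : ℝ) : HasDerivAt (lagP l) (-∑ i ∈ Finset.range l, lagP i x) x := by
  induction l with
  | zero =>
    have : lagP 0 = fun _ => 1 := by ext y; simp [lagP]
    rw [this]; simpa using hasDerivAt_const x (1:ℝ)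
  | succ l ih =>
    have : lagP (l+1) = fun x => lagP l x + ∑ k ∈ Finset.range (l + 1), (l.choose k : ℝ) * (-x) ^ (k+1) / ((k+1).factorial : ℝ) := by
      ext y; exact lagP_hasDeriv_aux l y
    rw [this]
    refine (ih.add (aux_hasDeriv l x)).congr_deriv ?_
    rw [Finset.sum_range_succ]; ring

theorem lagP_rec (l : ℕ) (x : ℝ) :
    x * (-∑ i ∈ Finset.range (l+1), lagP i x) = (l + 1) * (lagP (l+1) x - lagP l x) := by
  have h1 := lagP_hasDeriv (l+1) x
  have h2 : HasDerivAt (lagP (l+1)) (∑ k ∈ Finset.range (l+2), ((l+1).choose k : ℝ) * (k * (-x) ^ (k - 1) * (-1)) / (k.factorial : ℝ)) x := by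
    refine HasDerivAt.fun_sum fun k _ => ?_
    have h1 := ((((hasDerivAt_id x).neg).pow (k)).const_mul ((l+1).choose k : ℝ)).div_const ((k).factorial : ℝ)
    exact h1.congr_deriv (by simp)
  rw [h1.unique h2, lagP_hasDeriv_aux, add_sub_cancel_left, Finset.sum_range_succ']
  simp only [Nat.cast_zero, zero_mul, mul_zero, zero_div, add_zero]
  rw [Finset.mul_sum, Finset.mul_sum]
  refine Finset.sum_congr rfl fun k _ => ?_
  have := Nat.add_one_mul_choose_eq l k
  have h3 : ((l:ℝ) + 1) * (l.choose k : ℝ) = ((l+1).choose (k+1) : ℝ) * (k + 1) := by exact_mod_cast this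
  rw [show ((l:ℝ)+1) * ((l.choose k : ℝ) * (-x)^(k+1) / ((k+1).factorial : ℝ)) = (((l:ℝ)+1) * (l.choose k : ℝ)) * (-x)^(k+1) / ((k+1).factorial : ℝ) by ring, h3]
  push_cast
  rw [pow_succ]
  ring

theorem lag_hasDeriv (l : ℕ) (x : ℝ) :
    HasDerivAt (lag l) (-(1/2) * lag l x - ∑ i ∈ Finset.range l, lag i x) x := by
  have h : lag l = fun x => Real.exp (-x/2) * lagP l x := by ext y; exact lag_eq l y
  rw [h]
  have h1 : HasDerivAt (fun x : ℝ => Real.exp (-x/2)) (Real.exp (-x/2) * (-1/2)) x :=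
    ((hasDerivAt_id x).neg.div_const 2).exp
  refine (h1.mul (lagP_hasDeriv l x)).congr_deriv ?_
  simp only [lag_eq, mul_neg, Finset.mul_sum]
  ring

theorem lag_rec (l : ℕ) (x : ℝ) :
    x * (∑ i ∈ Finset.range l, lag i x) = l * ((if l = 0 then 0 else lag (l-1) x) - lag l x) := by
  cases l with
  | zero => simp
  | succ l =>
    have := lagP_rec l x
    simp only [lag_eq, ← Finset.mul_sum, Nat.succ_ne_zero, if_false, Nat.add_sub_cancel]
    push_cast
    linear_combination -Real.exp (-x/2) * this

def lagS (l : ℕ) (x : ℝ) : ℝ := ∑ i ∈ Finset.range l, lag i x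

theorem lagS_ode (l : ℕ) (x : ℝ) : HasDerivAt (fun y => y * lagS l y)
    (x * (1/2) * lagS l x + l * lag l x) x := by
  cases l with
  | zero => simpa [lagS] using hasDerivAt_const x (0:ℝ)
  | succ l =>
    have h : (fun y => y * lagS (l+1) y) = fun y => ((l:ℝ)+1) * (lag l y - lag (l+1) y) := by
      ext y; rw [lagS, lag_rec]; simp
    rw [h]
    refine (((lag_hasDeriv l x).sub (lag_hasDeriv (l+1) x)).const_mul _).congr_deriv ?_
    have := lag_rec (l+1) x
    simp only [Nat.succ_ne_zero, if_false, Nat.add_sub_cancel] at this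
    rw [lagS, mul_comm x (1/2), mul_assoc, this, Finset.sum_range_succ]
    push_cast
    ring

def LD : ℕ → ℕ → ℝ → ℝ
  | 0, l, x => lag l x
  | n+1, l, x => -(1/2) * LD n l x - ∑ i ∈ Finset.range l, LD n i x

theorem LD_hasDeriv (n l : ℕ) (x : ℝ) : HasDerivAt (LD n l) (LD (n+1) l x) x := by
  induction n generalizing l with
  | zero =>
    have : LD 0 = lag := by ext l x; simp [LD]
    rw [LD, this]; exact lag_hasDeriv l x
  | succ n ih =>
    rw [LD]
    have : LD (n+1) l = fun x => -(1/2) * LD n l x - ∑ i ∈ Finset.range l, LD n i x := by ext x; rw [LD]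
    rw [this]
    exact ((ih l).const_mul _).sub (HasDerivAt.fun_sum fun i _ => ih i)

theorem circ_exp (b c0 : ℂ) (R : ℝ) (h0 : (0:ℂ) ∈ Metric.ball c0 R) (k : ℕ) :
    (∮ w in C(c0, R), Complex.exp (b * w) / w ^ (k+1)) = 2 * Real.pi * I * (b ^ k / (k.factorial : ℂ)) := by
  have hR : 0 < R := dist_nonneg.trans_lt (Metric.mem_ball.1 h0)
  have hne : ∀ w ∈ Metric.sphere c0 R, w ≠ 0 := by
    rintro w hw rfl
    rw [Metric.mem_ball] at h0
    rw [Metric.mem_sphere] at hw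
    linarith
  induction k with
  | zero =>
    have h : Differentiable ℂ (fun w => Complex.exp (b * w)) := by fun_prop
    have := (h.diffContOnCl (s := Metric.ball c0 R)).circleIntegral_sub_inv_smul h0
    simp only [sub_zero, smul_eq_mul, mul_zero, Complex.exp_zero, mul_one] at this
    simp only [zero_add, pow_one, pow_zero, Nat.factorial_zero, Nat.cast_one, div_one, mul_one]
    rw [← this]
    congr 1; ext w; rw [div_eq_inv_mul]
  | succ k ih =>
    have h := circleIntegral.integral_eq_zero_of_hasDerivWithinAt (c := c0) hR.le (f := fun w => Complex.exp (b * w) / w ^ (k+1))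
      (f' := fun w => b * (Complex.exp (b * w) / w ^ (k+1)) - (k+1) * (Complex.exp (b * w) / w ^ (k+2))) ?_
    · have hci : ∀ j : ℕ, CircleIntegrable (fun w => Complex.exp (b * w) / w ^ j) c0 R := by
        intro j
        refine ContinuousOn.circleIntegrable hR.le ?_
        refine ContinuousOn.div (by fun_prop) (by fun_prop) fun w hw => pow_ne_zero _ (hne w hw)
      rw [circleIntegral.integral_sub, circleIntegral.integral_const_mul, circleIntegral.integral_const_mul, ih] at h
      · have hk : ((k:ℂ) + 1) ≠ 0 := by exact_mod_cast Nat.succ_ne_zero k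
        have h' := (sub_eq_zero.1 h).symm
        rw [show k + 1 + 1 = k + 2 by ring]
        have : (∮ w in C(c0, R), Complex.exp (b * w) / w ^ (k+2)) = (b * (2 * Real.pi * I * (b ^ k / (k.factorial : ℂ)))) / (k+1) := by
          rw [eq_div_iff hk, mul_comm]; exact h'
        rw [this, Nat.factorial_succ]
        push_cast
        have : (k.factorial : ℂ) ≠ 0 := by exact_mod_cast Nat.factorial_ne_zero k
        field_simp
        ring
      · exact (hci (k+1)).const_fun_smul (a := b)
      · exact (hci (k+2)).const_fun_smul (a := (k+1 : ℂ))
    · intro w hw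
      have hw0 := hne w hw
      have h1 : HasDerivAt (fun w => Complex.exp (b * w)) (Complex.exp (b * w) * (b * 1)) w :=
        ((hasDerivAt_id w).const_mul b).cexp
      have h2 : HasDerivAt (fun w : ℂ => w ^ (k+1)) (((k+1 : ℕ) : ℂ) * w ^ k) w := by
        simpa using hasDerivAt_pow (k+1) w
      refine ((h1.div h2 (pow_ne_zero _ hw0)).congr_deriv ?_).hasDerivWithinAt
      push_cast
      field_simp
      ring

theorem circ_lag (a b c0 : ℂ) (R : ℝ) (h0 : (0:ℂ) ∈ Metric.ball c0 R) (l : ℕ) :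
    (∮ w in C(c0, R), Complex.exp (b * w) * (w - a) ^ l / w ^ (l+1)) =
      2 * Real.pi * I * ∑ k ∈ Finset.range (l+1), (l.choose k : ℂ) * (-(a * b)) ^ k / (k.factorial : ℂ) := by
  have hR : 0 < R := dist_nonneg.trans_lt (Metric.mem_ball.1 h0)
  have hne : ∀ w ∈ Metric.sphere c0 R, w ≠ 0 := by
    rintro w hw rfl
    rw [Metric.mem_ball] at h0
    rw [Metric.mem_sphere] at hw
    linarith
  have e : (∮ w in C(c0, R), Complex.exp (b * w) * (w - a) ^ l / w ^ (l+1)) =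
      ∮ w in C(c0, R), ∑ k ∈ Finset.range (l+1), ((l.choose k : ℂ) * (-a) ^ k) * (Complex.exp (b * w) / w ^ (k+1)) := by
    refine circleIntegral.integral_congr hR.le fun w hw => ?_
    have hw0 := hne w hw
    beta_reduce
    rw [show w - a = (-a) + w by ring, add_pow, Finset.mul_sum, Finset.sum_div]
    refine Finset.sum_congr rfl fun k hk => ?_
    have hk' : k ≤ l := by have := Finset.mem_range.1 hk; omega
    have : w ^ (l+1) = w ^ (l-k) * w ^ (k+1) := by rw [← pow_add]; congr 1; omega
    rw [this]
    field_simp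
  rw [e, circleIntegral.integral_fun_sum]
  · simp only [circleIntegral.integral_const_mul, circ_exp b c0 R h0, Finset.mul_sum]
    refine Finset.sum_congr rfl fun k hk => ?_
    rw [show -(a*b) = (-a)*b by ring, mul_pow]; ring
  · intro k _
    refine ContinuousOn.circleIntegrable hR.le ?_
    refine continuousOn_const.mul (ContinuousOn.div (by fun_prop) (by fun_prop) fun w hw => pow_ne_zero _ (hne w hw))

theorem lagP_cast (l : ℕ) (x : ℝ) : ((lagP l x : ℝ) : ℂ) = ∑ k ∈ Finset.range (l+1), (l.choose k : ℂ) * (-(x:ℂ)) ^ k / (k.factorial : ℂ) := by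
  rw [lagP]; push_cast; rfl

theorem lag_bound (l : ℕ) (x : ℝ) (hx : 0 ≤ x) : |lag l x| ≤ 1 := by
  rcases Nat.eq_zero_or_pos l with rfl | hl
  · rw [lag_eq]; simp [lagP]; linarith
  set R := Real.sqrt l with hRdef
  have hl' : (0:ℝ) < l := by exact_mod_cast hl
  have hR : 0 < R := Real.sqrt_pos.2 hl'
  have hR2 : R ^ 2 = l := Real.sq_sqrt hl'.le
  set b := Real.sqrt x with hb
  have hb2 : b ^ 2 = x := Real.sq_sqrt hx
  have h1 := circ_lag (b:ℂ) (b:ℂ) 0 R (by simpa using hR) l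
  have h2 : (-((b:ℂ) * b)) = -(x:ℂ) := by rw [← hb2]; push_cast; ring
  rw [h2, ← lagP_cast] at h1
  have h3 := circleIntegral.norm_two_pi_i_inv_smul_integral_le_of_norm_le_const (c := 0) (C := Real.exp (x/2) / R)
    (f := fun w => Complex.exp (b * w) * (w - b) ^ l / w ^ (l+1)) hR.le ?_
  · rw [h1, smul_eq_mul, ← mul_assoc, inv_mul_cancel₀ Complex.two_pi_I_ne_zero, one_mul, Complex.norm_real, Real.norm_eq_abs,
      mul_div_cancel₀ _ hR.ne'] at h3
    rw [lag_eq, abs_mul, abs_of_pos (Real.exp_pos _)]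
    calc _ ≤ Real.exp (-x/2) * Real.exp (x/2) := by gcongr
      _ = 1 := by rw [← Real.exp_add]; simp; ring
  · intro w hw
    have hwn : ‖w‖ = R := by simpa using hw
    set D := ‖w - b‖ ^ 2 with hD
    have hDe : D = l - 2 * (b * w.re) + x := by
      have hw2 : w.re^2 + w.im^2 = l := by
        rw [← hR2, ← hwn, Complex.sq_norm, Complex.normSq_apply]; ring
      rw [hD, Complex.sq_norm, Complex.normSq_apply]
      simp only [sub_re, ofReal_re, sub_im, ofReal_im, sub_zero]
      nlinarith
    have hk : ‖w - b‖ ≤ R * Real.exp ((D / l - 1)/2) := by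
      apply le_of_sq_le_sq _ (by positivity)
      rw [mul_pow, hR2, ← Real.exp_nat_mul, ← hD]
      have := Real.add_one_le_exp (D / l - 1)
      have e : ((2:ℕ):ℝ) * ((D / l - 1)/2) = D / l - 1 := by push_cast; ring
      rw [e]
      calc D = l * (D / l - 1 + 1) := by field_simp; ring
        _ ≤ _ := by gcongr
    have hk2 : ‖w - b‖ ^ l ≤ R ^ l * Real.exp ((D - l)/2) := by
      calc _ ≤ (R * Real.exp ((D / l - 1)/2)) ^ l := by gcongr
        _ = _ := by
          rw [mul_pow, ← Real.exp_nat_mul]; congr 2; field_simp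
    rw [norm_div, norm_mul, norm_pow, norm_pow, hwn, Complex.norm_exp]
    have : ((b:ℂ) * w).re = b * w.re := by simp
    rw [this, show b * w.re = (l + x - D)/2 by linarith]
    calc Real.exp ((l + x - D)/2) * ‖w - b‖ ^ l / R ^ (l+1) ≤ Real.exp ((l + x - D)/2) * (R ^ l * Real.exp ((D - l)/2)) / R ^ (l+1) := by gcongr
      _ = (Real.exp ((l + x - D)/2) * Real.exp ((D - l)/2)) / R := by rw [pow_succ]; field_simp
      _ = _ := by rw [← Real.exp_add]; congr 2; ring

theorem LD_bound (n l : ℕ) (x : ℝ) (hx : 0 ≤ x) : |LD n l x| ≤ (l + 1) ^ n := by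
  induction n generalizing l with
  | zero => simpa [LD] using lag_bound l x hx
  | succ n ih =>
    rw [LD]
    have h1 : |∑ i ∈ Finset.range l, LD n i x| ≤ l * (l+1) ^ n := by
      refine (Finset.abs_sum_le_sum_abs _ _).trans ?_
      have : ∀ i ∈ Finset.range l, |LD n i x| ≤ ((l:ℝ)+1)^n := fun i hi => by
        refine (ih i).trans ?_
        have : (i:ℝ) ≤ l := by exact_mod_cast (Finset.mem_range.1 hi).le
        gcongr
      refine (Finset.sum_le_sum this).trans ?_
      simp
    have h2 := abs_sub (-(1/2) * LD n l x) (∑ i ∈ Finset.range l, LD n i x)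
    rw [abs_mul] at h2
    have h3 := ih l
    have : |(-(1/2) : ℝ)| = 1/2 := by norm_num
    rw [this] at h2
    rw [pow_succ]
    have : (0:ℝ) ≤ ((l:ℝ)+1)^n := by positivity
    nlinarith

theorem lag_zero (l : ℕ) : lag l 0 = 1 := by
  rw [lag_eq, lagP, Finset.sum_eq_single 0]
  · simp
  · intro k _ hk; simp [hk]
  · simp

end Lagsec

set_option linter.unusedSectionVars false
set_option linter.unusedSimpArgs false
set_option linter.unusedVariables false
section Ktsec
open Topology

def ub (u : ℝ) : ℝ := u * Real.smoothTransition (2 - 2 * u) * Real.smoothTransition (2 + 2 * u)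

theorem ub_eq {u : ℝ} (h : |u| ≤ 1/2) : ub u = u := by
  have := abs_le.1 h
  rw [ub, Real.smoothTransition.one_of_one_le (by linarith), Real.smoothTransition.one_of_one_le (by linarith)]
  ring

theorem ub_le (u : ℝ) : |ub u| ≤ 1 := by
  have h1 := Real.smoothTransition.nonneg (2 - 2 * u)
  have h2 := Real.smoothTransition.le_one (2 - 2 * u)
  have h3 := Real.smoothTransition.nonneg (2 + 2 * u)
  have h4 := Real.smoothTransition.le_one (2 + 2 * u)
  rw [ub]
  by_cases hu : 1 ≤ u
  · rw [Real.smoothTransition.zero_of_nonpos (by linarith)]; simp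
  by_cases hu' : u ≤ -1
  · rw [Real.smoothTransition.zero_of_nonpos (x := 2 + 2 * u) (by linarith)]; simp
  rw [abs_mul, abs_mul, abs_of_nonneg h1, abs_of_nonneg h3]
  have : |u| ≤ 1 := abs_le.2 ⟨by linarith, by linarith⟩
  exact mul_le_one₀ (mul_le_one₀ this h1 h2) h3 h4

def Rr (ξ : ℝ) : ℝ := 1/2 * (1 + tau2 ξ ^ 2) ^ (1/4 : ℝ)

theorem Rr_ge (ξ : ℝ) : 1/2 ≤ Rr ξ := by
  have : (1:ℝ) ≤ (1 + tau2 ξ ^ 2) ^ (1/4 : ℝ) := Real.one_le_rpow (by nlinarith [sq_nonneg (tau2 ξ)]) (by norm_num)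
  rw [Rr]; linarith

theorem Rr_pos (ξ : ℝ) : 0 < Rr ξ := by have := Rr_ge ξ; linarith

theorem Rr_four (ξ : ℝ) : (4 * Rr ξ ^ 2) ^ 2 = 1 + tau2 ξ ^ 2 := by
  have h : 0 ≤ 1 + tau2 ξ ^ 2 := by positivity
  have : ((1 + tau2 ξ ^ 2) ^ (1/4 : ℝ)) ^ 4 = 1 + tau2 ξ ^ 2 := by
    rw [← Real.rpow_natCast, ← Real.rpow_mul h]; norm_num
  rw [Rr]
  calc _ = ((1 + tau2 ξ ^ 2) ^ (1/4 : ℝ)) ^ 4 := by ring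
    _ = _ := this

def Kc (θ ξ : ℝ) : ℂ := Rr ξ * Complex.exp (θ * I)
def Kci (θ ξ : ℝ) : ℂ := ((Rr ξ)⁻¹ : ℝ) * Complex.exp (-(θ * I))
def Ky (θ ξ u : ℝ) : ℂ := ((ub u / 16 : ℝ) : ℂ) * Kci θ ξ ^ 2
def Kb (y : ℂ) : ℂ := Complex.exp (-(1/2) * Complex.log (1 - y))
def Kex (θ ξ u : ℝ) : ℂ := Kc θ ξ - ((tau2 ξ / 4 : ℝ) : ℂ) * Kci θ ξ * aSer (Ky θ ξ u)
def Kint (θ : ℝ) (x : ℝ × ℝ) : ℂ := Complex.exp (Kex θ x.1 x.2) * Kb (Ky θ x.1 x.2)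
def Kt (x : ℝ × ℝ) : ℂ := ((2 * Real.pi)⁻¹ : ℝ) • ∫ θ in (0:ℝ)..2 * Real.pi, Kint θ x

theorem norm_expI (θ : ℝ) : ‖Complex.exp (-(θ * I))‖ = 1 := by
  rw [Complex.norm_exp]; simp

theorem norm_Kci (θ ξ : ℝ) : ‖Kci θ ξ‖ = (Rr ξ)⁻¹ := by
  rw [Kci, norm_mul, norm_expI, Complex.norm_real, Real.norm_eq_abs, abs_of_pos (inv_pos.2 (Rr_pos ξ)), mul_one]

theorem Kc_mul_Kci (θ ξ : ℝ) : Kc θ ξ * Kci θ ξ = 1 := by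
  have h := (Rr_pos ξ).ne'
  have : (Rr ξ : ℂ) ≠ 0 := by exact_mod_cast h
  have e : Complex.exp (θ * I) * Complex.exp (-(θ * I)) = 1 := by rw [← Complex.exp_add]; simp
  rw [Kc, Kci]; push_cast
  calc _ = ((Rr ξ : ℂ) * (Rr ξ : ℂ)⁻¹) * (Complex.exp (θ * I) * Complex.exp (-(θ * I))) := by ring
    _ = 1 := by rw [e, mul_inv_cancel₀ this, one_mul]

theorem norm_Ky (θ ξ u : ℝ) : ‖Ky θ ξ u‖ ≤ 1/16 * (Rr ξ)⁻¹ ^ 2 := by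
  rw [Ky, norm_mul, norm_pow, norm_Kci, Complex.norm_real, Real.norm_eq_abs, abs_div]
  have := ub_le u
  gcongr
  norm_num

theorem inv_Rr_le (ξ : ℝ) : (Rr ξ)⁻¹ ≤ 2 := by
  rw [inv_le_comm₀ (Rr_pos ξ) (by norm_num)]; have := Rr_ge ξ; linarith

theorem norm_Ky' (θ ξ u : ℝ) : ‖Ky θ ξ u‖ ≤ 1/4 := by
  refine (norm_Ky θ ξ u).trans ?_
  have := inv_Rr_le ξ
  have h := (inv_pos.2 (Rr_pos ξ)).le
  calc _ ≤ 1/16 * (2:ℝ)^2 := by gcongr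
    _ = _ := by norm_num

theorem Kex_re (θ ξ u : ℝ) : (Kex θ ξ u).re ≤ 2 := by
  have hR := Rr_pos ξ
  have hR2 := Rr_ge ξ
  have e : Kex θ ξ u = (Kc θ ξ - ((tau2 ξ / 4 : ℝ) : ℂ) * Kci θ ξ) - ((tau2 ξ / 4 : ℝ) : ℂ) * Kci θ ξ * (aSer (Ky θ ξ u) - 1) := by
    rw [Kex]; ring
  have hs := Rr_four ξ
  have ht := tau2_ge ξ
  set t := tau2 ξ with ht'
  set s := 4 * Rr ξ ^ 2 with hs'
  have hs0 : 1 ≤ s := by rw [hs']; nlinarith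
  have hts : |t| ≤ s := by
    apply abs_le_of_sq_le_sq _ (by linarith); linarith
  have hts2 : s - t ≤ 3 := by
    by_cases h : 0 ≤ t
    · nlinarith
    · nlinarith
  have h1 : (Kc θ ξ - ((t / 4 : ℝ) : ℂ) * Kci θ ξ).re ≤ 3/2 := by
    have e1 : (Kc θ ξ - ((t / 4 : ℝ) : ℂ) * Kci θ ξ).re = (Rr ξ - t / 4 * (Rr ξ)⁻¹) * Real.cos θ := by
      rw [Kc, Kci, ← mul_assoc, ← Complex.ofReal_mul, sub_re, re_ofReal_mul, re_ofReal_mul, Complex.exp_re, Complex.exp_re]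
      simp
      ring
    rw [e1]
    have e2 : Rr ξ - t / 4 * (Rr ξ)⁻¹ = (s - t) / 4 * (Rr ξ)⁻¹ := by
      rw [hs']; field_simp
    have h0 : 0 ≤ Rr ξ - t / 4 * (Rr ξ)⁻¹ := by
      rw [e2]
      have := (abs_le.1 hts).2
      have : 0 ≤ s - t := by linarith
      positivity
    have h3 : Rr ξ - t / 4 * (Rr ξ)⁻¹ ≤ 3 / 4 * 2 := by
      rw [e2]
      have := inv_Rr_le ξ
      gcongr
    nlinarith [Real.cos_le_one θ]
  have h2 : ‖((t / 4 : ℝ) : ℂ) * Kci θ ξ * (aSer (Ky θ ξ u) - 1)‖ ≤ 1/16 := by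
    rw [norm_mul, norm_mul, norm_Kci, Complex.norm_real, Real.norm_eq_abs, abs_div]
    have ha := aSer_sub_one (norm_Ky' θ ξ u)
    have hb := norm_Ky θ ξ u
    have hinv := inv_Rr_le ξ
    calc _ ≤ s / |4| * (Rr ξ)⁻¹ * ((1/16 * (Rr ξ)⁻¹ ^ 2)/2) := by
          gcongr
          exact ha.trans (by linarith)
      _ = 1/32 * (Rr ξ)⁻¹ := by
          rw [hs', abs_of_pos (by norm_num : (0:ℝ) < 4)]; field_simp; norm_num
      _ ≤ _ := by linarith
  have h3 := (Complex.abs_re_le_norm _).trans h2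
  rw [e, sub_re]
  have := (abs_le.1 h3).1
  linarith

abbrev W0 : Unit → ℝ × ℝ → ℝ := fun _ x => 1 + ‖x‖
abbrev W1 : Unit × ℝ → ℝ × ℝ → ℝ := fun _ x => 1 + ‖x‖
theorem hW0 : ∀ p x, 1 ≤ W0 p x := fun p x => by simp [W0]
theorem hW1 : ∀ p x, 1 ≤ W1 p x := fun p x => by simp [W1]

theorem Kb_diff : DifferentiableOn ℂ Kb (Metric.ball 0 (1/2)) := by
  intro y hy
  have hy' : ‖y‖ < 1/2 := by simpa using hy
  have : 1 - y ∈ Complex.slitPlane := by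
    left
    have := (abs_le.1 (Complex.abs_re_le_norm y)).2
    simp; linarith
  refine DifferentiableAt.differentiableWithinAt ?_
  unfold Kb
  exact (((differentiableAt_const _).sub differentiableAt_id).clog this).const_mul _ |>.cexp

theorem Kt_TG (n : ℕ) : TG W0 n (fun _ x => Kt x) := by
  have hξ : TG W1 n (fun _ (x : ℝ × ℝ) => x.1) := TG.lin (ContinuousLinearMap.fst ℝ ℝ ℝ) ⟨1, 1, by norm_num, fun _ x => by simp⟩
  have hu : TG W1 n (fun _ (x : ℝ × ℝ) => x.2) := TG.lin (ContinuousLinearMap.snd ℝ ℝ ℝ) ⟨1, 1, by norm_num, fun _ x => by simp⟩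
  have ht := hξ.tau2 hW1
  have hR : TG W1 n (fun _ (x : ℝ × ℝ) => Rr x.1) := by
    refine (TG.const (1/2:ℝ)).mul hW1 (TG.rpow hW1 ((TG.const 1).add hW1 (ht.pow hW1 2)) (1/4) 1 one_pos (by norm_num) ?_)
    intro p x; nlinarith [sq_nonneg (tau2 x.1)]
  have hRi := hR.inv hW1 (1/2) (by norm_num) (fun p x => by
    rw [Real.norm_eq_abs, abs_of_pos (Rr_pos _)]; exact Rr_ge _)
  have hub : TG W1 n (fun _ (x : ℝ × ℝ) => ub x.2) := by
    have h2 := (TG.const (P := Unit × ℝ) (W := W1) (n := n) (2:ℝ))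
    exact (hu.mul hW1 ((h2.sub hW1 (h2.mul hW1 hu)).sT hW1)).mul hW1 ((h2.add hW1 (h2.mul hW1 hu)).sT hW1)
  have he : TG W1 n (fun (p : Unit × ℝ) (x : ℝ × ℝ) => Complex.exp (p.2 * I)) := by
    refine TG.const_x (by fun_prop) ⟨1, 0, fun p x => ?_⟩
    rw [Complex.norm_exp_ofReal_mul_I]; simp
  have he' : TG W1 n (fun (p : Unit × ℝ) (x : ℝ × ℝ) => Complex.exp (-(p.2 * I))) := by
    refine TG.const_x (by fun_prop) ⟨1, 0, fun p x => ?_⟩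
    rw [norm_expI]; simp
  have hc : TG W1 n (fun (p : Unit × ℝ) (x : ℝ × ℝ) => Kc p.2 x.1) := (hR.ofReal hW1).mul hW1 he
  have hci : TG W1 n (fun (p : Unit × ℝ) (x : ℝ × ℝ) => Kci p.2 x.1) := (hRi.ofReal hW1).mul hW1 he'
  have hy : TG W1 n (fun (p : Unit × ℝ) (x : ℝ × ℝ) => Ky p.2 x.1 x.2) :=
    (((hub.mul hW1 (TG.const (1/16:ℝ))).congr (fun p x => by ring)).ofReal hW1 (f := fun p x => ub x.2 / 16)).mul hW1 (hci.pow hW1 2)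
  have hK : ∀ (p : Unit × ℝ) (x : ℝ × ℝ), Ky p.2 x.1 x.2 ∈ Metric.closedBall (0:ℂ) (1/4) := fun p x => by
    simpa using norm_Ky' p.2 x.1 x.2
  have hsub : Metric.closedBall (0:ℂ) (1/4) ⊆ Metric.ball (0:ℂ) (1/2) := Metric.closedBall_subset_ball (by norm_num)
  have ha := TG.comp_holo hW1 Metric.isOpen_ball (isCompact_closedBall _ _) hsub aSer_diff hy hK
  have hb := TG.comp_holo hW1 Metric.isOpen_ball (isCompact_closedBall _ _) hsub Kb_diff hy hK
  have hex : TG W1 n (fun (p : Unit × ℝ) (x : ℝ × ℝ) => Kex p.2 x.1 x.2) :=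
    hc.sub hW1 (((((ht.mul hW1 (TG.const (1/4:ℝ))).congr (fun p x => by ring)).ofReal hW1
      (f := fun p x => tau2 x.1 / 4)).mul hW1 hci).mul hW1 ha)
  have hint : TG W1 n (fun (p : Unit × ℝ) (x : ℝ × ℝ) => Kint p.2 x) :=
    (hex.cexp hW1 2 (fun p x => Kex_re _ _ _)).mul hW1 hb
  have := TG.integral (W := W0) hW0 (fun p => continuous_const.add continuous_norm) 0 (2 * Real.pi) hint
  exact TG.clm hW0 (((2 * Real.pi)⁻¹ : ℝ) • ContinuousLinearMap.id ℝ ℂ) this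

/-- mean over circle -/
theorem circ_mean (R : ℝ) (hR : 0 < R) (f : ℂ → ℂ) :
    (∫ θ in (0:ℝ)..2 * Real.pi, f (R * Complex.exp (θ * I))) = I⁻¹ * ∮ z in C(0, R), z⁻¹ * f z := by
  rw [circleIntegral, ← intervalIntegral.integral_const_mul]
  congr 1; ext θ
  have h : circleMap 0 R θ ≠ 0 := circleMap_ne_center hR.ne'
  rw [deriv_circleMap, smul_eq_mul]
  have : circleMap 0 R θ = R * Complex.exp (θ * I) := by simp [circleMap]
  rw [this] at h ⊢
  have hR' := Complex.ofReal_ne_zero.2 hR.ne'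
  field_simp

theorem Kt_regular (lam : ℝ) (hl : 0 < lam) (h2 : lam ^ 2 ≤ 1/2) (l : ℕ) :
    Kt (lam * (2 * l + 1), lam ^ 2) = lag l (lam / 2) := by
  set ξ := lam * (2 * l + 1) with hξ
  have hξ0 : 0 ≤ ξ := by positivity
  have hub : ub (lam^2) = lam^2 := ub_eq (by rw [abs_of_nonneg (by positivity)]; exact h2)
  have hlam : lam / 4 < 1/2 := by nlinarith
  have hRg := Rr_ge ξ
  have key : ∀ θ : ℝ, Kint θ (ξ, lam^2) = (fun z : ℂ => z * (Complex.exp z * (z - lam/4) ^ l / (z + lam/4) ^ (l+1))) (Rr ξ * Complex.exp (θ * I)) := by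
    intro θ
    change _ = (fun z : ℂ => z * (Complex.exp z * (z - lam/4) ^ l / (z + lam/4) ^ (l+1))) (Kc θ ξ)
    have hcc := Kc_mul_Kci θ ξ
    set c := Kc θ ξ with hc
    have hc0 : c ≠ 0 := left_ne_zero_of_mul_eq_one hcc
    have hci : Kci θ ξ = c⁻¹ := eq_inv_of_mul_eq_one_right hcc
    set w : ℂ := (lam / 4 : ℝ) * c⁻¹ with hw
    have hy : Ky θ ξ (lam^2) = w ^ 2 := by
      rw [Ky, hub, hci, hw]; push_cast; ring
    have hwn : ‖w‖ < 1 := by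
      have := norm_Ky' θ ξ (lam^2)
      rw [hy, norm_pow] at this
      nlinarith [norm_nonneg w]
    have hre := abs_le.1 (Complex.abs_re_le_norm w)
    have p1 : 0 < (1 + w).re := by simp; linarith
    have p2 : 0 < (1 - w).re := by simp; linarith
    have n1 : 1 + w ≠ 0 := fun h => by rw [h] at p1; simp at p1
    have n2 : 1 - w ≠ 0 := fun h => by rw [h] at p2; simp at p2
    have hlog : Complex.log (1 - w^2) = Complex.log (1 + w) + Complex.log (1 - w) := by
      rw [show 1 - w^2 = (1+w)*(1-w) by ring]
      rw [Complex.log_mul_eq_add_log_iff n1 n2]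
      have a1 := abs_lt.1 (Complex.abs_arg_lt_pi_div_two_iff.2 (Or.inl p1))
      have a2 := abs_lt.1 (Complex.abs_arg_lt_pi_div_two_iff.2 (Or.inl p2))
      constructor <;> linarith
    have hex : Kex θ ξ (lam^2) = c - (2 * l + 1)/2 * (Complex.log (1 + w) - Complex.log (1 - w)) := by
      rw [Kex, hy, ← aSer_sq hwn, tau2_of_nonneg hξ0, hci, hξ, hw]
      push_cast
      ring
    simp only [Kint]
    rw [hex, hy, Kb, hlog, ← Complex.exp_add]
    rw [show c - (2 * (l:ℂ) + 1)/2 * (Complex.log (1 + w) - Complex.log (1 - w)) + -(1/2) * (Complex.log (1 + w) + Complex.log (1 - w))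
      = c + (l * Complex.log (1 - w) - ((l+1 : ℕ):ℂ) * Complex.log (1 + w)) by push_cast; ring]
    rw [Complex.exp_add, Complex.exp_sub, Complex.exp_nat_mul, Complex.exp_nat_mul, Complex.exp_log n1, Complex.exp_log n2]
    have m1 : c + lam/4 = c * (1 + w) := by rw [hw]; push_cast; field_simp
    have m2 : c - lam/4 = c * (1 - w) := by rw [hw]; push_cast; field_simp
    rw [m1, m2, mul_pow, mul_pow, pow_succ]
    field_simp
    ring
  have e : (∫ θ in (0:ℝ)..2 * Real.pi, Kint θ (ξ, lam^2)) = I⁻¹ * ∮ z in C(0, Rr ξ), (Complex.exp z * (z - lam/4) ^ l / (z + lam/4) ^ (l+1)) := by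
    refine (intervalIntegral.integral_congr (fun θ _ => key θ)).trans ((circ_mean _ (Rr_pos ξ) (fun z : ℂ => z * (Complex.exp z * (z - lam/4) ^ l / (z + lam/4) ^ (l+1)))).trans ?_)
    congr 1
    refine circleIntegral.integral_congr (Rr_pos ξ).le fun z hz => ?_
    have : z ≠ 0 := by
      rintro rfl
      have := Rr_pos ξ
      simp at hz; linarith
    field_simp
  have e2 : (∮ z in C(0, Rr ξ), (Complex.exp z * (z - lam/4) ^ l / (z + lam/4) ^ (l+1))) =
      Complex.exp (-(lam/4)) * ∮ w in C((lam/4 : ℝ), Rr ξ), Complex.exp (1 * w) * (w - (lam/2 : ℝ)) ^ l / w ^ (l+1) := by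
    rw [← circleIntegral.integral_const_mul]
    simp only [circleIntegral, deriv_circleMap]
    congr 1; ext θ
    have : circleMap ((lam/4 : ℝ) : ℂ) (Rr ξ) θ = circleMap 0 (Rr ξ) θ + lam/4 := by simp [circleMap]; ring
    rw [this, one_mul, Complex.exp_add, Complex.exp_neg]
    have h0 := Complex.exp_ne_zero (lam/4 : ℂ)
    rw [show circleMap 0 (Rr ξ) θ + lam/4 - ((lam/2 : ℝ) : ℂ) = circleMap 0 (Rr ξ) θ - lam/4 by push_cast; ring]
    congr 1
    field_simp
  rw [Kt, e, e2, circ_lag]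
  · have : -(((lam/2:ℝ):ℂ) * 1) = -((lam/2 : ℝ) : ℂ) := by ring
    rw [this, ← lagP_cast, lag_eq, Complex.real_smul]
    push_cast
    have hpi : (Real.pi : ℂ) ≠ 0 := by exact_mod_cast Real.pi_ne_zero
    rw [show (-((lam:ℂ)/2)/2) = -(lam/4) by ring]
    field_simp
  · simp [abs_of_pos hl]; linarith

theorem Kint_zero (θ ξ : ℝ) (hξ : 0 ≤ ξ) : Kint θ (ξ, 0) = (fun z : ℂ => Complex.exp (z - ξ / 4 * z⁻¹)) (Rr ξ * Complex.exp (θ * I)) := by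
  have hy : Ky θ ξ 0 = 0 := by simp [Ky, ub]
  have hci : Kci θ ξ = (Kc θ ξ)⁻¹ := eq_inv_of_mul_eq_one_right (Kc_mul_Kci θ ξ)
  simp only [Kint, Kex, hy, aSer_zero, Kb, sub_zero, Complex.log_one, mul_zero, Complex.exp_zero, mul_one, hci, tau2_of_nonneg hξ]
  simp [Kc]

theorem Kt_zero_eq (ξ : ℝ) (hξ : 0 ≤ ξ) : Kt (ξ, 0) = ((2 * Real.pi)⁻¹ : ℝ) •
    (I⁻¹ * ∮ z in C(0, Rr ξ), z⁻¹ * Complex.exp (z - ξ / 4 * z⁻¹)) := by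
  rw [Kt, ← circ_mean _ (Rr_pos ξ) (fun z : ℂ => Complex.exp (z - ξ / 4 * z⁻¹))]
  congr 1
  exact intervalIntegral.integral_congr (fun θ _ => Kint_zero θ ξ hξ)

theorem J0_exp (z : ℝ) : ((2 * Real.pi)⁻¹ : ℝ) • (∫ θ in (0:ℝ)..2 * Real.pi, Complex.exp ((z * Real.sin θ : ℝ) * I)) = J0 z := by
  have hc : Continuous fun θ : ℝ => Complex.exp ((z * Real.sin θ : ℝ) * I) := by fun_prop
  have hc2 : Continuous fun θ : ℝ => Complex.exp (-((z * Real.sin θ : ℝ) * I)) := by fun_prop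
  rw [← intervalIntegral.integral_add_adjacent_intervals (b := Real.pi) (hc.intervalIntegrable _ _) (hc.intervalIntegrable _ _)]
  have h2 : (∫ θ in Real.pi..2 * Real.pi, Complex.exp ((z * Real.sin θ : ℝ) * I)) = ∫ θ in (0:ℝ)..Real.pi, Complex.exp (-((z * Real.sin θ : ℝ) * I)) := by
    have := intervalIntegral.integral_comp_add_right (a := 0) (b := Real.pi) (fun θ : ℝ => Complex.exp ((z * Real.sin θ : ℝ) * I)) Real.pi
    rw [zero_add, ← two_mul] at this
    rw [← this]
    congr 1; ext θ
    rw [Real.sin_add_pi]; push_cast; congr 1; ring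
  rw [h2, ← intervalIntegral.integral_add (hc.intervalIntegrable _ _) (hc2.intervalIntegrable _ _), J0]
  have h3 : (∫ θ in (0:ℝ)..Real.pi, (Complex.exp ((z * Real.sin θ : ℝ) * I) + Complex.exp (-((z * Real.sin θ : ℝ) * I)))) =
     ((2 * ∫ θ in (0:ℝ)..Real.pi, Real.cos (z * Real.sin θ) : ℝ) : ℂ) := by
    rw [← intervalIntegral.integral_const_mul, ← intervalIntegral.integral_ofReal]
    congr 1; ext θ
    rw [Complex.ofReal_mul 2, Complex.ofReal_cos, Complex.cos, neg_mul]; push_cast; ring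
  rw [h3, Complex.real_smul, ← Complex.ofReal_mul]
  congr 1
  field_simp

theorem J0_abs (z : ℝ) : J0 |z| = J0 z := by
  rcases abs_choice z with h | h
  · rw [h]
  · rw [h, J0, J0]; simp

theorem J0_zero : J0 0 = 1 := by
  rw [J0]; simp [Real.pi_ne_zero]

theorem Kt_sing (z : ℝ) : Kt (z ^ 2, 0) = J0 z := by
  have hpi : (Real.pi : ℂ) ≠ 0 := by exact_mod_cast Real.pi_ne_zero
  rcases eq_or_ne z 0 with rfl | hz
  · have h0 : (0:ℝ)^2 = 0 := by norm_num
    rw [h0, Kt_zero_eq 0 le_rfl, J0_zero]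
    have := circ_exp 1 0 (Rr 0) (by simpa using Rr_pos _) 0
    simp only [zero_add, pow_one, pow_zero, Nat.factorial_zero, Nat.cast_one, div_one, mul_one, one_mul] at this
    have e : (∮ z in C(0, Rr 0), z⁻¹ * Complex.exp (z - ((0 : ℝ) : ℂ) / 4 * z⁻¹)) = ∮ z in C(0, Rr 0), Complex.exp z / z := by
      congr 1; ext w; simp; rw [div_eq_inv_mul]
    rw [e, this, Complex.real_smul]
    push_cast
    field_simp
  · rw [← J0_abs]
    have hz' : 0 < |z| / 2 := by positivity
    set ξ := z^2 with hξ
    have hξ0 : 0 ≤ ξ := by positivity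
    have hle : |z| / 2 ≤ Rr ξ := by
      have h4 := Rr_four ξ
      rw [tau2_of_nonneg hξ0] at h4
      have h5 : ξ ≤ 4 * Rr ξ ^ 2 := by
        apply le_of_sq_le_sq _ (by positivity); linarith
      apply le_of_sq_le_sq _ (Rr_pos ξ).le
      rw [div_pow, sq_abs]; linarith
    rw [Kt_zero_eq ξ hξ0]
    have hann := Complex.circleIntegral_sub_center_inv_smul_eq_of_differentiable_on_annulus_off_countable (c := 0) hz' hle
      (f := fun z : ℂ => Complex.exp (z - ξ / 4 * z⁻¹)) Set.countable_empty ?_ ?_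
    · simp only [sub_zero, smul_eq_mul] at hann
      rw [hann, ← circ_mean _ hz' (fun z : ℂ => Complex.exp (z - ξ / 4 * z⁻¹)), ← J0_exp]
      congr 2; ext θ
      congr 1
      have h0 : ((|z| : ℝ) : ℂ) ≠ 0 := by exact_mod_cast (abs_pos.2 hz).ne'
      have e1 : (ξ : ℂ) = ((|z| : ℝ) : ℂ) ^ 2 := by rw [hξ, ← Complex.ofReal_pow, sq_abs]
      rw [mul_inv, ← Complex.exp_neg, e1]
      push_cast
      rw [Complex.sin]
      have : ((|z| : ℝ) : ℂ) ^ 2 / 4 * ((((|z| : ℝ) : ℂ) / 2)⁻¹ * Complex.exp (-(θ * I))) = ((|z| : ℝ) : ℂ) / 2 * Complex.exp (-θ * I) := by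
        rw [neg_mul]; field_simp; norm_num
      rw [this]
      have hI : I * I = -1 := Complex.I_mul_I
      linear_combination (-((|z| : ℝ) : ℂ) / 2 * (Complex.exp (-θ * I) - Complex.exp (θ * I))) * hI
    · intro w hw
      have : w ≠ 0 := by
        rintro rfl; exact hw.2 (by simpa using hz)
      exact (by fun_prop (disch := assumption) : ContinuousAt (fun z : ℂ => Complex.exp (z - ξ / 4 * z⁻¹)) w).continuousWithinAt
    · intro w hw
      have : w ≠ 0 := by
        rintro rfl; exact hw.1.2 (by simp [hz'.le])
      fun_prop (disch := assumption)

end Ktsec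

set_option linter.unusedSectionVars false
set_option linter.unusedSimpArgs false
set_option linter.unusedVariables false
section Nksec
open Topology

def vN (u : ℝ) : ℝ := 1/8 + (u - 1/8) * Real.smoothTransition (8 * u - 1)
def LamN (u : ℝ) : ℝ := vN u ^ (1/2 : ℝ)
def etaN (y : ℝ) : ℝ := Real.smoothTransition (2 - 4 * y) * Real.smoothTransition (2 + 4 * y)
def sN (x : ℝ × ℝ) : ℝ := x.1 * (LamN x.2)⁻¹
def gN (l : ℕ) (x : ℝ × ℝ) : ℝ := LD 0 l (LamN x.2 * (1/2)) * etaN (sN x - (2 * l + 1))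
def NN (x : ℝ × ℝ) : ℝ := gN ⌊sN x / 2⌋₊ x

theorem vN_ge (u : ℝ) : 1/8 ≤ vN u := by
  rw [vN]
  by_cases h : u ≤ 1/8
  · rw [Real.smoothTransition.zero_of_nonpos (by linarith)]; linarith
  · have := Real.smoothTransition.nonneg (8 * u - 1)
    have : 0 ≤ (u - 1/8) * Real.smoothTransition (8 * u - 1) := mul_nonneg (by linarith) this
    linarith

theorem LamN_ge (u : ℝ) : 1/4 ≤ LamN u := by
  rw [LamN, ← Real.sqrt_eq_rpow]
  apply Real.le_sqrt_of_sq_le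
  have := vN_ge u
  norm_num at *; linarith

theorem LamN_pos (u : ℝ) : 0 < LamN u := by have := LamN_ge u; linarith

theorem LamN_sq {lam : ℝ} (hl : 0 < lam) (h : 1/4 ≤ lam ^ 2) : LamN (lam ^ 2) = lam := by
  rw [LamN, vN, Real.smoothTransition.one_of_one_le (by linarith), ← Real.sqrt_eq_rpow]
  rw [show 1/8 + (lam^2 - 1/8) * 1 = lam^2 by ring, Real.sqrt_sq hl.le]

theorem etaN_zero : etaN 0 = 1 := by
  rw [etaN, Real.smoothTransition.one_of_one_le (by norm_num), Real.smoothTransition.one_of_one_le (by norm_num)]; norm_num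

theorem etaN_ne {y : ℝ} (h : etaN y ≠ 0) : |y| < 1/2 := by
  by_contra h'
  apply h
  rcases le_abs.1 (not_lt.1 h') with h1 | h1
  · rw [etaN, Real.smoothTransition.zero_of_nonpos (by linarith), zero_mul]
  · rw [etaN, Real.smoothTransition.zero_of_nonpos (x := 2 + 4 * y) (by linarith), mul_zero]

abbrev WN : ℕ → ℝ × ℝ → ℝ := fun l x => (l + 1) * (1 + ‖x‖)
theorem hWN : ∀ p x, 1 ≤ WN p x := fun l x => by
  have := norm_nonneg x
  have h : (0:ℝ) ≤ l := Nat.cast_nonneg l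
  simp only [WN]
  nlinarith [mul_nonneg h this]

theorem WN_l (l : ℕ) (x) : (l + 1 : ℝ) ≤ WN l x := by
  have := norm_nonneg x
  have h : (0:ℝ) ≤ l := Nat.cast_nonneg l
  simp only [WN]
  nlinarith [mul_nonneg h this]

theorem WN_x (l : ℕ) (x) : 1 + ‖x‖ ≤ WN l x := by
  have := norm_nonneg x
  have h : (0:ℝ) ≤ l := Nat.cast_nonneg l
  simp only [WN]
  nlinarith [mul_nonneg h this]

theorem LamN_TG {P : Type} [TopologicalSpace P] {W : P → ℝ × ℝ → ℝ} (hW : ∀ p x, 1 ≤ W p x) (n : ℕ)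
    (hu : TG W n (fun _ (x : ℝ × ℝ) => x.2)) : TG W n (fun _ x => LamN x.2) := by
  have c := fun r : ℝ => (TG.const (P := P) (W := W) (n := n) r)
  refine TG.rpow hW (f := fun _ x => vN x.2) ?_ (1/2) (1/8) (by norm_num) (by norm_num) (fun _ x => vN_ge _)
  exact (c _).add hW ((hu.sub hW (c _)).mul hW ((((c 8).mul hW hu).sub hW (c 1)).sT hW))

theorem gN_TG (n : ℕ) : TG WN n gN := by
  have hxb : ∃ (C : ℝ) (k : ℕ), 0 ≤ C ∧ ∀ (p : ℕ) (x : ℝ × ℝ), ‖x‖ ≤ C * WN p x ^ k :=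
    ⟨1, 1, by norm_num, fun p x => by have := WN_x p x; rw [pow_one, one_mul]; linarith⟩
  have hξ : TG WN n (fun _ (x : ℝ × ℝ) => x.1) := TG.lin (ContinuousLinearMap.fst ℝ ℝ ℝ) hxb
  have hu : TG WN n (fun _ (x : ℝ × ℝ) => x.2) := TG.lin (ContinuousLinearMap.snd ℝ ℝ ℝ) hxb
  have hL := LamN_TG hWN n hu
  have c := fun r : ℝ => (TG.const (P := ℕ) (W := WN) (n := n) r)
  have hLi := hL.inv hWN (1/4) (by norm_num) (fun p x => by
    rw [Real.norm_eq_abs, abs_of_pos (LamN_pos _)]; exact LamN_ge _)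
  have hs : TG WN n (fun (_:ℕ) x => sN x) := hξ.mul hWN hLi
  have hl : TG WN n (fun (l:ℕ) (x : ℝ × ℝ) => (2 * l + 1 : ℝ)) := by
    refine TG.const_x continuous_of_discreteTopology ⟨2, 1, fun p x => ?_⟩
    have := WN_l p x
    have h : (0:ℝ) ≤ p := Nat.cast_nonneg p
    rw [Real.norm_eq_abs, abs_of_nonneg (by linarith), pow_one]; linarith
  have hd := hs.sub hWN hl
  have heta : TG WN n (fun (l:ℕ) x => etaN (sN x - (2 * l + 1))) :=
    (((c 2).sub hWN ((c 4).mul hWN hd)).sT hWN).mul hWN (((c 2).add hWN ((c 4).mul hWN hd)).sT hWN)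
  refine TG.mul hWN ?_ heta
  refine TG.comp1 hWN (f := fun _ x => LamN x.2 * (1/2)) (fun n l => LD n l) (fun j p x => LD_hasDeriv _ _ _) ?_ 0 (hL.mul hWN (c _))
  intro j
  have hLc : Continuous fun x : ℝ × ℝ => LamN x.2 := hL.pb.1.comp (Continuous.prodMk_right 0)
  refine ⟨?_, 1, j, fun l x => ?_⟩
  · rw [continuous_prod_of_discrete_left]
    intro l
    have : Continuous (LD j l) := continuous_iff_continuousAt.2 fun y => (LD_hasDeriv j l y).continuousAt
    exact this.comp (hLc.mul continuous_const)
  · rw [Real.norm_eq_abs, one_mul]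
    refine (LD_bound j l _ (by have := LamN_pos x.2; positivity)).trans ?_
    exact pow_le_pow_left₀ (by positivity) (WN_l l x) _

theorem floor_aux {s : ℝ} {l : ℕ} (h1 : (l:ℝ) ≤ s) (h2 : s < l + 1) : ⌊s⌋₊ = l :=
  (Nat.floor_eq_iff ((Nat.cast_nonneg l).trans h1)).2 ⟨h1, h2⟩

theorem gN_ne {l : ℕ} {x} (h : gN l x ≠ 0) : |sN x - (2 * l + 1)| < 1/2 := etaN_ne (right_ne_zero_of_mul h)

theorem NN_TG (n : ℕ) : TG W0 n (fun _ x => NN x) := by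
  refine TG.glue 2 1 ?_ (gN_TG n)
  intro x0
  have hsc : Continuous sN := by
    have hu : TG W0 1 (fun _ (x : ℝ × ℝ) => x.2) := TG.lin (ContinuousLinearMap.snd ℝ ℝ ℝ) ⟨1, 1, by norm_num, fun _ x => by simp⟩
    have := ((LamN_TG hW0 1 hu).pb.1.comp (Continuous.prodMk_right ()))
    have h2 : Continuous fun x : ℝ × ℝ => LamN x.2 := this
    exact continuous_fst.mul (h2.inv₀ fun x => (LamN_pos _).ne')
  refine ⟨⌊sN x0 / 2⌋₊, ?_, ?_⟩
  · have := hsc.continuousAt (x := x0) (Metric.ball_mem_nhds (sN x0) (by norm_num : (0:ℝ) < 1/4))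
    filter_upwards [this] with x hx
    have hx : |sN x - sN x0| < 1/4 := by simpa [Real.dist_eq] using hx
    rw [abs_lt] at hx
    rw [NN]
    by_cases h1 : gN ⌊sN x / 2⌋₊ x = 0
    · by_cases h2 : gN ⌊sN x0 / 2⌋₊ x = 0
      · rw [h1, h2]
      · have := abs_lt.1 (gN_ne h2)
        rw [floor_aux (s := sN x / 2) (l := ⌊sN x0 / 2⌋₊) (by linarith) (by linarith)]
    · have := abs_lt.1 (gN_ne h1)
      rw [floor_aux (s := sN x0 / 2) (l := ⌊sN x / 2⌋₊) (by linarith) (by linarith)]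
  · have h1 : (⌊sN x0 / 2⌋₊ : ℝ) ≤ |sN x0 / 2| := by
      calc (⌊sN x0 / 2⌋₊ : ℝ) ≤ (⌊|sN x0 / 2|⌋₊ : ℝ) := by
            exact_mod_cast Nat.floor_mono (le_abs_self _)
        _ ≤ _ := Nat.floor_le (abs_nonneg _)
    have h2 : |sN x0 / 2| ≤ 2 * ‖x0‖ := by
      have hi : (LamN x0.2)⁻¹ ≤ 4 := by
        rw [inv_le_comm₀ (LamN_pos _) (by norm_num)]; have := LamN_ge x0.2; linarith
      have hi0 := inv_pos.2 (LamN_pos x0.2)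
      have : |x0.1| ≤ ‖x0‖ := norm_fst_le x0
      rw [sN, abs_div, abs_mul, abs_of_pos hi0, abs_of_pos (by norm_num : (0:ℝ) < 2)]
      have : |x0.1| * (LamN x0.2)⁻¹ ≤ ‖x0‖ * 4 := by gcongr
      linarith
    rw [pow_one]; linarith

theorem NN_regular {lam : ℝ} (hl : 0 < lam) (h : 1/4 ≤ lam ^ 2) (l : ℕ) :
    NN (lam * (2 * l + 1), lam ^ 2) = lag l (lam / 2) := by
  have hs : sN (lam * (2 * l + 1), lam ^ 2) = 2 * l + 1 := by
    rw [sN, LamN_sq hl h]; field_simp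
  rw [NN, hs, floor_aux (l := l) (by linarith) (by linarith), gN, hs, LamN_sq hl h, sub_self, etaN_zero, mul_one, LD]
  congr 1; ring

def kap (x : ℝ × ℝ) : ℂ := Real.smoothTransition (2 - 4 * x.2) • Kt x + ((1 - Real.smoothTransition (2 - 4 * x.2)) * NN x : ℝ)

theorem kap_TG (n : ℕ) : TG W0 n (fun _ x => kap x) := by
  have hu : TG W0 n (fun _ (x : ℝ × ℝ) => x.2) := TG.lin (ContinuousLinearMap.snd ℝ ℝ ℝ) ⟨1, 1, by norm_num, fun _ x => by simp⟩
  have c := fun r : ℝ => (TG.const (P := Unit) (W := W0) (n := n) r)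
  have hs := ((c 2).sub hW0 ((c 4).mul hW0 hu)).sT hW0
  exact (hs.smul hW0 (Kt_TG n)).add hW0 ((((c 1).sub hW0 hs).mul hW0 (NN_TG n)).ofReal hW0)

theorem kap_sing (z : ℝ) : kap (z ^ 2, 0) = J0 z := by
  rw [kap, Kt_sing]
  simp only
  rw [Real.smoothTransition.one_of_one_le (by norm_num)]; simp

theorem kap_zero : kap (0, 0) = 1 := by
  have := kap_sing 0
  rw [J0_zero] at this
  simpa using this

theorem kap_regular {lam : ℝ} (hl : 0 < lam) (l : ℕ) : kap (lam * (2 * l + 1), lam ^ 2) = lag l (lam / 2) := by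
  rw [kap]
  simp only
  by_cases h1 : lam ^ 2 ≤ 1/4
  · rw [Kt_regular lam hl (by linarith), Real.smoothTransition.one_of_one_le (by linarith)]; simp
  rw [NN_regular hl (by linarith)]
  by_cases h2 : lam ^ 2 ≤ 1/2
  · rw [Kt_regular lam hl (by linarith)]
    simp only [Complex.real_smul]; push_cast; ring
  · rw [Real.smoothTransition.zero_of_nonpos (by linarith)]; simp

end Nksec

set_option linter.unusedSectionVars false
set_option linter.unusedSimpArgs false
set_option linter.unusedVariables false
section Kersec
open Topology

abbrev PP := (Fin 3 → ℝ) × ℝ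
abbrev E4 := ℝ × ℝ × ℝ × ℝ

def rho (p : PP) : ℝ := (p.1 0) ^ 2 + (p.1 1) ^ 2

def Ker (p : PP) (x : E4) : ℂ :=
  CT (p.2 ^ 2 * x.2.1 + 2 * p.2 * p.1 2 * x.2.2.1 + p.1 2 ^ 2 * x.2.2.2) *
    kap (rho p * (x.1 - x.2.2.2), rho p ^ 2 * x.2.1)

abbrev WK : PP → E4 → ℝ := fun p x => (1 + ‖p‖) * (1 + ‖x‖)

theorem hWK : ∀ p x, 1 ≤ WK p x := fun p x => by
  have := norm_nonneg x
  have h := norm_nonneg p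
  simp only [WK]
  nlinarith [mul_nonneg h this]

theorem WK_p (p x) : 1 + ‖p‖ ≤ WK p x := by
  have := norm_nonneg x
  have h := norm_nonneg p
  simp only [WK]
  nlinarith [mul_nonneg h this]

theorem WK_x (p x) : 1 + ‖x‖ ≤ WK p x := by
  have := norm_nonneg x
  have h := norm_nonneg p
  simp only [WK]
  nlinarith [mul_nonneg h this]

theorem norm_PP0 (p : PP) (i : Fin 3) : ‖p.1 i‖ ≤ ‖p‖ := (norm_le_pi_norm p.1 i).trans (norm_fst_le p)

theorem Ker_TG (n : ℕ) : TG WK n Ker := by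
  have hxb : ∃ (C : ℝ) (k : ℕ), 0 ≤ C ∧ ∀ (p : PP) (x : E4), ‖x‖ ≤ C * WK p x ^ k :=
    ⟨1, 1, by norm_num, fun p x => by have := WK_x p x; rw [pow_one, one_mul]; linarith⟩
  have c := fun r : ℝ => (TG.const (P := PP) (W := WK) (n := n) r)
  have x1 : TG WK n (fun _ (x : E4) => x.1) := TG.lin (ContinuousLinearMap.fst ℝ ℝ (ℝ × ℝ × ℝ)) hxb
  have x2 : TG WK n (fun _ (x : E4) => x.2.1) :=
    TG.lin ((ContinuousLinearMap.fst ℝ ℝ (ℝ × ℝ)).comp (ContinuousLinearMap.snd ℝ ℝ (ℝ × ℝ × ℝ))) hxb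
  have x3 : TG WK n (fun _ (x : E4) => x.2.2.1) :=
    TG.lin ((ContinuousLinearMap.fst ℝ ℝ ℝ).comp ((ContinuousLinearMap.snd ℝ ℝ (ℝ × ℝ)).comp (ContinuousLinearMap.snd ℝ ℝ (ℝ × ℝ × ℝ)))) hxb
  have x4 : TG WK n (fun _ (x : E4) => x.2.2.2) :=
    TG.lin ((ContinuousLinearMap.snd ℝ ℝ ℝ).comp ((ContinuousLinearMap.snd ℝ ℝ (ℝ × ℝ)).comp (ContinuousLinearMap.snd ℝ ℝ (ℝ × ℝ × ℝ)))) hxb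
  have pi : ∀ i : Fin 3, TG WK n (fun (p : PP) (_ : E4) => p.1 i) := fun i => by
    refine TG.const_x (by fun_prop) ⟨1, 1, fun p x => ?_⟩
    rw [one_mul, pow_one]
    exact (norm_PP0 p i).trans (by have := WK_p p x; linarith)
  have pt : TG WK n (fun (p : PP) (_ : E4) => p.2) := by
    refine TG.const_x (by fun_prop) ⟨1, 1, fun p x => ?_⟩
    rw [one_mul, pow_one]
    exact (norm_snd_le p).trans (by have := WK_p p x; linarith)
  have hr : TG WK n (fun (p : PP) (_ : E4) => rho p) := ((pi 0).pow hWK 2).add hWK ((pi 1).pow hWK 2)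
  have hm : TG WK n (fun p (x : E4) => (rho p * (x.1 - x.2.2.2), rho p ^ 2 * x.2.1)) := by
    have := (TG.clm hWK (ContinuousLinearMap.inl ℝ ℝ ℝ) (hr.mul hWK (x1.sub hWK x4))).add hWK
      (TG.clm hWK (ContinuousLinearMap.inr ℝ ℝ ℝ) ((hr.pow hWK 2).mul hWK x2))
    exact this.congr (fun p x => by simp)
  refine TG.mul hWK (TG.CT hWK ?_) ?_
  · exact (((pt.pow hWK 2).mul hWK x2).add hWK ((((c 2).mul hWK pt).mul hWK (pi 2)).mul hWK x3)).add hWK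
      (((pi 2).pow hWK 2).mul hWK x4)
  · refine TG.comp (W2 := W0) hWK (φ := fun _ => ()) continuous_const ?_ hW0 hm (kap_TG n)
    obtain ⟨C, k, hC, h⟩ := PB.posC hWK hm.pb
    refine ⟨1 + C, k, fun p x => ?_⟩
    have := h p x
    have h1 : 1 ≤ WK p x ^ k := one_le_pow₀ (hWK p x)
    simp only [W0]
    nlinarith

theorem Ker_regular {lam : ℝ} (hl : 0 < lam) (l : ℕ) (r : ℝ) (p : PP) :
    Ker p (lam * (2 * l + 1) + r ^ 2, lam ^ 2, lam * r, r ^ 2) = sph' lam l r p := by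
  have h1 : CT (p.2 ^ 2 * lam ^ 2 + 2 * p.2 * p.1 2 * (lam * r) + p.1 2 ^ 2 * r ^ 2) = Real.cos (lam * p.2 + r * p.1 2) := by
    rw [← CT_sq]; congr 1; ring
  have h2 : kap (rho p * (lam * (2 * l + 1) + r ^ 2 - r ^ 2), rho p ^ 2 * lam ^ 2) = lag l (lam / 2 * rho p) := by
    have h0 : 0 ≤ rho p := by unfold rho; positivity
    rcases h0.eq_or_lt with h | h
    · rw [← h]; simp [kap_zero, lag_zero]
    · have := kap_regular (lam := rho p * lam) (by positivity) l
      rw [show lam / 2 * rho p = rho p * lam / 2 by ring, ← this]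
      congr 2 <;> ring
  simp only [Ker, sph']
  rw [h1, h2, Complex.ofReal_mul]; rfl

theorem Ker_sing (zeta r : ℝ) (p : PP) : Ker p (zeta ^ 2 + r ^ 2, 0, 0, r ^ 2) = sphSing' zeta r p := by
  have h1 : CT (p.2 ^ 2 * 0 + 2 * p.2 * p.1 2 * 0 + p.1 2 ^ 2 * r ^ 2) = Real.cos (r * p.1 2) := by
    rw [← CT_sq]; congr 1; ring
  have h2 : kap (rho p * (zeta ^ 2 + r ^ 2 - r ^ 2), rho p ^ 2 * 0) = J0 (zeta * √(rho p)) := by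
    have h0 : 0 ≤ rho p := by unfold rho; positivity
    rw [← kap_sing, mul_pow, Real.sq_sqrt h0]
    congr 2 <;> ring
  simp only [Ker, sphSing']
  rw [h1, h2, Complex.ofReal_mul, mul_comm]; rfl

end Kersec

set_option linter.unusedSectionVars false
set_option linter.unusedSimpArgs false
set_option linter.unusedVariables false
section Trsec
open Topology

theorem SN_nonneg {E : Type*} [NormedAddCommGroup E] [NormedSpace ℝ E] (a : ℕ) (f : SchwartzMap E ℂ) : 0 ≤ SN a f :=
  apply_nonneg _ _

theorem SN_mono {E : Type*} [NormedAddCommGroup E] [NormedSpace ℝ E] {a b : ℕ} (h : a ≤ b) (f : SchwartzMap E ℂ) : SN a f ≤ SN b f := by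
  have : (Finset.Iic (a, a)).sup (schwartzSeminormFamily ℝ E ℂ) ≤ (Finset.Iic (b, b)).sup (schwartzSeminormFamily ℝ E ℂ) :=
    Finset.sup_mono (Finset.Iic_subset_Iic.2 ⟨h, h⟩)
  exact this f

theorem SN_pt {E : Type*} [NormedAddCommGroup E] [NormedSpace ℝ E] {a k n : ℕ} (hk : k ≤ a) (hn : n ≤ a)
    (f : SchwartzMap E ℂ) (x : E) : (1 + ‖x‖) ^ k * ‖iteratedFDeriv ℝ n f x‖ ≤ 2 ^ a * SN a f :=
  SchwartzMap.one_add_le_sup_seminorm_apply (𝕜 := ℝ) (m := (a, a)) hk hn f x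

instance instHaarPP : (volume : Measure PP).IsAddHaarMeasure :=
  inferInstanceAs ((volume : Measure (Fin 3 → ℝ)).prod (volume : Measure ℝ)).IsAddHaarMeasure

theorem jap_int : Integrable (fun p : PP => (1 + ‖p‖) ^ (-(5:ℝ))) := by
  apply integrable_one_add_norm
  simp; norm_num

theorem G_decay (k : ℕ) (G : SchwartzMap PP ℂ) (p : PP) :
    ‖G p‖ * (1 + ‖p‖) ^ k ≤ 2 ^ (k+5) * SN (k+5) G * (1 + ‖p‖) ^ (-(5:ℝ)) := by
  have h := SN_pt (k := k + 5) (n := 0) (a := k + 5) le_rfl (Nat.zero_le _) G p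
  rw [norm_iteratedFDeriv_zero] at h
  have h0 : (0:ℝ) < 1 + ‖p‖ := by positivity
  have e : (1 + ‖p‖) ^ (-(5:ℝ)) = ((1 + ‖p‖) ^ 5)⁻¹ := by
    rw [Real.rpow_neg h0.le]; norm_cast
  rw [e, ← div_eq_mul_inv, le_div_iff₀ (by positivity)]
  calc _ = (1 + ‖p‖) ^ (k + 5) * ‖G p‖ := by ring
    _ ≤ _ := h

variable {F F' : Type} [NormedAddCommGroup F] [NormedSpace ℝ F] [NormedAddCommGroup F'] [NormedSpace ℝ F']

theorem BK_bound (B : ℂ →L[ℝ] F →L[ℝ] F') {K : PP → E4 → F} {C : ℝ} {k : ℕ} (hC : 0 ≤ C)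
    (h : ∀ p x, ‖K p x‖ ≤ C * WK p x ^ k) (G : SchwartzMap PP ℂ) (p : PP) (x : E4) :
    ‖B (G p) (K p x)‖ ≤ (‖B‖ * C * 2 ^ (k+5) * SN (k+5) G * (1 + ‖x‖) ^ k) * (1 + ‖p‖) ^ (-(5:ℝ)) := by
  calc _ ≤ ‖B‖ * ‖G p‖ * ‖K p x‖ := B.le_opNorm₂ _ _
    _ ≤ ‖B‖ * ‖G p‖ * (C * WK p x ^ k) := by gcongr; exact h p x
    _ = ‖B‖ * C * (1 + ‖x‖) ^ k * (‖G p‖ * (1 + ‖p‖) ^ k) := by rw [mul_pow]; ring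
    _ ≤ ‖B‖ * C * (1 + ‖x‖) ^ k * (2 ^ (k+5) * SN (k+5) G * (1 + ‖p‖) ^ (-(5:ℝ))) :=
        mul_le_mul_of_nonneg_left (G_decay k G p) (by positivity)
    _ = _ := by ring

theorem BK_cont (B : ℂ →L[ℝ] F →L[ℝ] F') {K : PP → E4 → F} (h : PB WK K) (G : SchwartzMap PP ℂ) (x : E4) :
    Continuous fun p => B (G p) (K p x) := by
  have h1 : Continuous fun p => K p x := h.1.comp (f := fun p => (p, x)) (by fun_prop)
  exact (B.continuous.comp G.continuous).clm_apply h1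

theorem BK_int (B : ℂ →L[ℝ] F →L[ℝ] F') {K : PP → E4 → F} (h : PB WK K) (G : SchwartzMap PP ℂ) (x : E4) :
    Integrable fun p => B (G p) (K p x) := by
  obtain ⟨C, k, hC, hb⟩ := h.posC hWK
  exact (jap_int.const_mul _).mono' (BK_cont B h G x).aestronglyMeasurable
    (Filter.Eventually.of_forall fun p => BK_bound B hC hb G p x)

theorem BK_norm (B : ℂ →L[ℝ] F →L[ℝ] F') {K : PP → E4 → F} {C : ℝ} {k : ℕ} (hC : 0 ≤ C)
    (h : ∀ p x, ‖K p x‖ ≤ C * WK p x ^ k) (G : SchwartzMap PP ℂ) (x : E4) :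
    ‖∫ p, B (G p) (K p x)‖ ≤ (‖B‖ * C * 2 ^ (k+5) * ∫ p : PP, (1 + ‖p‖) ^ (-(5:ℝ))) * SN (k+5) G * (1 + ‖x‖) ^ k := by
  refine (norm_integral_le_of_norm_le (jap_int.const_mul _)
    (Filter.Eventually.of_forall fun p => BK_bound B hC h G p x)).trans (le_of_eq ?_)
  rw [integral_const_mul]; ring

theorem loc_bd (x0 : E4) (k : ℕ) {x : E4} (hx : x ∈ Metric.ball x0 1) : (1 + ‖x‖) ^ k ≤ (2 + ‖x0‖) ^ k := by
  have : ‖x‖ ≤ ‖x0‖ + 1 := by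
    have h1 : ‖x - x0‖ < 1 := by simpa [dist_eq_norm] using hx
    have := norm_le_insert' x x0
    linarith
  exact pow_le_pow_left₀ (by positivity) (by linarith) k

theorem BK_bound_loc (B : ℂ →L[ℝ] F →L[ℝ] F') {K : PP → E4 → F} {C : ℝ} {k : ℕ} (hC : 0 ≤ C)
    (h : ∀ p x, ‖K p x‖ ≤ C * WK p x ^ k) (G : SchwartzMap PP ℂ) (p : PP) (x0 x : E4) (hx : x ∈ Metric.ball x0 1) :
    ‖B (G p) (K p x)‖ ≤ (‖B‖ * C * 2 ^ (k+5) * SN (k+5) G * (2 + ‖x0‖) ^ k) * (1 + ‖p‖) ^ (-(5:ℝ)) := by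
  refine (BK_bound B hC h G p x).trans ?_
  have := loc_bd x0 k hx
  have := SN_nonneg (k+5) G
  gcongr

theorem BK_bound_ex (B : ℂ →L[ℝ] F →L[ℝ] F') {K : PP → E4 → F} (h : PB WK K) (G : SchwartzMap PP ℂ) (x0 : E4) :
    ∃ M : ℝ, ∀ p, ∀ x ∈ Metric.ball x0 1, ‖B (G p) (K p x)‖ ≤ M * (1 + ‖p‖) ^ (-(5:ℝ)) := by
  obtain ⟨C, k, hC, hb⟩ := h.posC hWK
  exact ⟨_, fun p x hx => BK_bound_loc B hC hb G p x0 x hx⟩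

theorem BK_TG {n : ℕ} : ∀ {F F' : Type} [NormedAddCommGroup F] [NormedSpace ℝ F] [NormedAddCommGroup F'] [NormedSpace ℝ F']
    (B : ℂ →L[ℝ] F →L[ℝ] F') {K : PP → E4 → F}, TG WK n K →
    ∃ (C : ℝ) (k m : ℕ), 0 ≤ C ∧ ∀ G : SchwartzMap PP ℂ, ContDiff ℝ n (fun x => ∫ p, B (G p) (K p x)) ∧
      ∀ i ≤ n, ∀ x, ‖iteratedFDeriv ℝ i (fun x => ∫ p, B (G p) (K p x)) x‖ ≤ C * SN m G * (1 + ‖x‖) ^ k := by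
  induction n with
  | zero =>
    intro F F' _ _ _ _ B K hK
    obtain ⟨C, k, hC, hb⟩ := PB.posC hWK hK
    refine ⟨(‖B‖ * C * 2 ^ (k+5) * ∫ p : PP, (1 + ‖p‖) ^ (-(5:ℝ))), k, k+5, ?_, fun G => ⟨?_, ?_⟩⟩
    rotate_left 2
    · intro i hi x
      obtain rfl : i = 0 := by omega
      rw [norm_iteratedFDeriv_zero]
      exact BK_norm B hC hb G x
    · positivity
    · refine contDiff_zero.2 (continuous_iff_continuousAt.2 fun x0 => ?_)
      refine continuousAt_of_dominated (bound := fun p => (‖B‖ * C * 2 ^ (k+5) * SN (k+5) G * (2 + ‖x0‖) ^ k) * (1 + ‖p‖) ^ (-(5:ℝ))) ?_ ?_ ?_ ?_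
      · exact Filter.Eventually.of_forall fun x => (BK_cont B hK G x).aestronglyMeasurable
      · filter_upwards [Metric.ball_mem_nhds x0 one_pos] with x hx
        exact Filter.Eventually.of_forall fun p => BK_bound_loc B hC hb G p x0 x hx
      · exact jap_int.const_mul _
      · refine Filter.Eventually.of_forall fun p => ?_
        have : Continuous (K p) := hK.1.comp (Continuous.prodMk_right p)
        exact ((B (G p)).continuous.comp this).continuousAt
  | succ n ih =>
    intro F F' _ _ _ _ B K hK
    obtain ⟨K1, K', K2, K3⟩ := hK
    obtain ⟨C, k, hC, hb⟩ := PB.posC hWK K1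
    obtain ⟨A, j, m, hA, ha⟩ := ih (B.precompR E4) K3
    have hder : ∀ G : SchwartzMap PP ℂ, ∀ x0, HasFDerivAt (fun x => ∫ p, B (G p) (K p x)) (∫ p, B.precompR E4 (G p) (K' p x0)) x0 := by
      intro G x0
      obtain ⟨M, hM⟩ := BK_bound_ex (B.precompR E4) K3.pb G x0
      refine hasFDerivAt_integral_of_dominated_of_fderiv_le (F := fun x p => B (G p) (K p x))
        (F' := fun x p => B.precompR E4 (G p) (K' p x)) (Metric.ball_mem_nhds x0 one_pos)
        (bound := fun p => M * (1 + ‖p‖) ^ (-(5:ℝ))) ?_ ?_ ?_ ?_ ?_ ?_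
      · exact Filter.Eventually.of_forall fun x => (BK_cont B K1 G x).aestronglyMeasurable
      · exact BK_int B K1 G x0
      · exact (BK_cont (B.precompR E4) K3.pb G x0).aestronglyMeasurable
      · exact Filter.Eventually.of_forall fun p x hx => hM p x hx
      · exact jap_int.const_mul _
      · exact Filter.Eventually.of_forall fun p x hx => (B (G p)).hasFDerivAt.comp x (K2 p x)
    set C0 := (‖B‖ * C * 2 ^ (k+5) * ∫ p : PP, (1 + ‖p‖) ^ (-(5:ℝ))) with hC0
    have hC0' : 0 ≤ C0 := by positivity
    refine ⟨C0 + A, k + j, (k + 5) + m, by positivity, fun G => ?_⟩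
    have hf : fderiv ℝ (fun x => ∫ p, B (G p) (K p x)) = fun x0 => ∫ p, B.precompR E4 (G p) (K' p x0) := by
      ext1 x; exact (hder G x).fderiv
    refine ⟨?_, fun i hi x => ?_⟩
    · rw [Nat.cast_add, Nat.cast_one, contDiff_succ_iff_fderiv]
      refine ⟨fun x => (hder G x).differentiableAt, by simp, ?_⟩
      rw [hf]; exact (ha G).1
    · have hx : 1 ≤ 1 + ‖x‖ := by have := norm_nonneg x; linarith
      cases i with
      | zero =>
        rw [norm_iteratedFDeriv_zero]
        refine (BK_norm B hC hb G x).trans ?_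
        have h1 := SN_mono (show k + 5 ≤ k + 5 + m by omega) G
        have h2 := SN_nonneg (k + 5) G
        have h3 := SN_nonneg (k + 5 + m) G
        rw [← hC0]
        gcongr
        · linarith
        · omega
      | succ i =>
        rw [← norm_iteratedFDeriv_fderiv, hf]
        refine ((ha G).2 i (by omega) x).trans ?_
        have h1 := SN_mono (show m ≤ k + 5 + m by omega) G
        have h2 := SN_nonneg (m) G
        have h3 := SN_nonneg (k + 5 + m) G
        gcongr
        · linarith
        · omega

def hG (G : SchwartzMap PP ℂ) (x : E4) : ℂ := ∫ p, G p * Ker p x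

theorem hG_bound (n : ℕ) : ∃ (C : ℝ) (k m : ℕ), 0 ≤ C ∧ ∀ G : SchwartzMap PP ℂ,
      ∀ i ≤ n, ∀ x, ‖iteratedFDeriv ℝ i (hG G) x‖ ≤ C * SN m G * (1 + ‖x‖) ^ k := by
  obtain ⟨C, k, m, hC, h⟩ := BK_TG (ContinuousLinearMap.mul ℝ ℂ) (Ker_TG n)
  exact ⟨C, k, m, hC, fun G => (h G).2⟩

theorem hG_contDiff (n : ℕ) (G : SchwartzMap PP ℂ) : ContDiff ℝ n (hG G) := by
  obtain ⟨C, k, m, hC, h⟩ := BK_TG (ContinuousLinearMap.mul ℝ ℂ) (Ker_TG n)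
  exact (h G).1

end Trsec

set_option linter.unusedSectionVars false
set_option linter.unusedSimpArgs false
set_option linter.unusedVariables false
section Popsec
open Topology LineDeriv

def PG (F : PP → ℝ) : Prop := Continuous F ∧ ∃ (C : ℝ) (k : ℕ), 0 ≤ C ∧ ∀ p, |F p| ≤ C * (1 + ‖p‖) ^ k

theorem PG.mul {F H : PP → ℝ} (hF : PG F) (hH : PG H) : PG fun p => F p * H p := by
  obtain ⟨c1, C, k, hC, h1⟩ := hF
  obtain ⟨c2, D, m, hD, h2⟩ := hH
  refine ⟨c1.mul c2, C * D, k + m, by positivity, fun p => ?_⟩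
  rw [abs_mul, pow_add]
  calc _ ≤ (C * (1 + ‖p‖) ^ k) * (D * (1 + ‖p‖) ^ m) := mul_le_mul (h1 p) (h2 p) (abs_nonneg _) (by positivity)
    _ = _ := by ring

theorem PG.add {F H : PP → ℝ} (hF : PG F) (hH : PG H) : PG fun p => F p + H p := by
  obtain ⟨c1, C, k, hC, h1⟩ := hF
  obtain ⟨c2, D, m, hD, h2⟩ := hH
  refine ⟨c1.add c2, C + D, k + m, by positivity, fun p => ?_⟩
  have hp : 1 ≤ 1 + ‖p‖ := by linarith [norm_nonneg p]
  have a1 : (1 + ‖p‖) ^ k ≤ (1 + ‖p‖) ^ (k+m) := pow_le_pow_right₀ hp (by omega)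
  have a2 : (1 + ‖p‖) ^ m ≤ (1 + ‖p‖) ^ (k+m) := pow_le_pow_right₀ hp (by omega)
  calc _ ≤ |F p| + |H p| := abs_add_le _ _
    _ ≤ C * (1 + ‖p‖) ^ k + D * (1 + ‖p‖) ^ m := add_le_add (h1 p) (h2 p)
    _ ≤ C * (1 + ‖p‖) ^ (k+m) + D * (1 + ‖p‖) ^ (k+m) := by gcongr
    _ = _ := by ring

theorem PG.bdd {F : PP → ℝ} (c : Continuous F) (C : ℝ) (h : ∀ p, |F p| ≤ C) : PG F :=
  ⟨c, C, 0, (abs_nonneg _).trans (h 0), fun p => by simpa using h p⟩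

theorem PG.const (c : ℝ) : PG fun _ => c := PG.bdd continuous_const |c| fun _ => le_rfl

theorem PG.coord (i : Fin 3) : PG fun p => p.1 i := by
  refine ⟨by fun_prop, 1, 1, zero_le_one, fun p => ?_⟩
  have h1 : |p.1 i| ≤ ‖p.1‖ := norm_le_pi_norm p.1 i
  have h2 := norm_fst_le p
  simp; linarith

theorem PG.rho : PG rho := by
  have := ((PG.coord 0).mul (PG.coord 0)).add ((PG.coord 1).mul (PG.coord 1))
  refine cast (congrArg PG ?_) this
  ext p; simp [_root_.rho]; ring

theorem PG.cos (lam r : ℝ) : PG fun p => Real.cos (lam * p.2 + r * p.1 2) :=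
  PG.bdd (by fun_prop) 1 fun p => Real.abs_cos_le_one _

theorem PG.sin (lam r : ℝ) : PG fun p => Real.sin (lam * p.2 + r * p.1 2) :=
  PG.bdd (by fun_prop) 1 fun p => Real.abs_sin_le_one _

theorem LD_cont (n l : ℕ) : Continuous (LD n l) :=
  continuous_iff_continuousAt.2 fun x => (LD_hasDeriv n l x).continuousAt

theorem PG.LD (n l : ℕ) {lam : ℝ} (hl : 0 < lam) : PG fun p => _root_.LD n l (lam / 2 * _root_.rho p) := by
  refine PG.bdd ((LD_cont n l).comp (by unfold _root_.rho; fun_prop)) ((l+1)^n) fun p => LD_bound n l _ ?_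
  unfold _root_.rho; positivity

theorem PG.int {F : PP → ℝ} (h : PG F) (G : SchwartzMap PP ℂ) : Integrable fun p => G p * (F p : ℂ) := by
  obtain ⟨c, C, k, hC, hb⟩ := h
  refine (jap_int.const_mul (C * (2 ^ (k+5) * SN (k+5) G))).mono' ?_ (Filter.Eventually.of_forall fun p => ?_)
  · have := G.continuous
    exact (by fun_prop : Continuous _).aestronglyMeasurable
  · rw [norm_mul, Complex.norm_real, Real.norm_eq_abs]
    calc _ ≤ ‖G p‖ * (C * (1 + ‖p‖) ^ k) := by gcongr; exact hb p
      _ = C * (‖G p‖ * (1 + ‖p‖) ^ k) := by ring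
      _ ≤ C * (2 ^ (k+5) * SN (k+5) G * (1 + ‖p‖) ^ (-(5:ℝ))) := mul_le_mul_of_nonneg_left (G_decay k G p) hC
      _ = _ := by ring

theorem ibp1 {F F' : PP → ℝ} (hF : PG F) (hF' : PG F') (v : PP)
    (hd : ∀ p, HasDerivAt (fun s : ℝ => F (p + s • v)) (F' p) 0) (G : SchwartzMap PP ℂ) :
    ∫ p, (∂_{v} G) p * (F p : ℂ) = - ∫ p, G p * (F' p : ℂ) := by
  have h := integral_bilinear_hasLineDerivAt_right_eq_neg_left_of_integrable (μ := (volume : Measure PP))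
    (f := G) (f' := (∂_{v} G : SchwartzMap PP ℂ)) (g := fun p => (F p : ℂ)) (g' := fun p => (F' p : ℂ)) (v := v)
    (B := ContinuousLinearMap.mul ℝ ℂ) (hF.int _) (hF'.int _) (hF.int _)
    (fun x _ => by
      rw [SchwartzMap.lineDerivOp_apply_eq_fderiv]
      exact (G.differentiableAt.hasFDerivAt).hasLineDerivAt v)
    (fun x _ => (hd x).ofReal_comp)
  simp only [ContinuousLinearMap.mul_apply'] at h
  rw [h, neg_neg]

theorem ibp2 {F F' F'' : PP → ℝ} (hF : PG F) (hF' : PG F') (hF'' : PG F'') (v : PP)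
    (hd : ∀ p, HasDerivAt (fun s : ℝ => F (p + s • v)) (F' p) 0)
    (hd' : ∀ p, HasDerivAt (fun s : ℝ => F' (p + s • v)) (F'' p) 0) (G : SchwartzMap PP ℂ) :
    ∫ p, (∂_{v} (∂_{v} G : SchwartzMap PP ℂ) : SchwartzMap PP ℂ) p * (F p : ℂ) = ∫ p, G p * (F'' p : ℂ) := by
  rw [ibp1 hF hF' v hd, ibp1 hF' hF'' v hd', neg_neg]

theorem LD_ode (l : ℕ) (y : ℝ) : LD 1 l y + y * LD 2 l y = (-1/2 - l + y/4) * lag l y := by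
  have h1 := lagS_ode l y
  have h2 : HasDerivAt (lagS l) (∑ i ∈ Finset.range l, LD 1 i y) y := by
    have : lagS l = fun x => ∑ i ∈ Finset.range l, LD 0 i x := by ext x; simp [lagS, LD]
    rw [this]; exact HasDerivAt.fun_sum fun i _ => LD_hasDeriv 0 i y
  have h3 := h1.unique ((hasDerivAt_id y).mul h2)
  have e1 : LD 1 l y = -(1/2) * lag l y - lagS l y := by simp [LD, lagS]
  have e2 : LD 2 l y = -(1/2) * LD 1 l y - ∑ i ∈ Finset.range l, LD 1 i y := by rw [LD]
  simp only [id] at h3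
  rw [e2, mul_sub]
  rw [e1]; linear_combination h3

def ev (i : Fin 3) : PP := (Pi.single i 1, 0)
def et : PP := (0, 1)

def Pop : SchwartzMap PP ℂ →L[ℝ] SchwartzMap PP ℂ :=
  (2:ℝ) • ContinuousLinearMap.id ℝ _
   - lineDerivOpCLM ℝ (SchwartzMap PP ℂ) (ev 0) ∘L lineDerivOpCLM ℝ (SchwartzMap PP ℂ) (ev 0)
   - lineDerivOpCLM ℝ (SchwartzMap PP ℂ) (ev 1) ∘L lineDerivOpCLM ℝ (SchwartzMap PP ℂ) (ev 1)
   - lineDerivOpCLM ℝ (SchwartzMap PP ℂ) (ev 2) ∘L lineDerivOpCLM ℝ (SchwartzMap PP ℂ) (ev 2)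
   - SchwartzMap.smulLeftCLM ℂ (fun p : PP => rho p / 4) ∘L
     (lineDerivOpCLM ℝ (SchwartzMap PP ℂ) et ∘L lineDerivOpCLM ℝ (SchwartzMap PP ℂ) et)

theorem rho_temp : (fun p : PP => rho p / 4).HasTemperateGrowth := by
  have h : ∀ i, (fun p : PP => p.1 i).HasTemperateGrowth := fun i =>
    ((ContinuousLinearMap.proj (R := ℝ) (φ := fun _ : Fin 3 => ℝ) i) ∘L ContinuousLinearMap.fst ℝ (Fin 3 → ℝ) ℝ).hasTemperateGrowth
  have : (fun p : PP => rho p / 4) = fun p => (p.1 0 * p.1 0 + p.1 1 * p.1 1) * (1/4) := by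
    ext p; simp [rho]; ring
  rw [this]
  have h0 := h 0
  have h1 := h 1
  fun_prop

theorem Pop_apply (G : SchwartzMap PP ℂ) (p : PP) : Pop G p = 2 * G p
   - (∂_{ev 0} (∂_{ev 0} G : SchwartzMap PP ℂ) : SchwartzMap PP ℂ) p
   - (∂_{ev 1} (∂_{ev 1} G : SchwartzMap PP ℂ) : SchwartzMap PP ℂ) p
   - (∂_{ev 2} (∂_{ev 2} G : SchwartzMap PP ℂ) : SchwartzMap PP ℂ) p
   - ((rho p / 4 : ℝ) : ℂ) * (∂_{et} (∂_{et} G : SchwartzMap PP ℂ) : SchwartzMap PP ℂ) p := by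
  simp [Pop, SchwartzMap.smulLeftCLM_apply_apply rho_temp]

theorem d_cos2 (lam r c : ℝ) (l n : ℕ) (p : PP) : HasDerivAt (fun s : ℝ => Real.cos (lam * (p + s • ev 2).2 + r * (p + s • ev 2).1 2) * (c * LD n l (lam/2 * rho (p + s • ev 2))))
   (-r * Real.sin (lam * p.2 + r * p.1 2) * (c * LD n l (lam/2 * rho p))) 0 := by
  simp [rho, ev]
  have : HasDerivAt (fun s : ℝ => lam * p.2 + r * (p.1 2 + s)) r 0 := by
    simpa using (((hasDerivAt_id (0:ℝ)).const_add (p.1 2)).const_mul r).const_add (lam * p.2)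
  have h := (this.cos).mul_const (c * LD n l (lam / 2 * (p.1 0 ^ 2 + p.1 1 ^ 2)))
  simp only [neg_mul, add_zero] at h ⊢
  refine h.congr_deriv ?_
  ring

theorem d_sin2 (lam r c : ℝ) (l n : ℕ) (p : PP) : HasDerivAt (fun s : ℝ => -r * Real.sin (lam * (p + s • ev 2).2 + r * (p + s • ev 2).1 2) * (c * LD n l (lam/2 * rho (p + s • ev 2))))
   (-r^2 * (Real.cos (lam * p.2 + r * p.1 2) * (c * LD n l (lam/2 * rho p)))) 0 := by
  simp [rho, ev]
  have : HasDerivAt (fun s : ℝ => lam * p.2 + r * (p.1 2 + s)) r 0 := by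
    simpa using (((hasDerivAt_id (0:ℝ)).const_add (p.1 2)).const_mul r).const_add (lam * p.2)
  have h := ((this.sin).const_mul (-r)).mul_const (c * LD n l (lam / 2 * (p.1 0 ^ 2 + p.1 1 ^ 2)))
  simp only [neg_mul, add_zero] at h ⊢
  refine h.congr_deriv ?_
  ring

theorem d_cost (lam r : ℝ) (l : ℕ) (p : PP) : HasDerivAt (fun s : ℝ => (rho (p + s • et) / 4) * (Real.cos (lam * (p + s • et).2 + r * (p + s • et).1 2) * (LD 0 l (lam/2 * rho (p + s • et)))))
   ((rho p / 4) * (-lam * Real.sin (lam * p.2 + r * p.1 2) * (LD 0 l (lam/2 * rho p)))) 0 := by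
  simp [rho, et]
  have : HasDerivAt (fun s : ℝ => lam * (p.2 + s) + r * p.1 2) lam 0 := by
    simpa using (((hasDerivAt_id (0:ℝ)).const_add (p.2)).const_mul lam).add_const (r * p.1 2)
  have h := ((this.cos).mul_const (LD 0 l (lam / 2 * (p.1 0 ^ 2 + p.1 1 ^ 2)))).const_mul ((p.1 0 ^ 2 + p.1 1 ^ 2) / 4)
  simp only [neg_mul, add_zero] at h ⊢
  refine h.congr_deriv ?_
  ring

theorem d_sint (lam r : ℝ) (l : ℕ) (p : PP) : HasDerivAt (fun s : ℝ => (rho (p + s • et) / 4) * (-lam * Real.sin (lam * (p + s • et).2 + r * (p + s • et).1 2) * (LD 0 l (lam/2 * rho (p + s • et)))))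
   ((rho p / 4) * (-lam^2 * (Real.cos (lam * p.2 + r * p.1 2) * (LD 0 l (lam/2 * rho p))))) 0 := by
  simp [rho, et]
  have : HasDerivAt (fun s : ℝ => lam * (p.2 + s) + r * p.1 2) lam 0 := by
    simpa using (((hasDerivAt_id (0:ℝ)).const_add (p.2)).const_mul lam).add_const (r * p.1 2)
  have h := (((this.sin).const_mul (-lam)).mul_const (LD 0 l (lam / 2 * (p.1 0 ^ 2 + p.1 1 ^ 2)))).const_mul ((p.1 0 ^ 2 + p.1 1 ^ 2) / 4)
  simp only [neg_mul, mul_neg, add_zero] at h ⊢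
  refine h.congr_deriv ?_
  ring

theorem d_rho (i : Fin 3) (hi : i = 0 ∨ i = 1) (p : PP) : HasDerivAt (fun s : ℝ => rho (p + s • ev i)) (2 * p.1 i) 0 := by
  rcases hi with rfl | rfl
  · simp [rho, ev]
    simpa using (((hasDerivAt_id (0:ℝ)).const_add (p.1 0)).pow 2).add_const (p.1 1 ^ 2)
  · simp [rho, ev]
    simpa using (((hasDerivAt_id (0:ℝ)).const_add (p.1 1)).pow 2).const_add (p.1 0 ^ 2)

theorem d_LD (lam : ℝ) (l n : ℕ) (i : Fin 3) (hi : i = 0 ∨ i = 1) (p : PP) :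
    HasDerivAt (fun s : ℝ => LD n l (lam/2 * rho (p + s • ev i))) (lam * p.1 i * LD (n+1) l (lam/2 * rho p)) 0 := by
  have h1 := (d_rho i hi p).const_mul (lam/2)
  have h2 := LD_hasDeriv n l (lam/2 * rho (p + (0:ℝ) • ev i))
  have h := h2.comp (0:ℝ) h1
  refine h.congr_deriv ?_
  simp; ring

theorem d_x1 (lam r : ℝ) (l : ℕ) (i : Fin 3) (hi : i = 0 ∨ i = 1) (p : PP) : HasDerivAt (fun s : ℝ => Real.cos (lam * (p + s • ev i).2 + r * (p + s • ev i).1 2) * LD 0 l (lam/2 * rho (p + s • ev i)))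
   (Real.cos (lam * p.2 + r * p.1 2) * (lam * p.1 i * LD 1 l (lam/2 * rho p))) 0 := by
  have h := (d_LD lam l 0 i hi p).const_mul (Real.cos (lam * p.2 + r * p.1 2))
  rcases hi with rfl | rfl <;> simpa [ev] using h

theorem d_x2 (lam r : ℝ) (l : ℕ) (i : Fin 3) (hi : i = 0 ∨ i = 1) (p : PP) : HasDerivAt (fun s : ℝ => Real.cos (lam * (p + s • ev i).2 + r * (p + s • ev i).1 2) * (lam * (p + s • ev i).1 i * LD 1 l (lam/2 * rho (p + s • ev i))))
   (Real.cos (lam * p.2 + r * p.1 2) * (lam * LD 1 l (lam/2 * rho p) + lam * p.1 i * (lam * p.1 i * LD 2 l (lam/2 * rho p)))) 0 := by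
  have h0 : HasDerivAt (fun s : ℝ => lam * (p.1 i + s)) lam 0 := by
    simpa using ((hasDerivAt_id (0:ℝ)).const_add (p.1 i)).const_mul lam
  have h := (h0.mul (d_LD lam l 1 i hi p)).const_mul (Real.cos (lam * p.2 + r * p.1 2))
  rcases hi with rfl | rfl <;> simpa [ev] using h

theorem sph_eq (lam r : ℝ) (l : ℕ) (p : PP) : sph' lam l r p = Real.cos (lam * p.2 + r * p.1 2) * LD 0 l (lam/2 * rho p) := by
  simp [sph', LD, rho]

theorem int_sub5 {a b c d e : PP → ℂ} (ha : Integrable a) (hb : Integrable b) (hc : Integrable c) (hd : Integrable d) (he : Integrable e) :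
    ∫ p, (a p - b p - c p - d p - e p) = (∫ p, a p) - (∫ p, b p) - (∫ p, c p) - (∫ p, d p) - (∫ p, e p) := by
  have h1 := integral_sub ha hb
  have h2 := integral_sub (ha.sub hb) hc
  have h3 := integral_sub ((ha.sub hb).sub hc) hd
  have h4 := integral_sub (((ha.sub hb).sub hc).sub hd) he
  simp only [Pi.sub_apply] at h1 h2 h3 h4
  rw [h4, h3, h2, h1]

theorem Pop_int {lam : ℝ} (hl : 0 < lam) (r : ℝ) (l : ℕ) (G : SchwartzMap PP ℂ) :
    ∫ p, Pop G p * (sph' lam l r p : ℂ) = ((2 + (lam * (2*l+1) + r^2) : ℝ) : ℂ) * ∫ p, G p * (sph' lam l r p : ℂ) := by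
  have C := PG.cos lam r
  have S := PG.sin lam r
  have L0 := PG.LD 0 l hl
  have L1 := PG.LD 1 l hl
  have L2 := PG.LD 2 l hl
  have X := PG.coord
  have R : PG fun p => rho p / 4 := by
    have := PG.rho.mul (PG.const (1/4)); simpa [div_eq_mul_inv] using this
  have P0 := C.mul L0
  have Px : ∀ i, PG _ := fun i => C.mul (((PG.const lam).mul (X i)).mul L1)
  have Pxx : ∀ i, PG _ := fun i => C.mul (((PG.const lam).mul L1).add (((PG.const lam).mul (X i)).mul (((PG.const lam).mul (X i)).mul L2)))
  have P3 := ((PG.const (-r)).mul S).mul ((PG.const 1).mul L0)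
  have P33 := (PG.const (-r^2)).mul (C.mul ((PG.const 1).mul L0))
  have Pt := R.mul (((PG.const (-lam)).mul S).mul L0)
  have Ptt := R.mul ((PG.const (-lam^2)).mul (C.mul L0))
  have i0 := ibp2 P0 (Px 0) (Pxx 0) (ev 0) (d_x1 lam r l 0 (Or.inl rfl)) (d_x2 lam r l 0 (Or.inl rfl)) G
  have i1 := ibp2 P0 (Px 1) (Pxx 1) (ev 1) (d_x1 lam r l 1 (Or.inr rfl)) (d_x2 lam r l 1 (Or.inr rfl)) G
  have i3 := ibp2 (C.mul ((PG.const 1).mul L0)) P3 P33 (ev 2) (d_cos2 lam r 1 l 0) (d_sin2 lam r 1 l 0) G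
  have it := ibp2 (R.mul P0) Pt Ptt et (d_cost lam r l) (d_sint lam r l) G
  simp only [one_mul] at i3
  have I0 := P0.int G
  have hs : ∀ p, sph' lam l r p = Real.cos (lam * p.2 + r * p.1 2) * LD 0 l (lam/2 * rho p) := sph_eq lam r l
  have J0 := P0.int (∂_{ev 0} (∂_{ev 0} G : SchwartzMap PP ℂ) : SchwartzMap PP ℂ)
  have J1 := P0.int (∂_{ev 1} (∂_{ev 1} G : SchwartzMap PP ℂ) : SchwartzMap PP ℂ)
  have J2 := P0.int (∂_{ev 2} (∂_{ev 2} G : SchwartzMap PP ℂ) : SchwartzMap PP ℂ)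
  have J3 := (R.mul P0).int (∂_{et} (∂_{et} G : SchwartzMap PP ℂ) : SchwartzMap PP ℂ)
  have e : ∀ p, Pop G p * (sph' lam l r p : ℂ) = 
     (((2 * (G p * ((Real.cos (lam * p.2 + r * p.1 2) * LD 0 l (lam/2 * rho p) : ℝ) : ℂ))
     - (∂_{ev 0} (∂_{ev 0} G : SchwartzMap PP ℂ) : SchwartzMap PP ℂ) p * ((Real.cos (lam * p.2 + r * p.1 2) * LD 0 l (lam/2 * rho p) : ℝ) : ℂ))
     - (∂_{ev 1} (∂_{ev 1} G : SchwartzMap PP ℂ) : SchwartzMap PP ℂ) p * ((Real.cos (lam * p.2 + r * p.1 2) * LD 0 l (lam/2 * rho p) : ℝ) : ℂ))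
     - (∂_{ev 2} (∂_{ev 2} G : SchwartzMap PP ℂ) : SchwartzMap PP ℂ) p * ((Real.cos (lam * p.2 + r * p.1 2) * LD 0 l (lam/2 * rho p) : ℝ) : ℂ))
     - (∂_{et} (∂_{et} G : SchwartzMap PP ℂ) : SchwartzMap PP ℂ) p * ((rho p / 4 * (Real.cos (lam * p.2 + r * p.1 2) * LD 0 l (lam/2 * rho p)) : ℝ) : ℂ) := by
    intro p; rw [Pop_apply, hs]; push_cast; ring
  simp only [e]
  rw [int_sub5 (I0.const_mul 2) J0 J1 J2 J3, i0, i1, i3, it,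
    ← int_sub5 (I0.const_mul 2) ((Pxx 0).int G) ((Pxx 1).int G) (((PG.const (-r^2)).mul (C.mul L0)).int G) (Ptt.int G), ← integral_const_mul]
  congr 1; ext p
  rw [hs]
  have h := LD_ode l (lam/2 * rho p)
  have h0 : LD 0 l = lag l := by ext; simp [LD]
  have hr : rho p = p.1 0 ^ 2 + p.1 1 ^ 2 := rfl
  rw [← h0] at h
  have key : 2 * (Real.cos (lam * p.2 + r * p.1 2) * LD 0 l (lam/2 * rho p))
    - (Real.cos (lam * p.2 + r * p.1 2) * (lam * LD 1 l (lam/2 * rho p) + lam * p.1 0 * (lam * p.1 0 * LD 2 l (lam/2 * rho p))))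
    - (Real.cos (lam * p.2 + r * p.1 2) * (lam * LD 1 l (lam/2 * rho p) + lam * p.1 1 * (lam * p.1 1 * LD 2 l (lam/2 * rho p))))
    - (-r^2 * (Real.cos (lam * p.2 + r * p.1 2) * LD 0 l (lam/2 * rho p)))
    - (rho p / 4 * (-lam^2 * (Real.cos (lam * p.2 + r * p.1 2) * LD 0 l (lam/2 * rho p))))
    = (2 + (lam * (2*l+1) + r^2)) * (Real.cos (lam * p.2 + r * p.1 2) * LD 0 l (lam/2 * rho p)) := by
    have h5 : LD 2 l (lam/2 * rho p) * (lam^2 * p.1 0^2 + lam^2 * p.1 1^2) = lam^2 * rho p * LD 2 l (lam/2 * rho p) := by rw [hr]; ring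
    linear_combination (-2 * lam * Real.cos (lam * p.2 + r * p.1 2)) * h - Real.cos (lam * p.2 + r * p.1 2) * h5
  calc _ = G p * ((2 * (Real.cos (lam * p.2 + r * p.1 2) * LD 0 l (lam/2 * rho p))
    - (Real.cos (lam * p.2 + r * p.1 2) * (lam * LD 1 l (lam/2 * rho p) + lam * p.1 0 * (lam * p.1 0 * LD 2 l (lam/2 * rho p))))
    - (Real.cos (lam * p.2 + r * p.1 2) * (lam * LD 1 l (lam/2 * rho p) + lam * p.1 1 * (lam * p.1 1 * LD 2 l (lam/2 * rho p))))
    - (-r^2 * (Real.cos (lam * p.2 + r * p.1 2) * LD 0 l (lam/2 * rho p)))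
    - (rho p / 4 * (-lam^2 * (Real.cos (lam * p.2 + r * p.1 2) * LD 0 l (lam/2 * rho p)))) : ℝ) : ℂ) := by push_cast; ring
    _ = _ := by rw [key]; push_cast; ring

end Popsec

set_option linter.unusedSectionVars false
set_option linter.unusedSimpArgs false
set_option linter.unusedVariables false
section Pksec
open Topology

def SpecR : Set E4 := {x | ∃ lam > (0:ℝ), ∃ (l : ℕ) (r : ℝ), x = (lam * (2 * l + 1) + r ^ 2, lam ^ 2, lam * r, r ^ 2)}
def SpecS : Set E4 := {x | ∃ (zeta r : ℝ), x = (zeta ^ 2 + r ^ 2, 0, 0, r ^ 2)}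

theorem hG_reg (G : SchwartzMap PP ℂ) {lam : ℝ} (hl : 0 < lam) (l : ℕ) (r : ℝ) :
    hG G (lam * (2 * l + 1) + r ^ 2, lam ^ 2, lam * r, r ^ 2) = ∫ p, G p * (sph' lam l r p : ℂ) := by
  unfold hG; congr 1; ext p; rw [Ker_regular hl]

theorem hG_sing (G : SchwartzMap PP ℂ) (zeta r : ℝ) :
    hG G (zeta ^ 2 + r ^ 2, 0, 0, r ^ 2) = ∫ p, G p * (sphSing' zeta r p : ℂ) := by
  unfold hG; congr 1; ext p; rw [Ker_sing]

theorem hG_pop_reg (G : SchwartzMap PP ℂ) {x : E4} (hx : x ∈ SpecR) : hG (Pop G) x = ((2 + x.1 : ℝ) : ℂ) * hG G x := by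
  obtain ⟨lam, hl, l, r, rfl⟩ := hx
  rw [hG_reg _ hl, hG_reg _ hl, Pop_int hl]

theorem SpecS_sub : SpecS ⊆ closure SpecR := by
  rintro _ ⟨z, r, rfl⟩
  have t0 : Filter.Tendsto (fun l : ℕ => (2 * (l:ℝ) + 1)⁻¹) Filter.atTop (𝓝 0) := by
    apply Filter.Tendsto.inv_tendsto_atTop
    exact Filter.tendsto_atTop_add_const_right _ _ (tendsto_natCast_atTop_atTop.const_mul_atTop two_pos)
  have t1 : Filter.Tendsto (fun l : ℕ => z^2 * (2 * (l:ℝ) + 1)⁻¹ + ((2 * (l:ℝ) + 1)⁻¹)^2) Filter.atTop (𝓝 0) := by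
    simpa using (t0.const_mul (z^2)).add (t0.pow 2)
  refine mem_closure_of_tendsto (b := Filter.atTop) (f := fun l : ℕ => 
    ((z^2 * (2 * (l:ℝ) + 1)⁻¹ + ((2 * (l:ℝ) + 1)⁻¹)^2) * (2 * l + 1) + r ^ 2, (z^2 * (2 * (l:ℝ) + 1)⁻¹ + ((2 * (l:ℝ) + 1)⁻¹)^2)^2,
      (z^2 * (2 * (l:ℝ) + 1)⁻¹ + ((2 * (l:ℝ) + 1)⁻¹)^2) * r, r^2)) ?_ (Filter.Eventually.of_forall fun l => ⟨_, by positivity, l, r, rfl⟩)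
  refine Filter.Tendsto.prodMk_nhds ?_ (Filter.Tendsto.prodMk_nhds (by simpa using t1.pow 2) (Filter.Tendsto.prodMk_nhds (by simpa using t1.mul_const r) tendsto_const_nhds))
  have : Filter.Tendsto (fun l : ℕ => z^2 + (2 * (l:ℝ) + 1)⁻¹ + r^2) Filter.atTop (𝓝 (z^2 + r^2)) := by
    simpa using (t0.const_add (z^2)).add_const (r^2)
  refine this.congr fun l => ?_
  have : (2 * (l:ℝ) + 1) ≠ 0 := by positivity
  field_simp

theorem hG_cont (G : SchwartzMap PP ℂ) : Continuous (hG G) := (hG_contDiff 0 G).continuous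

theorem hG_pop (G : SchwartzMap PP ℂ) {x : E4} (hx : x ∈ SpecR ∪ SpecS) : hG (Pop G) x = ((2 + x.1 : ℝ) : ℂ) * hG G x := by
  have hc : IsClosed {x : E4 | hG (Pop G) x = ((2 + x.1 : ℝ) : ℂ) * hG G x} := by
    have h1 := hG_cont G
    have h2 := hG_cont (Pop G)
    exact isClosed_eq h2 (by fun_prop)
  have : closure SpecR ⊆ {x : E4 | hG (Pop G) x = ((2 + x.1 : ℝ) : ℂ) * hG G x} :=
    closure_minimal (fun x hx => hG_pop_reg G hx) hc
  rcases hx with hx | hx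
  · exact this (subset_closure hx)
  · exact this (SpecS_sub hx)

theorem hG_popk (k : ℕ) (G : SchwartzMap PP ℂ) {x : E4} (hx : x ∈ SpecR ∪ SpecS) :
    hG (Pop^[k] G) x = ((2 + x.1 : ℝ) : ℂ) ^ k * hG G x := by
  induction k generalizing G with
  | zero => simp
  | succ k ih => rw [Function.iterate_succ_apply, ih, hG_pop G hx]; ring

theorem SN_pop1 (m : ℕ) : ∃ (C : ℝ) (m' : ℕ), 0 ≤ C ∧ ∀ G : SchwartzMap PP ℂ, SN m (Pop G) ≤ C * SN m' G := by
  set q : Seminorm ℝ (SchwartzMap PP ℂ) := ((Finset.Iic (m,m)).sup (schwartzSeminormFamily ℝ PP ℂ)).comp Pop.toLinearMap with hq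
  have hw := schwartz_withSeminorms ℝ PP ℂ
  have hc : Continuous q := by
    have h1 : Continuous ⇑((Finset.Iic (m,m)).sup (schwartzSeminormFamily ℝ PP ℂ) : Seminorm ℝ (SchwartzMap PP ℂ)) := by
      refine Finset.sup_induction (p := fun s : Seminorm ℝ (SchwartzMap PP ℂ) => Continuous ⇑s) ?_ ?_ fun i _ => hw.continuous_seminorm i
      · exact continuous_const
      · intro a ha b hb; exact ha.sup hb
    exact h1.comp Pop.continuous
  obtain ⟨s, C, hC, h⟩ := Seminorm.bound_of_continuous hw q hc
  set a := s.sup (fun i => max i.1 i.2)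
  have hs : s ⊆ Finset.Iic (a, a) := fun i hi => by
    have : max i.1 i.2 ≤ a := Finset.le_sup (f := fun i : ℕ × ℕ => max i.1 i.2) hi
    exact Finset.mem_Iic.2 ⟨(le_max_left _ _).trans this, (le_max_right _ _).trans this⟩
  refine ⟨C, a, C.2, fun G => ?_⟩
  have h1 := h G
  have h2 : s.sup (schwartzSeminormFamily ℝ PP ℂ) G ≤ SN a G := (Finset.sup_mono hs : s.sup (schwartzSeminormFamily ℝ PP ℂ) ≤ _) G
  exact h1.trans (mul_le_mul_of_nonneg_left h2 C.2)

theorem SN_popk (k m : ℕ) : ∃ (C : ℝ) (m' : ℕ), 0 ≤ C ∧ ∀ G : SchwartzMap PP ℂ, SN m (Pop^[k] G) ≤ C * SN m' G := by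
  induction k with
  | zero => exact ⟨1, m, zero_le_one, fun G => by simp⟩
  | succ k ih =>
    obtain ⟨C, m1, hC, h⟩ := ih
    obtain ⟨D, m2, hD, h'⟩ := SN_pop1 m1
    refine ⟨C * D, m2, by positivity, fun G => ?_⟩
    rw [Function.iterate_succ_apply]
    calc _ ≤ C * SN m1 (Pop G) := h _
      _ ≤ C * (D * SN m2 G) := by gcongr; exact h' G
      _ = _ := by ring

end Pksec

set_option linter.unusedSectionVars false
set_option linter.unusedSimpArgs false
set_option linter.unusedVariables false
section Cutsec
open Topology

def WU : ℕ → E4 → ℝ := fun _ _ => 1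
theorem hWU : ∀ p x, 1 ≤ WU p x := fun _ _ => le_rfl

theorem TG.aff {g : ℝ → ℝ} (hg : ∀ j, Differentiable ℝ (deriv^[j] g)) (hb : ∀ j, ∃ C, ∀ y, |deriv^[j] g y| ≤ C)
    (L : E4 →L[ℝ] ℝ) (s c : ℕ → ℝ) (hs : ∀ p, |s p| ≤ 1) (n : ℕ) : ∀ j, TG WU n (fun p x => deriv^[j] g (s p * L x + c p)) := by
  have hpb : ∀ j, PB WU (fun p x => deriv^[j] g (s p * L x + c p)) := fun j => by
    constructor
    · have h1 : Continuous s := continuous_of_discreteTopology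
      have h2 : Continuous c := continuous_of_discreteTopology
      have h3 := (hg j).continuous
      fun_prop
    · obtain ⟨C, hC⟩ := hb j
      exact ⟨C, 0, fun p x => by simpa using hC _⟩
  induction n with
  | zero => exact hpb
  | succ n ih =>
    intro j
    refine ⟨hpb j, fun p x => s p • (deriv^[j+1] g (s p * L x + c p) • L), fun p x => ?_, ?_⟩
    · have h1 : HasFDerivAt (fun x => s p * L x + c p) (s p • L) x := (L.hasFDerivAt.const_mul (s p)).add_const _
      have h2 := ((hg j) (s p * L x + c p)).hasDerivAt
      have := h2.comp_hasFDerivAt x h1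
      rw [Function.iterate_succ_apply']
      beta_reduce
      rw [smul_comm]
      exact this
    · refine TG.smul hWU (TG.const_x continuous_of_discreteTopology ⟨1, 0, fun p x => by simpa using hs p⟩) ?_
      exact TG.smul hWU (ih (j+1)) (TG.const L)

theorem TG.sTaff (L : E4 →L[ℝ] ℝ) (s c : ℕ → ℝ) (hs : ∀ p, |s p| ≤ 1) (n : ℕ) :
    TG WU n (fun p x => Real.smoothTransition (s p * L x + c p)) :=
  TG.aff (g := Real.smoothTransition) (fun j => (sT_iter_contDiff j).differentiable (by simp)) sT_iter_bound L s c hs n 0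

def tau3 (y : ℝ) : ℝ := y * (Real.smoothTransition (3 - 2 * y) * Real.smoothTransition (3 + 2 * y))

theorem tau3_zero {y : ℝ} (hy : 3/2 ≤ |y|) : tau3 y = 0 := by
  rcases le_abs.1 hy with h | h
  · simp [tau3, Real.smoothTransition.zero_of_nonpos (show 3 - 2*y ≤ 0 by linarith)]
  · simp [tau3, Real.smoothTransition.zero_of_nonpos (show 3 + 2*y ≤ 0 by linarith)]

theorem tau3_one {y : ℝ} (hy : |y| ≤ 1) : tau3 y = y := by
  have := abs_le.1 hy
  simp [tau3, Real.smoothTransition.one_of_one_le (show 1 ≤ 3 - 2*y by linarith), Real.smoothTransition.one_of_one_le (show 1 ≤ 3 + 2*y by linarith)]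

theorem tau3_abs (y : ℝ) : |tau3 y| ≤ 3/2 := by
  by_cases hy : 3/2 ≤ |y|
  · rw [tau3_zero hy]; norm_num
  · push Not at hy
    rw [tau3, abs_mul]
    have h : |Real.smoothTransition (3 - 2 * y) * Real.smoothTransition (3 + 2 * y)| ≤ 1 := by
      rw [abs_of_nonneg (mul_nonneg (Real.smoothTransition.nonneg _) (Real.smoothTransition.nonneg _))]
      exact mul_le_one₀ (Real.smoothTransition.le_one _) (Real.smoothTransition.nonneg _) (Real.smoothTransition.le_one _)
    calc _ ≤ |y| * 1 := by gcongr
      _ ≤ _ := by linarith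

theorem tau3_contDiff : ContDiff ℝ (⊤:ℕ∞) tau3 := by
  unfold tau3
  have h : ContDiff ℝ (⊤:ℕ∞) Real.smoothTransition := Real.smoothTransition.contDiff
  exact contDiff_id.mul ((h.comp (by fun_prop)).mul (h.comp (by fun_prop)))

theorem tau3_iter (j : ℕ) : ContDiff ℝ (⊤:ℕ∞) (deriv^[j] tau3) ∧ HasCompactSupport (deriv^[j] tau3) := by
  induction j with
  | zero =>
    refine ⟨tau3_contDiff, HasCompactSupport.intro (isCompact_Icc (a := (-(3/2):ℝ)) (b := 3/2)) fun x hx => tau3_zero ?_⟩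
    by_contra h; push Not at h
    exact hx ⟨by linarith [(abs_lt.1 h).1], by linarith [(abs_lt.1 h).2]⟩
  | succ j ih =>
    rw [Function.iterate_succ_apply']
    refine ⟨(contDiff_infty_iff_deriv.1 ih.1).2, ih.2.deriv⟩

theorem TG.tau3aff (L : E4 →L[ℝ] ℝ) (s c : ℕ → ℝ) (hs : ∀ p, |s p| ≤ 1) (n : ℕ) :
    TG WU n (fun p x => tau3 (s p * L x + c p)) :=
  TG.aff (g := tau3) (fun j => (tau3_iter j).1.differentiable (by simp))
    (fun j => (tau3_iter j).2.exists_bound_of_continuous (tau3_iter j).1.continuous) L s c hs n 0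

def c1 : E4 →L[ℝ] ℝ := ContinuousLinearMap.fst ℝ _ _
def c2 : E4 →L[ℝ] ℝ := ContinuousLinearMap.fst ℝ _ _ ∘L ContinuousLinearMap.snd ℝ _ _
def c3 : E4 →L[ℝ] ℝ := ContinuousLinearMap.fst ℝ _ _ ∘L ContinuousLinearMap.snd ℝ _ _ ∘L ContinuousLinearMap.snd ℝ _ _
def c4 : E4 →L[ℝ] ℝ := ContinuousLinearMap.snd ℝ _ _ ∘L ContinuousLinearMap.snd ℝ _ _ ∘L ContinuousLinearMap.snd ℝ _ _

def chi (n : ℕ) (x : E4) : ℝ := Real.smoothTransition (1 * c1 x + (1 - n)) - Real.smoothTransition (1 * c1 x + (-n))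
def sn (n : ℕ) : ℝ := (((n:ℝ) + 2)^2)⁻¹
def psi (L : E4 →L[ℝ] ℝ) (n : ℕ) (x : E4) : ℝ := Real.smoothTransition (-sn n * L x + 2) * Real.smoothTransition (sn n * L x + 2)
def Rn (n : ℕ) (x : E4) : ℝ := 1 + ((n:ℝ)+1)⁻¹ * (1 + tau3 (1 * c1 x + (-n)))
def An (k n : ℕ) (x : E4) : ℝ := (chi n x * (psi c2 n x * psi c3 n x * psi c4 n x)) * ((Rn n x)⁻¹) ^ k

theorem sn_abs (n : ℕ) : |sn n| ≤ 1 := by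
  rw [sn, abs_of_nonneg (by positivity)]
  apply inv_le_one_of_one_le₀
  have : (0:ℝ) ≤ n := n.cast_nonneg
  nlinarith

theorem Rn_ge (n : ℕ) (x : E4) : 1/2 ≤ Rn n x := by
  have h := (abs_le.1 (tau3_abs (1 * c1 x + (-n)))).1
  have h1 : (0:ℝ) ≤ ((n:ℝ)+1)⁻¹ := by positivity
  have h2 : ((n:ℝ)+1)⁻¹ ≤ 1 := inv_le_one_of_one_le₀ (by linarith [(n.cast_nonneg : (0:ℝ) ≤ n)])
  unfold Rn; nlinarith

theorem An_TG (k b : ℕ) : TG WU b (An k) := by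
  have hc : TG WU b chi := TG.sub hWU (TG.sTaff c1 (fun _ => 1) (fun n => 1 - n) (by simp) b) (TG.sTaff c1 (fun _ => 1) (fun n => -n) (by simp) b)
  have hp : ∀ L, TG WU b (psi L) := fun L => TG.mul hWU (TG.sTaff L (fun n => -sn n) (fun n => 2) (by simpa using sn_abs) b)
     (TG.sTaff L sn (fun n => 2) sn_abs b)
  have hR : TG WU b Rn := TG.add hWU (TG.const 1) (TG.mul hWU (TG.const_x (φ := fun n : ℕ => ((n:ℝ)+1)⁻¹) continuous_of_discreteTopology ⟨1, 0, fun n x => by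
       rw [Real.norm_eq_abs, abs_of_nonneg (by positivity)]; simp
       exact inv_le_one_of_one_le₀ (by linarith [(n.cast_nonneg : (0:ℝ) ≤ n)])⟩) (TG.add hWU (TG.const 1) (TG.tau3aff c1 (fun _ => 1) (fun n => -n) (by simp) b)))
  have hRi := TG.inv hWU hR (1/2) (by norm_num) (fun n x => (Rn_ge n x).trans (le_abs_self _))
  exact TG.mul hWU (TG.mul hWU hc (TG.mul hWU (TG.mul hWU (hp c2) (hp c3)) (hp c4))) (TG.pow hWU hRi k)

theorem chi_supp {n : ℕ} {x : E4} (h : chi n x ≠ 0) : |x.1 - n| ≤ 1 := by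
  by_contra h'
  push Not at h'
  apply h
  have e : c1 x = x.1 := rfl
  unfold chi
  rw [e]
  rcases lt_abs.1 h' with h1 | h1
  · rw [Real.smoothTransition.one_of_one_le (by linarith), Real.smoothTransition.one_of_one_le (by linarith), sub_self]
  · rw [Real.smoothTransition.zero_of_nonpos (by linarith), Real.smoothTransition.zero_of_nonpos (by linarith), sub_self]

theorem psi_supp {L : E4 →L[ℝ] ℝ} {n : ℕ} {x : E4} (h : psi L n x ≠ 0) : |L x| ≤ 2 * ((n:ℝ)+2)^2 := by
  by_contra h'
  push Not at h'
  apply h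
  have hp : (0:ℝ) < ((n:ℝ)+2)^2 := by positivity
  have hs : sn n * ((n:ℝ)+2)^2 = 1 := by unfold sn; field_simp
  have hs0 : 0 < sn n := by unfold sn; positivity
  rcases lt_abs.1 h' with h1 | h1
  · have : 2 ≤ sn n * L x := by nlinarith
    rw [psi, Real.smoothTransition.zero_of_nonpos (by linarith), zero_mul]
  · have : 2 ≤ sn n * (-L x) := by nlinarith
    rw [psi, Real.smoothTransition.zero_of_nonpos (x := sn n * L x + 2) (by linarith), mul_zero]

theorem psi_one {L : E4 →L[ℝ] ℝ} {n : ℕ} {x : E4} (h : |L x| ≤ ((n:ℝ)+2)^2) : psi L n x = 1 := by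
  have hp : (0:ℝ) < ((n:ℝ)+2)^2 := by positivity
  have hs : sn n * ((n:ℝ)+2)^2 = 1 := by unfold sn; field_simp
  have hs0 : 0 < sn n := by unfold sn; positivity
  have := abs_le.1 h
  rw [psi, Real.smoothTransition.one_of_one_le (by nlinarith), Real.smoothTransition.one_of_one_le (by nlinarith), one_mul]

theorem An_supp {k n : ℕ} {x : E4} (h : An k n x ≠ 0) : ‖x‖ ≤ 2 * ((n:ℝ)+2)^2 := by
  unfold An at h
  simp only [mul_ne_zero_iff] at h
  obtain ⟨⟨h1, ⟨h2, h3⟩, h4⟩, -⟩ := h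
  have a1 := abs_le.1 (chi_supp h1)
  have b1 : |x.1| ≤ 2 * ((n:ℝ)+2)^2 := by
    have : (0:ℝ) ≤ n := n.cast_nonneg
    rw [abs_le]; constructor <;> nlinarith
  have b2 := psi_supp h2
  have b3 := psi_supp h3
  have b4 := psi_supp h4
  rw [Prod.norm_def, Prod.norm_def, Prod.norm_def]
  exact max_le b1 (max_le b2 (max_le b3 b4))

theorem chi_sum {x : E4} (hx : 0 ≤ x.1) : HasSum (fun n : ℕ => chi n x) 1 := by
  obtain ⟨N, hN⟩ := exists_nat_gt (x.1 + 1)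
  have h0 : ∀ n ∉ Finset.range (N+1), chi n x = 0 := fun n hn => by
    by_contra h
    have := abs_le.1 (chi_supp h)
    rw [Finset.mem_range, not_lt] at hn
    have : ((N+1:ℕ):ℝ) ≤ n := by exact_mod_cast hn
    push_cast at this
    linarith
  have h1 := hasSum_sum_of_ne_finset_zero (L := SummationFilter.unconditional _) h0
  have h2 : ∀ M : ℕ, ∑ n ∈ Finset.range M, chi n x = Real.smoothTransition (x.1 + 1) - Real.smoothTransition (x.1 + 1 - M) := fun M => by
    induction M with
    | zero => simp
    | succ M ih =>
      rw [Finset.sum_range_succ, ih]; unfold chi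
      have e : c1 x = x.1 := rfl
      rw [e]
      have e1 : 1 * x.1 + (1 - (M:ℝ)) = x.1 + 1 - M := by ring
      have e2 : 1 * x.1 + -(M:ℝ) = x.1 + 1 - (M+1:ℕ) := by push_cast; ring
      rw [e1, e2]; ring
  rw [h2, Real.smoothTransition.one_of_one_le (by linarith), Real.smoothTransition.zero_of_nonpos (by push_cast; linarith), sub_zero] at h1
  exact h1

def Tn (G : SchwartzMap PP ℂ) (k n : ℕ) (x : E4) : ℂ := ((((n:ℝ)+1)^k)⁻¹ : ℝ) • ((An k n x) • hG (Pop^[k] G) x)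

theorem Spec_bd {x : E4} (hx : x ∈ SpecR ∪ SpecS) : 0 ≤ x.1 ∧ |x.2.1| ≤ (x.1+1)^2 ∧ |x.2.2.1| ≤ (x.1+1)^2 ∧ |x.2.2.2| ≤ (x.1+1)^2 := by
  rcases hx with ⟨lam, hl, l, r, rfl⟩ | ⟨z, r, rfl⟩
  · have h0 : 0 ≤ lam * l := by positivity
    have hr := sq_nonneg r
    set s := lam * (2 * l + 1) + r^2 with hs
    have hs1 : lam + r^2 ≤ s := by rw [hs]; nlinarith
    simp only
    refine ⟨by positivity, ?_, ?_, ?_⟩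
    · rw [abs_of_nonneg (by positivity)]; nlinarith
    · rw [abs_le]; constructor <;> nlinarith [sq_nonneg (r-1), sq_nonneg (r+1), mul_pos hl hl, mul_nonneg hl.le (sq_nonneg (r-1)), mul_nonneg hl.le (sq_nonneg (r+1)), sq_nonneg (lam - r), sq_nonneg (lam+r)]
    · rw [abs_of_nonneg (by positivity)]; nlinarith
  · simp only [abs_zero]
    refine ⟨by positivity, by positivity, by positivity, ?_⟩
    rw [abs_of_nonneg (by positivity)]; nlinarith [sq_nonneg z, sq_nonneg r]

theorem Tn_spec (G : SchwartzMap PP ℂ) (k n : ℕ) {x : E4} (hx : x ∈ SpecR ∪ SpecS) : Tn G k n x = (chi n x : ℂ) * hG G x := by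
  by_cases h : chi n x = 0
  · simp [Tn, An, h]
  have h1 := chi_supp h
  obtain ⟨b1, b2, b3, b4⟩ := Spec_bd hx
  have hle : (x.1 + 1)^2 ≤ ((n:ℝ)+2)^2 := by
    have := (abs_le.1 h1).2
    gcongr ?_ ^ 2
    linarith
  have p2 : psi c2 n x = 1 := psi_one (b2.trans hle)
  have p3 : psi c3 n x = 1 := psi_one (b3.trans hle)
  have p4 : psi c4 n x = 1 := psi_one (b4.trans hle)
  have e1 : (1 * c1 x + (-(n:ℝ))) = x.1 - n := by rw [one_mul]; rfl
  have hR : Rn n x = ((n:ℝ)+1)⁻¹ * (2 + x.1) := by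
    rw [Rn, e1, tau3_one h1]; field_simp; ring
  rw [Tn, An, p2, p3, p4, hR, hG_popk k G hx]
  have h2 : (2 + (x.1:ℂ)) ≠ 0 := by
    have : (2 + x.1 : ℝ) ≠ 0 := by positivity
    exact_mod_cast this
  have h3 : ((n:ℂ) + 1) ≠ 0 := by exact_mod_cast (Nat.succ_ne_zero n)
  simp only [Complex.real_smul]
  push_cast
  field_simp
  rw [div_pow]
  field_simp

end Cutsec

set_option linter.unusedSectionVars false
set_option linter.unusedSimpArgs false
set_option linter.unusedVariables false
section Diagsec
open Topology

theorem hG_smooth (G : SchwartzMap PP ℂ) : ContDiff ℝ (⊤:ℕ∞) (hG G) := contDiff_infty.2 fun n => hG_contDiff n G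
theorem An_smooth (k n : ℕ) : ContDiff ℝ (⊤:ℕ∞) (An k n) := contDiff_infty.2 fun b => (An_TG k b).contDiff n
theorem Tn_smooth (G : SchwartzMap PP ℂ) (k n : ℕ) : ContDiff ℝ (⊤:ℕ∞) (Tn G k n) :=
  (contDiff_const (c := ((((n:ℝ)+1)^k)⁻¹ : ℝ))).smul ((An_smooth k n).smul (hG_smooth (Pop^[k] G)))

theorem Tn_out (G : SchwartzMap PP ℂ) (k n i : ℕ) {x : E4} (hx : 2 * ((n:ℝ)+2)^2 < ‖x‖) : iteratedFDeriv ℝ i (Tn G k n) x = 0 := by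
  have h1 : tsupport (Tn G k n) ⊆ Metric.closedBall 0 (2 * ((n:ℝ)+2)^2) := by
    refine closure_minimal (fun y hy => ?_) Metric.isClosed_closedBall
    rw [mem_closedBall_zero_iff]
    refine An_supp (k := k) fun h => hy ?_
    simp [Tn, h]
  by_contra h
  have := h1 (support_iteratedFDeriv_subset (𝕜 := ℝ) i h)
  rw [mem_closedBall_zero_iff] at this
  linarith

theorem Tn_bound : ∃ e : ℕ → ℕ, ∀ b k, ∃ (B : ℝ) (m : ℕ), 0 ≤ B ∧ ∀ (G : SchwartzMap PP ℂ) (n i : ℕ), i ≤ b → ∀ x,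
    (1 + ‖x‖)^b * ‖iteratedFDeriv ℝ i (Tn G k n) x‖ ≤ B * SN m G * (((n:ℝ)+1)^(e b) * (((n:ℝ)+1)^k)⁻¹) := by
  choose Ch e0 mh hCh hh using hG_bound
  refine ⟨fun b => 2 * (e0 b + b), fun b k => ?_⟩
  obtain ⟨D, kd, hD, hA⟩ := (An_TG k b).bound hWU
  obtain ⟨Cp, mp, hCp, hp⟩ := SN_popk k (mh b)
  refine ⟨2^b * D * Ch b * Cp * 9^(e0 b + b), mp, by have := hCh b; positivity, fun G n i hi x => ?_⟩
  have hC0 := hCh b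
  have hSN := SN_nonneg mp G
  by_cases hx : 2 * ((n:ℝ)+2)^2 < ‖x‖
  · rw [Tn_out G k n i hx, norm_zero, mul_zero]; positivity
  push Not at hx
  have hn : (0:ℝ) ≤ n := n.cast_nonneg
  have hx1 : 1 + ‖x‖ ≤ 9 * ((n:ℝ)+1)^2 := by nlinarith
  have e1 : iteratedFDeriv ℝ i (Tn G k n) x = ((((n:ℝ)+1)^k)⁻¹ : ℝ) • iteratedFDeriv ℝ i (fun x => (An k n x) • hG (Pop^[k] G) x) x := by
    have := iteratedFDeriv_const_smul_apply (𝕜 := ℝ) (i := i) (a := ((((n:ℝ)+1)^k)⁻¹ : ℝ)) (f := fun x => (An k n x) • hG (Pop^[k] G) x) (x := x)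
      (((An_smooth k n).smul (hG_smooth _)).contDiffAt.of_le (by exact_mod_cast le_top))
    exact this
  have e2 : ‖iteratedFDeriv ℝ i (fun x => (An k n x) • hG (Pop^[k] G) x) x‖ ≤ 2^i * (D * (Ch b * SN (mh b) (Pop^[k] G) * (1 + ‖x‖)^(e0 b))) := by
    refine (norm_iteratedFDeriv_smul_le (𝕜 := ℝ) (An_smooth k n) (hG_smooth (Pop^[k] G)) x (n := i) (by exact_mod_cast le_top)).trans ?_
    have : (2:ℝ)^i = ∑ j ∈ Finset.range (i+1), (i.choose j : ℝ) := by exact_mod_cast (Nat.sum_range_choose i).symm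
    rw [this, Finset.sum_mul]
    refine Finset.sum_le_sum fun j hj => ?_
    have hj' : j ≤ i := by simpa [Nat.lt_succ_iff] using hj
    rw [mul_assoc]
    have a1 := hA j (by omega) n x
    simp only [WU, one_pow, mul_one] at a1
    have a2 := hh b (Pop^[k] G) (i - j) (by omega) x
    gcongr
  have e3 : (2:ℝ)^i ≤ 2^b := pow_le_pow_right₀ one_le_two hi
  have e4 := hp G
  rw [e1, norm_smul, Real.norm_eq_abs, abs_of_nonneg (by positivity)]
  have hS2 := SN_nonneg (mh b) (Pop^[k] G)
  calc _ ≤ (1 + ‖x‖)^b * ((((n:ℝ)+1)^k)⁻¹ * (2^i * (D * (Ch b * SN (mh b) (Pop^[k] G) * (1 + ‖x‖)^(e0 b))))) := by gcongr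
    _ ≤ (1 + ‖x‖)^b * ((((n:ℝ)+1)^k)⁻¹ * (2^b * (D * (Ch b * (Cp * SN mp G) * (1 + ‖x‖)^(e0 b))))) := by gcongr
    _ = (2^b * D * Ch b * Cp * SN mp G * (((n:ℝ)+1)^k)⁻¹) * (1 + ‖x‖)^(e0 b + b) := by rw [pow_add]; ring
    _ ≤ (2^b * D * Ch b * Cp * SN mp G * (((n:ℝ)+1)^k)⁻¹) * (9 * ((n:ℝ)+1)^2)^(e0 b + b) := by gcongr
    _ = _ := by rw [mul_pow, ← pow_mul]; ring

theorem diag (e : ℕ → ℕ) (B : ℕ → ℕ → ℝ) (hB : ∀ b k, 0 ≤ B b k) (k1 a : ℕ) (hk1 : a ≤ k1) (hk2 : e a + 3 ≤ k1) (ε : ℝ) (hε : 0 < ε) :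
    ∃ κ : ℕ → ℕ, (∀ b, Summable fun n : ℕ => B b (κ n) * (((n:ℝ)+1)^(e b) * (((n:ℝ)+1)^(κ n))⁻¹)) ∧
      ∀ n : ℕ, B a (κ n) * (((n:ℝ)+1)^(e a) * (((n:ℝ)+1)^(κ n))⁻¹) ≤ (ε + B a k1) * (((n:ℝ)+1)^2)⁻¹ := by
  classical
  set P : ℕ → ℕ → Prop := fun n j => ∀ b ≤ j, e b + 3 ≤ j → B b j * (((n:ℝ)+1)^(e b) * (((n:ℝ)+1)^j)⁻¹) ≤ ε * (((n:ℝ)+1)^2)⁻¹ with hP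
  have hsq : Summable fun n : ℕ => (((n:ℝ)+1)^2)⁻¹ := by
    have := (summable_nat_add_iff 1).2 (Real.summable_nat_pow_inv.2 (one_lt_two))
    simpa using this
  have hpw : ∀ (n c j d : ℕ), c + d ≤ j → ((n:ℝ)+1)^c * (((n:ℝ)+1)^j)⁻¹ ≤ (((n:ℝ)+1)^d)⁻¹ := fun n c j d h => by
    have h1 : (1:ℝ) ≤ (n:ℝ)+1 := by linarith [(n.cast_nonneg : (0:ℝ) ≤ n)]
    rw [← div_eq_mul_inv, div_le_iff₀ (by positivity), ← div_eq_inv_mul, le_div_iff₀ (by positivity), ← pow_add]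
    exact pow_le_pow_right₀ h1 h
  have hev : ∀ j, ∀ᶠ n in Filter.atTop, P n j := fun j => by
    have : ∀ b ∈ Finset.range (j+1), ∀ᶠ n : ℕ in Filter.atTop, e b + 3 ≤ j → B b j * (((n:ℝ)+1)^(e b) * (((n:ℝ)+1)^j)⁻¹) ≤ ε * (((n:ℝ)+1)^2)⁻¹ := by
      intro b _
      obtain ⟨N, hN⟩ := exists_nat_ge (B b j / ε)
      filter_upwards [Filter.eventually_ge_atTop N] with n hn hj
      have hn' : (N:ℝ) ≤ n := by exact_mod_cast hn
      have h2 : B b j ≤ ε * ((n:ℝ)+1) := by rw [div_le_iff₀ hε] at hN; nlinarith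
      calc _ ≤ (ε * ((n:ℝ)+1)) * (((n:ℝ)+1)^3)⁻¹ := by
            gcongr
            exact hpw n _ _ _ hj
        _ = _ := by field_simp
    have := (Finset.eventually_all _).2 this
    filter_upwards [this] with n hn b hb
    exact hn b (Finset.mem_range.2 (by omega))
  set f : ℕ → ℕ := fun n => Nat.findGreatest (P n) n
  have hf : ∀ J, ∀ᶠ n in Filter.atTop, J ≤ f n := fun J => by
    filter_upwards [hev J, Filter.eventually_ge_atTop J] with n h1 h2
    exact Nat.le_findGreatest h2 h1
  have hfP : ∀ n, k1 ≤ f n → P n (f n) := fun n h => Nat.findGreatest_of_ne_zero (P := P n) (n := n) (m := f n) rfl (by omega)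
  refine ⟨fun n => if k1 ≤ f n then f n else k1, fun b => ?_, fun n => ?_⟩
  · refine Summable.of_norm_bounded_eventually_nat (hsq.mul_left ε) ?_
    filter_upwards [hf k1, hf b, hf (e b + 3)] with n h1 h2 h3
    rw [if_pos h1, Real.norm_eq_abs, abs_of_nonneg (by have := hB b (f n); positivity)]
    exact hfP n h1 b h2 h3
  · have := hB a k1
    by_cases h : k1 ≤ f n
    · simp only [if_pos h]
      refine (hfP n h a (by omega) (by omega)).trans ?_
      gcongr; linarith
    · simp only [if_neg h]
      calc _ ≤ B a k1 * (((n:ℝ)+1)^2)⁻¹ := by gcongr; exact hpw n _ _ _ (by omega)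
        _ ≤ _ := by gcongr; linarith

theorem SN_zero {m : ℕ} {G : SchwartzMap PP ℂ} (h : SN m G = 0) : G = 0 := by
  ext p
  have := SN_pt (a := m) (k := 0) (n := 0) (Nat.zero_le _) (Nat.zero_le _) G p
  rw [h] at this
  simp at this
  simpa using this

theorem main_ex (a : ℕ) : ∃ C, 0 < C ∧ ∃ a' : ℕ, ∀ G : SchwartzMap PP ℂ, ∃ g : SchwartzMap E4 ℂ, GT4Eq G g ∧ SN a g ≤ C * SN a' G := by
  obtain ⟨e, h⟩ := Tn_bound
  choose B m hB hT using h
  set k1 := max a (e a + 3)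
  set S : ℝ := ∑' n : ℕ, (((n:ℝ)+1)^2)⁻¹ with hS
  have hsq : Summable fun n : ℕ => (((n:ℝ)+1)^2)⁻¹ := by
    have := (summable_nat_add_iff 1).2 (Real.summable_nat_pow_inv.2 (one_lt_two))
    simpa using this
  have hS0 : 0 ≤ S := tsum_nonneg fun n => by positivity
  have hBa := hB a k1
  refine ⟨(1 + B a k1) * S + 1, by positivity, m a k1, fun G => ?_⟩
  by_cases h0 : SN (m a k1) G = 0
  · have := SN_zero h0
    subst this
    refine ⟨0, ⟨fun lam hl l r => by simp, fun z r => by simp⟩, ?_⟩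
    have : SN a (0 : SchwartzMap E4 ℂ) = 0 := map_zero _
    rw [this]; exact mul_nonneg (by positivity) (SN_nonneg _ _)
  have hpos : 0 < SN (m a k1) G := lt_of_le_of_ne (SN_nonneg _ _) (Ne.symm h0)
  obtain ⟨κ, hs, ha⟩ := diag e (fun b k => B b k * SN (m b k) G) (fun b k => mul_nonneg (hB b k) (SN_nonneg _ _)) k1 a (le_max_left _ _) (le_max_right _ _) _ hpos
  set u : ℕ → ℕ → ℝ := fun b n => B b (κ n) * SN (m b (κ n)) G * (((n:ℝ)+1)^(e b) * (((n:ℝ)+1)^(κ n))⁻¹) with hu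
  have hu' : ∀ b i n x, i ≤ b → (1 + ‖x‖)^b * ‖iteratedFDeriv ℝ i (Tn G (κ n) n) x‖ ≤ u b n := fun b i n x hi => hT b (κ n) G n i hi x
  have hbase : ∀ i n x, ‖iteratedFDeriv ℝ i (Tn G (κ n) n) x‖ ≤ u i n := fun i n x => by
    refine le_trans ?_ (hu' i i n x le_rfl)
    refine le_mul_of_one_le_left (norm_nonneg _) (one_le_pow₀ (by linarith [norm_nonneg x]))
  have hsm : ∀ n, ContDiff ℝ (⊤:ℕ∞) (Tn G (κ n) n) := fun n => Tn_smooth G (κ n) n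
  have hcd : ContDiff ℝ (⊤:ℕ∞) (fun x => ∑' n, Tn G (κ n) n x) :=
    contDiff_tsum (v := u) hsm (fun k _ => hs k) (fun k n x _ => hbase k n x)
  have hit : ∀ i : ℕ, iteratedFDeriv ℝ i (fun x => ∑' n, Tn G (κ n) n x) = fun x => ∑' n, iteratedFDeriv ℝ i (Tn G (κ n) n) x := fun i =>
    iteratedFDeriv_tsum (v := u) (N := (⊤:ℕ∞)) hsm (fun k _ => hs k) (fun k n x _ => hbase k n x) (by exact_mod_cast le_top)
  have hdec : ∀ b i x, i ≤ b → (1 + ‖x‖)^b * ‖iteratedFDeriv ℝ i (fun x => ∑' n, Tn G (κ n) n x) x‖ ≤ ∑' n, u b n := fun b i x hi => by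
    rw [hit i]
    have hsn : Summable fun n => ‖iteratedFDeriv ℝ i (Tn G (κ n) n) x‖ :=
      Summable.of_nonneg_of_le (fun n => norm_nonneg _) (fun n => hbase i n x) (hs i)
    calc _ ≤ (1 + ‖x‖)^b * ∑' n, ‖iteratedFDeriv ℝ i (Tn G (κ n) n) x‖ := by
          gcongr; exact norm_tsum_le_tsum_norm hsn
      _ = ∑' n, (1 + ‖x‖)^b * ‖iteratedFDeriv ℝ i (Tn G (κ n) n) x‖ := (tsum_mul_left).symm
      _ ≤ _ := Summable.tsum_le_tsum (fun n => hu' b i n x hi) (hsn.mul_left _) (hs b)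
  have hle : ∀ (b k : ℕ) (x : E4), k ≤ b → ‖x‖^k ≤ (1 + ‖x‖)^b := fun b k x hk =>
    (pow_le_pow_left₀ (norm_nonneg x) (by linarith) k).trans (pow_le_pow_right₀ (by linarith [norm_nonneg x]) hk)
  let g : SchwartzMap E4 ℂ := { toFun := fun x => ∑' n, Tn G (κ n) n x, smooth' := hcd, decay' := fun k i => ⟨∑' n, u (max k i) n, fun x => by
    refine le_trans ?_ (hdec (max k i) i x (le_max_right _ _))
    gcongr
    exact hle _ _ x (le_max_left _ _)⟩ }
  have hspec : ∀ x ∈ SpecR ∪ SpecS, g x = hG G x := fun x hx => by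
    show ∑' n, Tn G (κ n) n x = hG G x
    simp only [Tn_spec G _ _ hx]
    have h1 : HasSum (fun n => (chi n x : ℂ)) ((1:ℝ):ℂ) := Complex.hasSum_ofReal.2 (chi_sum (Spec_bd hx).1)
    simpa using (h1.mul_right (hG G x)).tsum_eq
  refine ⟨g, ⟨fun lam hl l r => ?_, fun z r => ?_⟩, ?_⟩
  · rw [hspec _ (Or.inl ⟨lam, hl, l, r, rfl⟩), hG_reg G hl]
  · rw [hspec _ (Or.inr ⟨z, r, rfl⟩), hG_sing]
  · have hua : ∑' n, u a n ≤ (1 + B a k1) * S * SN (m a k1) G := by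
      calc _ ≤ ∑' n : ℕ, (SN (m a k1) G + B a k1 * SN (m a k1) G) * (((n:ℝ)+1)^2)⁻¹ :=
            Summable.tsum_le_tsum ha (hs a) (hsq.mul_left _)
        _ = _ := by rw [tsum_mul_left, ← hS]; ring
    have hnn : 0 ≤ ∑' n, u a n := (by positivity : (0:ℝ) ≤ _).trans (hdec a 0 0 (Nat.zero_le _))
    refine (Seminorm.finset_sup_apply_le hnn fun i hi => ?_).trans (hua.trans ?_)
    · have hi := Finset.mem_Iic.1 hi
      refine SchwartzMap.seminorm_le_bound ℝ _ _ g hnn fun x => ?_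
      refine le_trans ?_ (hdec a i.2 x hi.2)
      gcongr
      · exact hle _ _ x hi.1
      · exact le_rfl
    · nlinarith

end Diagsec

/-- Every Schwartz `K'`-invariant function on `N'` has a Schwartz extension of its Gelfand
transform to `ℝ⁴`; moreover the extension can be chosen with seminorm control. -/
theorem statement4 :
    (∀ G : SchwartzMap ((Fin 3 → ℝ) × ℝ) ℂ, InvK' ⇑G →
      ∃ g : SchwartzMap (ℝ × ℝ × ℝ × ℝ) ℂ, GT4Eq G g) ∧
    (∀ a : ℕ, ∃ C : ℝ, 0 < C ∧ ∃ a' : ℕ,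
      ∀ G : SchwartzMap ((Fin 3 → ℝ) × ℝ) ℂ, InvK' ⇑G →
        ∃ g : SchwartzMap (ℝ × ℝ × ℝ × ℝ) ℂ, GT4Eq G g ∧ SN a g ≤ C * SN a' G) := by
  have key : ∀ a : ℕ, ∃ C : ℝ, 0 < C ∧ ∃ a' : ℕ, ∀ G : SchwartzMap ((Fin 3 → ℝ) × ℝ) ℂ, InvK' G →
      ∃ g : SchwartzMap (ℝ × ℝ × ℝ × ℝ) ℂ, GT4Eq G g ∧ SN a g ≤ C * SN a' G := by
    intro a
    obtain ⟨C, hC, a', h⟩ := main_ex a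
    exact ⟨C, hC, a', fun G _ => h G⟩
  refine ⟨fun G hG' => ?_, key⟩
  obtain ⟨C, hC, a', h⟩ := key 0
  obtain ⟨g, hg, _⟩ := h G hG'
  exact ⟨g, hg⟩
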